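/- Stratified Datalog extended with the choice construct expresses exactly the DB-PTIME queries, i.e., all queries computable in time polynomial in the size of the database; in contrast, stratified Datalog without choice cannot express all DB-PTIME queries unless a predefined total order on the universe is assumed, an assumption violating the genericity principle. -/

import Mathlib

/-!
# STATEMENT 6

Stratified Datalog extended with the choice construct expresses exactly the
DB-PTIME queries, i.e. all (generic) queries computable in time polynomial in
the size of the database; in contrast, stratified Datalog without choice
cannot express all DB-PTIME queries unless a predefined total order on the
universe is assumed — an assumption violating the genericity principle: over
unordered databases some generic DB-PTIME query is not expressible without
choice.

Choice programs, stratification, first-order equivalents and stable models are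
as in Statements 0 and 5 (grounding over the active domain); polynomial-time
computability is formalized from first principles via deterministic Turing
machines, as in Statement 3, with explicit binary encodings.  A query is a
genericity-respecting mapping from finite databases over the domain `ℕ` to
output relations of a fixed arity; it is expressed by a (stratified, choice)
program when, on every finite database, stable models of the program exist and
all of them agree with the query on the designated answer predicate (thus a
*deterministic* query, computed nondeterministically).
-/

/-- A ground normal logic-program rule over ground atoms `α`. -/
structure GRule (α : Type) where
  head : α
  pos : Set α
  neg : Set α

/-- A ground normal logic program is a set of ground rules. -/
abbrev GProgram (α : Type) := Set (GRule α)

/-- `M` satisfies a ground rule. -/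
def GRule.Sat {α : Type} (r : GRule α) (M : Set α) : Prop :=
  r.pos ⊆ M → (∀ a ∈ r.neg, a ∉ M) → r.head ∈ M

/-- `M` is a model of (i.e. closed under) the program `P`. -/
def IsModel {α : Type} (P : GProgram α) (M : Set α) : Prop := ∀ r ∈ P, r.Sat M

/-- The Gelfond–Lifschitz reduct of `P` with respect to `M`: delete every rule
whose negative body intersects `M`, and delete the negative bodies of the
remaining rules. -/
def reduct {α : Type} (P : GProgram α) (M : Set α) : GProgram α :=
  {r | ∃ r' ∈ P, (∀ a ∈ r'.neg, a ∉ M) ∧ r = ⟨r'.head, r'.pos, ∅⟩}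

/-- The least (Herbrand) model of a program: the intersection of all models. -/
def leastModel {α : Type} (P : GProgram α) : Set α := ⋂₀ {N | IsModel P N}

/-- `M` is a (total, two-valued) stable model of `P` in the sense of
Gelfond–Lifschitz: `M` is the least model of the reduct of `P` by `M`.
Every such model is total: each atom is either true (in `M`) or false. -/
def IsStableModel {α : Type} (P : GProgram α) (M : Set α) : Prop :=
  M = leastModel (reduct P M)

/-! ## Datalog with choice goals -/

/-- Terms: variables (named by naturals) and constants from `C`. -/
inductive Term (C : Type) where
  | var (v : ℕ)
  | const (c : C)

/-- A relational schema: predicate symbols with arities. -/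
structure Schema where
  pred : Type
  ar : pred → ℕ

/-- A (possibly non-ground) atom over schema `S` and constants `C`. -/
structure Atom (S : Schema) (C : Type) where
  p : S.pred
  args : Fin (S.ar p) → Term C

/-- A ground atom. -/
structure GAtom (S : Schema) (C : Type) where
  p : S.pred
  args : Fin (S.ar p) → C

/-- A Datalog rule whose body may additionally contain choice goals
`choice((X),(Y))`, recorded in `cgoals` as pairs `(X, Y)` of disjoint lists of
variables, with nonempty right side `Y`. -/
structure CRule (S : Schema) (C : Type) where
  head : Atom S C
  pos : List (Atom S C)
  neg : List (Atom S C)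
  cgoals : List (List ℕ × List ℕ)
  cgoals_disjoint : ∀ g ∈ cgoals, ∀ v ∈ g.1, v ∉ g.2
  cgoals_right_ne : ∀ g ∈ cgoals, g.2 ≠ []

/-- A choice program: a finite list of rules, possibly with choice goals. -/
abbrev CProgram (S : Schema) (C : Type) := List (CRule S C)

/-- A choice program is *positive* when its non-choice goals contain no
negation. -/
def CProgram.Positive {S : Schema} {C : Type} (P : CProgram S C) : Prop :=
  ∀ r ∈ P, r.neg = []

def Term.eval {C : Type} (ν : ℕ → C) : Term C → C
  | .var v => ν v
  | .const c => c

def Atom.ground {S : Schema} {C : Type} (a : Atom S C) (ν : ℕ → C) : GAtom S C :=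
  ⟨a.p, fun i => (a.args i).eval ν⟩

/-- `W`: the list of all variables occurring in the choice goals of a rule. -/
def CRule.W {S : Schema} {C : Type} (r : CRule S C) : List ℕ :=
  (r.cgoals.flatMap fun g => g.1 ++ g.2).dedup

/-- Atoms of the first-order equivalent `foe(P)`: the original (base) atoms
together with `chosen_r` and `diffChoice_r` atoms for each choice rule `r`
(rules are referred to by their position in the program). -/
inductive FAtom (S : Schema) (C : Type) where
  | base (a : GAtom S C)
  | chosen (r : ℕ) (w : List C)
  | diff (r : ℕ) (w : List C)

/-- The (ground) positive body of an instantiated rule, as base atoms. -/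
def posBody {S : Schema} {C : Type} (r : CRule S C) (ν : ℕ → C) : Set (FAtom S C) :=
  {x | ∃ a ∈ r.pos, x = FAtom.base (a.ground ν)}

/-- The (ground) negative body of an instantiated rule, as base atoms. -/
def negBody {S : Schema} {C : Type} (r : CRule S C) (ν : ℕ → C) : Set (FAtom S C) :=
  {x | ∃ a ∈ r.neg, x = FAtom.base (a.ground ν)}


/-- The first-order equivalent `foe(P)` of a choice program `P` over the
database `edb`, with the grounding substitutions restricted to the domain
`D`. -/
def foeD {S : Schema} {C : Type} (P : CProgram S C) (D : Set C)
    (edb : Set (GAtom S C)) : GProgram (FAtom S C) :=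
  {r | ∃ a ∈ edb, r = ⟨FAtom.base a, ∅, ∅⟩} ∪
  {r | ∃ i : Fin P.length, ∃ ν : ℕ → C, (∀ v, ν v ∈ D) ∧ (P.get i).cgoals = [] ∧
        r = ⟨FAtom.base ((P.get i).head.ground ν), posBody (P.get i) ν,
             negBody (P.get i) ν⟩} ∪
  {r | ∃ i : Fin P.length, ∃ ν : ℕ → C, (∀ v, ν v ∈ D) ∧ (P.get i).cgoals ≠ [] ∧
        r = ⟨FAtom.base ((P.get i).head.ground ν),
             insert (FAtom.chosen i ((P.get i).W.map ν)) (posBody (P.get i) ν),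
             negBody (P.get i) ν⟩} ∪
  {r | ∃ i : Fin P.length, ∃ ν : ℕ → C, (∀ v, ν v ∈ D) ∧ (P.get i).cgoals ≠ [] ∧
        r = ⟨FAtom.chosen i ((P.get i).W.map ν), posBody (P.get i) ν,
             insert (FAtom.diff i ((P.get i).W.map ν)) (negBody (P.get i) ν)⟩} ∪
  {r | ∃ i : Fin P.length, ∃ g ∈ (P.get i).cgoals, ∃ ν ν' : ℕ → C,
        (∀ v, ν v ∈ D) ∧ (∀ v, ν' v ∈ D) ∧
        (∀ v ∈ g.1, ν v = ν' v) ∧ (∃ v ∈ g.2, ν v ≠ ν' v) ∧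
        r = ⟨FAtom.diff i ((P.get i).W.map ν),
             {FAtom.chosen i ((P.get i).W.map ν')}, ∅⟩}

/-- The active domain of a database: all constants occurring in its facts. -/
def activeDom {S : Schema} {C : Type} (edb : Set (GAtom S C)) : Set C :=
  {c | ∃ a ∈ edb, ∃ i, a.args i = c}

def Atom.consts {S : Schema} {C : Type} (a : Atom S C) : Set C :=
  {c | ∃ i, a.args i = Term.const c}

/-- The constants occurring in a choice program. -/
def CProgram.consts {S : Schema} {C : Type} (P : CProgram S C) : Set C :=
  {c | ∃ r ∈ P, c ∈ r.head.consts ∨ (∃ a ∈ r.pos, c ∈ a.consts) ∨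
        ∃ a ∈ r.neg, c ∈ a.consts}

/-- The grounding domain for program `P` on database `edb`. -/
def gdom {S : Schema} {C : Type} (P : CProgram S C) (edb : Set (GAtom S C)) :
    Set C :=
  activeDom edb ∪ CProgram.consts P

/-! ## Deterministic Turing machines, polynomial time, NP-hardness -/

/-- A deterministic single-tape Turing machine with states `Fin (q+1)`
(initial state `0`), tape alphabet `Fin (k+3)` (blank `0`; `1`, `2` encode the
booleans `false`, `true`) and transition function `δ` (`none` means halt; the
`Bool` component is the direction of the head move, `true` = right). -/
structure TM where
  q : ℕ
  k : ℕ
  δ : Fin (q + 1) → Fin (k + 3) → Option (Fin (q + 1) × Fin (k + 3) × Bool)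

/-- A configuration: current state, tape content, head position. -/
structure TMCfg (M : TM) where
  state : Fin (M.q + 1)
  tape : ℤ → Fin (M.k + 3)
  head : ℤ

def TM.step (M : TM) (c : TMCfg M) : Option (TMCfg M) :=
  match M.δ c.state (c.tape c.head) with
  | none => none
  | some (q', s', mv) =>
      some ⟨q', Function.update c.tape c.head s',
            if mv then c.head + 1 else c.head - 1⟩

/-- Run for `n` steps (`none` if the machine halts strictly before). -/
def TM.iter (M : TM) : ℕ → TMCfg M → Option (TMCfg M)
  | 0, c => some c
  | n + 1, c => (M.step c).bind (M.iter n)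

/-- Starting from `c`, `M` halts after exactly `t` steps in configuration
`c'`. -/
def TM.HaltsIn (M : TM) (c : TMCfg M) (t : ℕ) (c' : TMCfg M) : Prop :=
  M.iter t c = some c' ∧ M.step c' = none

def TM.boolSym (M : TM) (b : Bool) : Fin (M.k + 3) := if b then 2 else 1

/-- The initial configuration on input `x`: the input written in cells
`0, …, |x|-1`, the rest blank, head on cell `0`, state `0`. -/
def TM.init (M : TM) (x : List Bool) : TMCfg M :=
  ⟨0, fun i => if h : 0 ≤ i ∧ i.toNat < x.length then M.boolSym (x.get ⟨i.toNat, h.2⟩)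
               else 0, 0⟩

/-- The tape of `c` holds output `y`: cells `0, …, |y|-1` hold the symbols of
`y` and cell `|y|` is blank. -/
def TM.OutputIs (M : TM) (c : TMCfg M) (y : List Bool) : Prop :=
  (∀ i : Fin y.length, c.tape ((i : ℕ) : ℤ) = M.boolSym (y.get i)) ∧
  c.tape (y.length : ℤ) = 0

def TM.ComputesInTime (M : TM) (f : List Bool → List Bool) (T : ℕ → ℕ) : Prop :=
  ∀ x, ∃ t ≤ T x.length, ∃ c', M.HaltsIn (M.init x) t c' ∧ M.OutputIs c' (f x)

/-- `f` is computable in polynomial time. -/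
def PolyTimeComputable (f : List Bool → List Bool) : Prop :=
  ∃ (M : TM) (p : Polynomial ℕ), M.ComputesInTime f fun n => p.eval n

/-- The language `L` is decidable in (deterministic) polynomial time. -/
def InPolyTime (L : Set (List Bool)) : Prop :=
  ∃ f, PolyTimeComputable f ∧ ∀ x, x ∈ L ↔ f x = [true]

/-- A simple self-delimiting pairing of binary strings. -/
def pairCode (x y : List Bool) : List Bool :=
  (x.flatMap fun b => [b, b]) ++ [false, true] ++ y

/-- `L` is in NP: membership has polynomially short certificates, checkable in
polynomial time. -/
def InNP (L : Set (List Bool)) : Prop :=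
  ∃ (V : Set (List Bool)) (p : Polynomial ℕ), InPolyTime V ∧
    ∀ x, x ∈ L ↔ ∃ c, c.length ≤ p.eval x.length ∧ pairCode x c ∈ V

/-- `L` is NP-hard (under polynomial-time many-one reductions). -/
def NPHard (L : Set (List Bool)) : Prop :=
  ∀ L', InNP L' → ∃ f, PolyTimeComputable f ∧ ∀ x, x ∈ L' ↔ f x ∈ L

/-! ## Binary encodings of databases and models -/

def encListAux (l : List (List Bool)) : List Bool :=
  l.flatMap fun x => (x.flatMap fun b => [b, b]) ++ [false, true]

def encNat (n : ℕ) : List Bool := Nat.bits n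

def encNats (l : List ℕ) : List Bool := encListAux (l.map encNat)

def encGAtom {m : ℕ} {ar : Fin m → ℕ} (a : GAtom ⟨Fin m, ar⟩ ℕ) : List Bool :=
  encNats ((a.p : ℕ) :: List.ofFn a.args)

def encDB {m : ℕ} {ar : Fin m → ℕ} (l : List (GAtom ⟨Fin m, ar⟩ ℕ)) : List Bool :=
  encListAux (l.map encGAtom)

def encFAtom {m : ℕ} {ar : Fin m → ℕ} : FAtom ⟨Fin m, ar⟩ ℕ → List Bool
  | .base a => encListAux [encNat 0, encGAtom a]
  | .chosen r w => encListAux [encNat 1, encNat r, encNats w]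
  | .diff r w => encListAux [encNat 2, encNat r, encNats w]

def encModel {m : ℕ} {ar : Fin m → ℕ} (l : List (FAtom ⟨Fin m, ar⟩ ℕ)) :
    List Bool :=
  encListAux (l.map encFAtom)


/-- `σ` is a stratification of the program `P` (choice goals ignored). -/
def StratifiedBy {S : Schema} {C : Type} (P : CProgram S C) (σ : S.pred → ℕ) : Prop :=
  ∀ r ∈ P, (∀ a ∈ r.pos, σ a.p ≤ σ r.head.p) ∧ (∀ a ∈ r.neg, σ a.p < σ r.head.p)

/-! ## Queries, genericity, DB-PTIME, expressibility -/

/-- The input schema with `m` predicates of arities `ar`. -/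
def inSchema (m : ℕ) (ar : Fin m → ℕ) : Schema := ⟨Fin m, ar⟩

/-- Renaming of a database along a permutation of the domain. -/
def renameDB {m : ℕ} {ar : Fin m → ℕ} (π : ℕ ≃ ℕ)
    (db : Set (GAtom (inSchema m ar) ℕ)) : Set (GAtom (inSchema m ar) ℕ) :=
  {a | ∃ b ∈ db, a = ⟨b.p, fun i => π (b.args i)⟩}

/-- A query of arity `k` over the input schema: a mapping from databases to
sets of `k`-tuples. -/
def Query (m : ℕ) (ar : Fin m → ℕ) (k : ℕ) :=
  Set (GAtom (inSchema m ar) ℕ) → Set (Fin k → ℕ)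

/-- Genericity: the query commutes with all isomorphisms (permutations) of the
data domain. -/
def Generic {m : ℕ} {ar : Fin m → ℕ} {k : ℕ} (Q : Query m ar k) : Prop :=
  ∀ (π : ℕ ≃ ℕ) (db : Set (GAtom (inSchema m ar) ℕ)),
    Q (renameDB π db) = {t | ∃ s ∈ Q db, t = fun i => π (s i)}

/-- Encoding of an output relation, given as a list of tuples. -/
def encOut {k : ℕ} (out : List (Fin k → ℕ)) : List Bool :=
  encListAux (out.map fun t => encNats (List.ofFn t))

/-- The query `Q` is DB-PTIME: some polynomial-time computable function maps
(the encoding of) every finite database, presented as a list of its facts, to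
(the encoding of) a list enumerating the answer `Q(db)`. -/
def DBPTime {m : ℕ} {ar : Fin m → ℕ} {k : ℕ} (Q : Query m ar k) : Prop :=
  ∃ f : List Bool → List Bool, PolyTimeComputable f ∧
    ∀ dbl : List (GAtom (inSchema m ar) ℕ),
      ∃ out : List (Fin k → ℕ), f (encDB dbl) = encOut out ∧
        ∀ t, t ∈ out ↔ t ∈ Q {a | a ∈ dbl}

/-- The embedding of a database fact into the schema of a program with `n`
auxiliary (intensional) predicates. -/
def embDB {m n : ℕ} {ar : Fin m → ℕ} {arAux : Fin n → ℕ}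
    (a : GAtom (inSchema m ar) ℕ) :
    GAtom ⟨Fin m ⊕ Fin n, Sum.elim ar arAux⟩ ℕ :=
  ⟨Sum.inl a.p, a.args⟩

/-- The query `Q` is expressed by a stratified Datalog program with choice:
there are auxiliary intensional predicates (among them the answer predicate
`ans` of arity `k`), none of which redefines a database predicate, and a
stratified choice program `P` such that on every finite database the
first-order equivalent of `P` (grounded over the active domain together with
the constants of `P`) has a stable model, and in every one of its stable
models the answer predicate holds of exactly the tuples in `Q(db)`. -/
def ExpressibleChoice {m : ℕ} {ar : Fin m → ℕ} {k : ℕ} (Q : Query m ar k) : Prop :=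
  ∃ (n : ℕ) (arAux : Fin n → ℕ)
    (P : CProgram ⟨Fin m ⊕ Fin n, Sum.elim ar arAux⟩ ℕ)
    (σ : Fin m ⊕ Fin n → ℕ) (ans : Fin n) (hk : arAux ans = k),
    (∀ r ∈ P, ∃ j : Fin n, r.head.p = Sum.inr j) ∧
    StratifiedBy P σ ∧
    ∀ db : Set (GAtom (inSchema m ar) ℕ), db.Finite →
      (∃ M, IsStableModel
          (foeD P (gdom P {b | ∃ a ∈ db, b = embDB (arAux := arAux) a})
            {b | ∃ a ∈ db, b = embDB (arAux := arAux) a}) M) ∧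
      ∀ M, IsStableModel
          (foeD P (gdom P {b | ∃ a ∈ db, b = embDB (arAux := arAux) a})
            {b | ∃ a ∈ db, b = embDB (arAux := arAux) a}) M →
        ∀ t : Fin k → ℕ,
          (FAtom.base ⟨Sum.inr ans, fun i => t (Fin.cast hk i)⟩ ∈ M ↔ t ∈ Q db)

/-- As `ExpressibleChoice`, but by a stratified Datalog program *without*
choice goals. -/
def ExpressibleNoChoice {m : ℕ} {ar : Fin m → ℕ} {k : ℕ} (Q : Query m ar k) : Prop :=
  ∃ (n : ℕ) (arAux : Fin n → ℕ)
    (P : CProgram ⟨Fin m ⊕ Fin n, Sum.elim ar arAux⟩ ℕ)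
    (σ : Fin m ⊕ Fin n → ℕ) (ans : Fin n) (hk : arAux ans = k),
    (∀ r ∈ P, r.cgoals = []) ∧
    (∀ r ∈ P, ∃ j : Fin n, r.head.p = Sum.inr j) ∧
    StratifiedBy P σ ∧
    ∀ db : Set (GAtom (inSchema m ar) ℕ), db.Finite →
      (∃ M, IsStableModel
          (foeD P (gdom P {b | ∃ a ∈ db, b = embDB (arAux := arAux) a})
            {b | ∃ a ∈ db, b = embDB (arAux := arAux) a}) M) ∧
      ∀ M, IsStableModel
          (foeD P (gdom P {b | ∃ a ∈ db, b = embDB (arAux := arAux) a})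
            {b | ∃ a ∈ db, b = embDB (arAux := arAux) a}) M →
        ∀ t : Fin k → ℕ,
          (FAtom.base ⟨Sum.inr ans, fun i => t (Fin.cast hk i)⟩ ∈ M ↔ t ∈ Q db)

namespace DC

/-! ## Stack machines on a four-track tape -/

abbrev Sym := Fin 4 → Fin 3

/-- A machine over the four-track alphabet; the state `none` is the exit. -/
structure Mach where
  Q : Type
  fin : Fintype Q
  entry : Q
  δ : Q → Sym → Option Q × Sym × Bool

structure Conf (Q : Type) where
  st : Option Q
  tape : ℤ → Sym
  head : ℤ

def mv (b : Bool) (h : ℤ) : ℤ := if b then h + 1 else h - 1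

inductive Reach {Q : Type} (δ : Q → Sym → Option Q × Sym × Bool) : ℕ → Conf Q → Conf Q → Prop
  | refl (c : Conf Q) : Reach δ 0 c c
  | step {n : ℕ} {q : Q} {T : ℤ → Sym} {h : ℤ} {c : Conf Q} :
      Reach δ n ⟨(δ q (T h)).1, Function.update T h (δ q (T h)).2.1, mv (δ q (T h)).2.2 h⟩ c →
      Reach δ (n + 1) ⟨some q, T, h⟩ c

theorem Reach.trans {Q : Type} {δ : Q → Sym → Option Q × Sym × Bool} {n m : ℕ} {a b c : Conf Q}
    (h₁ : Reach δ n a b) (h₂ : Reach δ m b c) : Reach δ (n + m) a c := by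
  induction h₁ with
  | refl => simpa using h₂
  | step _ ih => rw [Nat.add_right_comm]; exact .step (ih h₂)

theorem Reach.of_step {Q : Type} {δ : Q → Sym → Option Q × Sym × Bool} {n : ℕ} {q : Q}
    {T T' : ℤ → Sym} {h h' : ℤ} {q' : Option Q} {s : Sym} {b : Bool} {c : Conf Q}
    (hδ : δ q (T h) = (q', s, b)) (hT : Function.update T h s = T') (hh : mv b h = h')
    (hr : Reach δ n ⟨q', T', h'⟩ c) : Reach δ (n + 1) ⟨some q, T, h⟩ c := by
  subst hT hh
  refine .step ?_
  rw [hδ]; exact hr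

/-- Running a machine inside a larger one. -/
theorem Reach.embed {Q Q' : Type} {δ : Q → Sym → Option Q × Sym × Bool}
    {δ' : Q' → Sym → Option Q' × Sym × Bool} (ι : Q → Q') (e : Option Q')
    (h : ∀ q a, δ' (ι q) a =
      ((δ q a).1.elim e fun q₁ => some (ι q₁), (δ q a).2.1, (δ q a).2.2))
    {n : ℕ} {c d : Conf Q} (hr : Reach δ n c d) :
    Reach δ' n ⟨c.st.elim e fun q₁ => some (ι q₁), c.tape, c.head⟩
      ⟨d.st.elim e fun q₁ => some (ι q₁), d.tape, d.head⟩ := by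
  induction hr with
  | refl => exact .refl _
  | step _ ih => exact .of_step (h _ _) rfl rfl ih

def bsym (b : Bool) : Fin 3 := if b then 2 else 1

theorem bsym_ne (b : Bool) : bsym b ≠ 0 := by cases b <;> decide

/-- The content of a track holding the stack `l` (top first), bottom in cell `0`. -/
def cell : List Bool → ℤ → Fin 3
  | [], _ => 0
  | b :: l, z => if z = l.length then bsym b else cell l z

theorem cell_eq_zero_iff (l : List Bool) (z : ℤ) : cell l z = 0 ↔ z < 0 ∨ (l.length : ℤ) ≤ z := by
  induction l with
  | nil => simp [cell]; omega
  | cons b l ih =>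
    simp only [cell]
    split_ifs with h
    · simp [bsym_ne, h]
    · rw [ih]; simp; omega

abbrev Stacks := Fin 4 → List Bool

def tp (s : Stacks) : ℤ → Sym := fun z i => cell (s i) z

theorem tp_push (s : Stacks) (i : Fin 4) (b : Bool) :
    Function.update (tp s) ((s i).length : ℤ)
      (Function.update (tp s (s i).length) i (bsym b)) = tp (Function.update s i (b :: s i)) := by
  funext z j
  by_cases hz : z = (s i).length
  · subst hz
    by_cases hj : j = i
    · subst hj; simp [tp, cell]
    · simp [tp, hj]
  · by_cases hj : j = i
    · subst hj; simp [tp, hz, cell]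
    · simp [tp, hj, hz]

theorem tp_pop (s : Stacks) (i : Fin 4) (b : Bool) (l : List Bool) (h : s i = b :: l) :
    Function.update (tp s) (l.length : ℤ)
      (Function.update (tp s l.length) i 0) = tp (Function.update s i l) := by
  funext z j
  by_cases hz : z = l.length
  · subst hz
    by_cases hj : j = i
    · subst hj; simp [tp, cell_eq_zero_iff, eq_comm (a := (0 : Fin 3))]
    · simp [tp, hj]
  · by_cases hj : j = i
    · subst hj; simp [tp, hz, cell, h]
    · simp [tp, hj, hz]

def tot (s : Stacks) : ℕ := ∑ i, (s i).length

theorem length_le_tot (s : Stacks) (i : Fin 4) : (s i).length ≤ tot s :=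
  Finset.single_le_sum (f := fun i => (s i).length) (fun _ _ => Nat.zero_le _) (Finset.mem_univ i)

theorem tot_update (s : Stacks) (i : Fin 4) (l : List Bool) :
    tot (Function.update s i l) + (s i).length = tot s + l.length := by
  unfold tot
  rw [← Finset.add_sum_erase _ _ (Finset.mem_univ i),
    ← Finset.add_sum_erase (Finset.univ : Finset (Fin 4)) (fun i => (s i).length)
      (Finset.mem_univ i)]
  have : ∑ x ∈ Finset.univ.erase i, (Function.update s i l x).length
      = ∑ x ∈ Finset.univ.erase i, (s x).length :=
    Finset.sum_congr rfl fun x hx => by simp [Finset.ne_of_mem_erase hx]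
  simp [this]; omega

/-- `M` transforms the stacks `s` into `s'` using at most `n` stack operations. -/
def Mach.Run (M : Mach) (n : ℕ) (s s' : Stacks) : Prop :=
  (∃ t ≤ n * (2 * (tot s + n) + 4), Reach M.δ t ⟨some M.entry, tp s, 0⟩ ⟨none, tp s', 0⟩) ∧
    tot s' ≤ tot s + n

theorem Mach.Run.mono {M : Mach} {n m : ℕ} {s s' : Stacks} (h : M.Run n s s') (hnm : n ≤ m) :
    M.Run m s s' := by
  obtain ⟨⟨t, ht, hr⟩, hl⟩ := h
  exact ⟨⟨t, ht.trans (by gcongr), hr⟩, by omega⟩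

theorem time_add {n m a a' : ℕ} (ha : a' ≤ a + n) :
    n * (2 * (a + n) + 4) + m * (2 * (a' + m) + 4) ≤ (n + m) * (2 * (a + (n + m)) + 4) := by
  have h1 : n * (2 * (a + n) + 4) ≤ n * (2 * (a + (n + m)) + 4) := by exact Nat.mul_le_mul_left _ (by omega)
  have h2 : m * (2 * (a' + m) + 4) ≤ m * (2 * (a + (n + m)) + 4) := by exact Nat.mul_le_mul_left _ (by omega)
  rw [Nat.add_mul]; omega

/-- Sequential composition. -/
def Mach.seq (M N : Mach) : Mach where
  Q := M.Q ⊕ N.Q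
  fin := @instFintypeSum _ _ M.fin N.fin
  entry := .inl M.entry
  δ := fun q a => match q with
    | .inl q => ((M.δ q a).1.elim (some (.inr N.entry)) fun q₁ => some (.inl q₁),
        (M.δ q a).2.1, (M.δ q a).2.2)
    | .inr q => ((N.δ q a).1.elim none fun q₁ => some (.inr q₁),
        (N.δ q a).2.1, (N.δ q a).2.2)

theorem Mach.Run.seq {M N : Mach} {n m : ℕ} {s s' s'' : Stacks} (h₁ : M.Run n s s')
    (h₂ : N.Run m s' s'') : (M.seq N).Run (n + m) s s'' := by
  obtain ⟨⟨t, ht, hr⟩, hl⟩ := h₁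
  obtain ⟨⟨t', ht', hr'⟩, hl'⟩ := h₂
  refine ⟨⟨t + t', ?_, ?_⟩, by omega⟩
  · exact (Nat.add_le_add ht ht').trans (time_add hl)
  · have a := hr.embed (δ' := (M.seq N).δ) Sum.inl (some (.inr N.entry)) (fun q a => rfl)
    have b := hr'.embed (δ' := (M.seq N).δ) Sum.inr none (fun q a => rfl)
    exact a.trans b

/-- The idle machine. -/
def Mach.skip : Mach where
  Q := Bool
  fin := inferInstance
  entry := false
  δ := fun q a => if q then (none, a, false) else (some true, a, true)

theorem run_skip (s : Stacks) : Mach.skip.Run 1 s s := by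
  refine ⟨⟨2, by omega, ?_⟩, by omega⟩
  exact .of_step (q' := some true) (b := true) rfl (Function.update_eq_self _ _) rfl
    (.of_step (q' := none) (b := false) rfl (Function.update_eq_self _ _) rfl (.refl _))

/-- Push `b` on stack `i`. -/
def Mach.push (i : Fin 4) (b : Bool) : Mach where
  Q := Bool
  fin := inferInstance
  entry := false
  δ := fun q a =>
    if q then (if a i = 0 then (none, a, true) else (some true, a, false))
    else (if a i = 0 then (some true, Function.update a i (bsym b), false) else (some false, a, true))

theorem reach_right {Q : Type} {δ : Q → Sym → Option Q × Sym × Bool} (q : Q) (i : Fin 4)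
    (hδ : ∀ a : Sym, a i ≠ 0 → δ q a = (some q, a, true)) (s : Stacks) (k : ℕ) :
    ∀ j : ℕ, j + k = (s i).length → Reach δ k ⟨some q, tp s, j⟩ ⟨some q, tp s, (s i).length⟩ := by
  induction k with
  | zero => intro j hj; simp at hj; rw [hj]; exact .refl _
  | succ k ih =>
    intro j hj
    refine .of_step (hδ _ ?_) (Function.update_eq_self _ _) ?_ (ih (j + 1) (by omega))
    · simp only [tp, ne_eq, cell_eq_zero_iff]; omega
    · simp [mv]

theorem reach_left {Q : Type} {δ : Q → Sym → Option Q × Sym × Bool} (q : Q) (i : Fin 4)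
    (hδ : ∀ a : Sym, a i ≠ 0 → δ q a = (some q, a, false)) (s : Stacks) (k : ℕ) :
    ∀ z : ℤ, z = (k : ℤ) - 1 → k ≤ (s i).length →
      Reach δ k ⟨some q, tp s, z⟩ ⟨some q, tp s, -1⟩ := by
  induction k with
  | zero => intro z hz _; simp at hz; rw [hz]; exact .refl _
  | succ k ih =>
    intro z hz hk
    refine .of_step (hδ _ ?_) (Function.update_eq_self _ _) ?_ (ih (z - 1) (by omega) (by omega))
    · simp only [tp, ne_eq, cell_eq_zero_iff]; omega
    · simp [mv]

theorem run_push (i : Fin 4) (b : Bool) (s : Stacks) :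
    (Mach.push i b).Run 1 s (Function.update s i (b :: s i)) := by
  have htot := tot_update s i (b :: s i)
  have hle := length_le_tot s i
  refine ⟨⟨(s i).length + ((s i).length + 1 + 1), by omega, ?_⟩,
    by simp at htot; omega⟩
  refine (reach_right (δ := (Mach.push i b).δ) false i (fun a ha => by simp [Mach.push, ha]) s _ 0
    (by simp)).trans ?_
  refine .of_step (q' := some true) (b := false) ?_ (tp_push s i b) rfl ?_
  · have : tp s (s i).length i = 0 := by simp [tp, cell_eq_zero_iff]
    simp [Mach.push, this]
  · refine Reach.trans (reach_left (δ := (Mach.push i b).δ) true i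
      (fun a ha => by simp [Mach.push, ha]) _ _ _ (by simp [mv]) (by simp)) ?_
    refine .of_step (q' := none) (b := true) ?_ (Function.update_eq_self _ _) rfl (.refl _)
    have : tp (Function.update s i (b :: s i)) (-1) i = 0 := by simp [tp, cell_eq_zero_iff]
    simp [Mach.push, this]

/-- Pop stack `i`; continue with the machine `M x` for the result `x`, after which control returns
to the beginning if `l x` holds. -/
def Mach.branch (i : Fin 4) (M : Option Bool → Mach) (l : Option Bool → Bool) : Mach where
  Q := Option (Option Bool) ⊕ (Σ x, (M x).Q)
  fin := haveI := fun x => (M x).fin; inferInstance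
  entry := .inl none
  δ := fun q a => match q with
    | .inl none => if a i = 0 then (some (.inl (some none)), a, false) else (some (.inl none), a, true)
    | .inl (some none) =>
        if a i = 0 then (some (.inr ⟨none, (M none).entry⟩), a, true)
        else (some (.inl (some (some (a i = 2)))), Function.update a i 0, false)
    | .inl (some (some b)) =>
        if a i = 0 then (some (.inr ⟨some b, (M (some b)).entry⟩), a, true)
        else (some (.inl (some (some b))), a, false)
    | .inr ⟨x, q⟩ =>
        (((M x).δ q a).1.elim (if l x then some (.inl none) else none) fun q₁ => some (.inr ⟨x, q₁⟩), ((M x).δ q a).2.1, ((M x).δ q a).2.2)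

theorem reach_pop (i : Fin 4) (M : Option Bool → Mach) (l : Option Bool → Bool) (s : Stacks) :
    ∃ t ≤ 2 * tot s + 3, Reach (Mach.branch i M l).δ t
      ⟨some (Mach.branch i M l).entry, tp s, 0⟩
      ⟨some (.inr ⟨(s i).head?, (M (s i).head?).entry⟩),
        tp (Function.update s i (s i).tail), 0⟩ := by
  have hle := length_le_tot s i
  have h0 : tp s (s i).length i = 0 := by simp [tp, cell_eq_zero_iff]
  have hR := reach_right (δ := (Mach.branch i M l).δ) (.inl none) i
    (fun a ha => by simp [Mach.branch, ha]) s (s i).length 0 (by simp)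
  match hs : s i with
  | [] =>
    refine ⟨(s i).length + (0 + 1 + 1), ?_, hR.trans (.of_step (q' := some (.inl (some none))) (b := false) ?_
      (Function.update_eq_self _ _) rfl
      (.of_step (q' := some (.inr ⟨none, (M none).entry⟩)) (b := true) ?_
      (Function.update_eq_self _ _) rfl ?_))⟩
    rotate_left 3
    · have : Function.update s i [].tail = s := by rw [← hs]; simp [hs]
      rw [this, hs]; exact .refl _
    · omega
    · simp only [Mach.branch]; rw [if_pos h0]
    · simp only [Mach.branch]; rw [if_pos]
      simp [tp, cell_eq_zero_iff, mv, hs]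
  | b :: r =>
    have hc : tp s (r.length : ℤ) i = bsym b := by simp [tp, hs, cell]
    refine ⟨_, ?_, hR.trans (.of_step (q' := some (.inl (some none))) (b := false) ?_
      (Function.update_eq_self _ _) (h' := r.length) ?_
      (.of_step (q' := some (.inl (some (some b)))) (b := false) ?_
      (tp_pop s i b r hs) rfl ((reach_left (δ := (Mach.branch i M l).δ) (.inl (some (some b))) i
      (fun a ha => by simp [Mach.branch, ha]) _ r.length _ (by simp [mv]) (by simp)).trans
      (.of_step (q' := some (.inr ⟨some b, (M (some b)).entry⟩)) (b := true) ?_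
      (Function.update_eq_self _ _) rfl (.refl _)))))⟩
    · simp only [hs, List.length_cons] at hle ⊢; omega
    · simp only [Mach.branch]; rw [if_pos h0]
    · simp [mv, hs]
    · simp only [Mach.branch]; rw [if_neg (by rw [hc]; exact bsym_ne b), hc]
      cases b <;> simp [bsym]
    · simp only [Mach.branch]; rw [if_pos]
      simp [tp, cell_eq_zero_iff]

theorem run_branch (i : Fin 4) (M : Option Bool → Mach) (l : Option Bool → Bool) {s s' : Stacks}
    {n : ℕ} (hl : l (s i).head? = false)
    (h : (M (s i).head?).Run n (Function.update s i (s i).tail) s') :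
    (Mach.branch i M l).Run (n + 1) s s' := by
  obtain ⟨t, ht, hr⟩ := reach_pop i M l s
  obtain ⟨⟨t', ht', hr'⟩, hl'⟩ := h
  have hu : tot (Function.update s i (s i).tail) ≤ tot s := by
    have := tot_update s i (s i).tail
    simp at this; omega
  refine ⟨⟨t + t', ?_, ?_⟩, by omega⟩
  · rw [Nat.add_mul]
    have : t' ≤ n * (2 * (tot s + (n + 1)) + 4) := ht'.trans (by exact Nat.mul_le_mul_left _ (by omega))
    omega
  · have a := hr'.embed (δ' := (Mach.branch i M l).δ) (fun q => .inr ⟨_, q⟩) none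
      (fun q a => by simp only [Mach.branch, hl]; rfl)
    exact hr.trans a

theorem run_loop (i : Fin 4) (M : Option Bool → Mach) (l : Option Bool → Bool) {s s' s'' : Stacks}
    {n m : ℕ} (hl : l (s i).head? = true)
    (h : (M (s i).head?).Run n (Function.update s i (s i).tail) s')
    (h₂ : (Mach.branch i M l).Run m s' s'') :
    (Mach.branch i M l).Run (n + 1 + m) s s'' := by
  obtain ⟨t, ht, hr⟩ := reach_pop i M l s
  obtain ⟨⟨t', ht', hr'⟩, hl'⟩ := h
  obtain ⟨⟨t₂, ht₂, hr₂⟩, hl₂⟩ := h₂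
  have hu : tot (Function.update s i (s i).tail) ≤ tot s := by
    have := tot_update s i (s i).tail
    simp at this; omega
  refine ⟨⟨t + t' + t₂, ?_, ?_⟩, by omega⟩
  · refine le_trans (Nat.add_le_add ?_ ht₂) (time_add (n := n + 1) (a := tot s) (by omega))
    rw [Nat.add_mul]
    have : t' ≤ n * (2 * (tot s + (n + 1)) + 4) := ht'.trans (by exact Nat.mul_le_mul_left _ (by omega))
    omega
  · have a := hr'.embed (δ' := (Mach.branch i M l).δ) (fun q => .inr ⟨_, q⟩) (some (.inl none))
      (fun q a => by simp only [Mach.branch, hl]; rfl)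
    exact (hr.trans a).trans hr₂

end DC

namespace DC

/-! ## Binary trees on stacks -/

inductive V where
  | nil
  | cons (a b : V)

def V.code : V → List Bool
  | .nil => [false]
  | .cons a b => true :: (a.code ++ b.code)

abbrev st (a b c d : List Bool) : Stacks := ![a, b, c, d]

theorem st_up0 (a b c d x : List Bool) : Function.update (st a b c d) 0 x = st x b c d := by
  funext i; fin_cases i <;> rfl
theorem st_up1 (a b c d x : List Bool) : Function.update (st a b c d) 1 x = st a x c d := by
  funext i; fin_cases i <;> rfl
theorem st_up2 (a b c d x : List Bool) : Function.update (st a b c d) 2 x = st a b x d := by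
  funext i; fin_cases i <;> rfl
theorem st_up3 (a b c d x : List Bool) : Function.update (st a b c d) 3 x = st a b c x := by
  funext i; fin_cases i <;> rfl

theorem push0 (x : Bool) (a b c d : List Bool) :
    (Mach.push 0 x).Run 1 (st a b c d) (st (x :: a) b c d) := by
  have h := run_push 0 x (st a b c d)
  rwa [st_up0] at h
theorem push1 (x : Bool) (a b c d : List Bool) :
    (Mach.push 1 x).Run 1 (st a b c d) (st a (x :: b) c d) := by
  have h := run_push 1 x (st a b c d)
  rwa [st_up1] at h
theorem push2 (x : Bool) (a b c d : List Bool) :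
    (Mach.push 2 x).Run 1 (st a b c d) (st a b (x :: c) d) := by
  have h := run_push 2 x (st a b c d)
  rwa [st_up2] at h
theorem push3 (x : Bool) (a b c d : List Bool) :
    (Mach.push 3 x).Run 1 (st a b c d) (st a b c (x :: d)) := by
  have h := run_push 3 x (st a b c d)
  rwa [st_up3] at h

/-- Branch with continuations for the empty stack, `false` and `true`. -/
def br (e f t : Mach) : Option Bool → Mach
  | none => e
  | some false => f
  | some true => t

/-- Pop all of stack `i`, running `M b` for each popped bit `b`. -/
def Mach.forEach (i : Fin 4) (M : Bool → Mach) : Mach :=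
  .branch i (fun x => x.elim .skip M) Option.isSome

theorem run_forEach_nil (i : Fin 4) (M : Bool → Mach) {s : Stacks} (hs : s i = []) :
    (Mach.forEach i M).Run 2 s s := by
  refine run_branch i _ _ (n := 1) (by rw [hs]; rfl) ?_
  rw [hs]
  have : Function.update s i [].tail = s := by rw [← hs]; simp [hs]
  rw [this]
  exact run_skip _

theorem run_forEach_cons (i : Fin 4) (M : Bool → Mach) {s s' s'' : Stacks} {x : Bool}
    {l : List Bool} {n m : ℕ} (hs : s i = x :: l) (h : (M x).Run n (Function.update s i l) s')
    (h₂ : (Mach.forEach i M).Run m s' s'') : (Mach.forEach i M).Run (n + 1 + m) s s'' := by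
  refine run_loop i _ _ (by rw [hs]; rfl) ?_ h₂
  rw [hs]; exact h

/-- Move stack `i` to stack `j`, reversing it. -/
def Mach.unload (i j : Fin 4) : Mach := .forEach i (.push j)

theorem unload10 (b a c d : List Bool) :
    (Mach.unload 1 0).Run (2 * b.length + 2) (st a b c d) (st (b.reverse ++ a) [] c d) := by
  induction b generalizing a with
  | nil => exact run_forEach_nil _ _ rfl
  | cons x l ih =>
    have h := run_forEach_cons 1 (Mach.push 0) (s := st a (x :: l) c d) rfl
      (by rw [st_up1]; exact push0 _ _ _ _ _) (ih (x :: a))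
    simpa [Mach.unload] using Mach.Run.mono h (by simp; omega)

theorem unload13 (b a c d : List Bool) :
    (Mach.unload 1 3).Run (2 * b.length + 2) (st a b c d) (st a [] c (b.reverse ++ d)) := by
  induction b generalizing d with
  | nil => exact run_forEach_nil _ _ rfl
  | cons x l ih =>
    have h := run_forEach_cons 1 (Mach.push 3) (s := st a (x :: l) c d) rfl
      (by rw [st_up1]; exact push3 _ _ _ _ _) (ih (x :: d))
    simpa [Mach.unload] using Mach.Run.mono h (by simp; omega)

theorem unload31 (b a c d : List Bool) :
    (Mach.unload 3 1).Run (2 * d.length + 2) (st a b c d) (st a (d.reverse ++ b) c []) := by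
  induction d generalizing b with
  | nil => exact run_forEach_nil _ _ rfl
  | cons x l ih =>
    have h := run_forEach_cons 3 (Mach.push 1) (s := st a b c (x :: l)) rfl
      (by rw [st_up3]; exact push1 _ _ _ _ _) (ih (x :: b))
    simpa [Mach.unload] using Mach.Run.mono h (by simp; omega)

theorem unload32 (b a c d : List Bool) :
    (Mach.unload 3 2).Run (2 * d.length + 2) (st a b c d) (st a b (d.reverse ++ c) []) := by
  induction d generalizing c with
  | nil => exact run_forEach_nil _ _ rfl
  | cons x l ih =>
    have h := run_forEach_cons 3 (Mach.push 2) (s := st a b c (x :: l)) rfl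
      (by rw [st_up3]; exact push2 _ _ _ _ _) (ih (x :: c))
    simpa [Mach.unload] using Mach.Run.mono h (by simp; omega)

theorem unload20 (b a c d : List Bool) :
    (Mach.unload 2 0).Run (2 * c.length + 2) (st a b c d) (st (c.reverse ++ a) b [] d) := by
  induction c generalizing a with
  | nil => exact run_forEach_nil _ _ rfl
  | cons x l ih =>
    have h := run_forEach_cons 2 (Mach.push 0) (s := st a b (x :: l) d) rfl
      (by rw [st_up2]; exact push0 _ _ _ _ _) (ih (x :: a))
    simpa [Mach.unload] using Mach.Run.mono h (by simp; omega)

theorem clear1 (b a c d : List Bool) :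
    (Mach.forEach 1 fun _ => .skip).Run (2 * b.length + 2) (st a b c d) (st a [] c d) := by
  induction b with
  | nil => exact run_forEach_nil _ _ rfl
  | cons x l ih =>
    have h := run_forEach_cons 1 (fun _ => Mach.skip) (s := st a (x :: l) c d) rfl
      (by rw [st_up1]; exact run_skip _) ih
    exact Mach.Run.mono h (by simp; omega)

theorem copy1 (b a c d : List Bool) :
    (Mach.forEach 1 fun x => (Mach.push 0 x).seq (.push 3 x)).Run (3 * b.length + 2) (st a b c d)
      (st (b.reverse ++ a) [] c (b.reverse ++ d)) := by
  induction b generalizing a d with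
  | nil => exact (run_forEach_nil _ _ rfl)
  | cons x l ih =>
    have h := run_forEach_cons 1 (fun x => (Mach.push 0 x).seq (.push 3 x))
      (s := st a (x :: l) c d) rfl
      (by rw [st_up1]; exact (push0 _ _ _ _ _).seq (push3 _ _ _ _ _)) (ih (x :: a) (x :: d))
    simpa using Mach.Run.mono h (by simp; omega)

/-- One step of the transfer of a tree: stack `2` counts the subtrees still to be moved. -/
def Mach.grabLoop : Mach :=
  .branch 2 (br .skip .skip (.branch 0 (br .skip (.push 1 false)
    ((Mach.push 1 true).seq ((Mach.push 2 true).seq (.push 2 true)))) fun _ => false))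
    fun x => x == some true

def Mach.grab : Mach := (Mach.push 2 true).seq .grabLoop

theorem run_grabLoop (N : ℕ) : ∀ (fs : List V), (fs.flatMap V.code).length ≤ N →
    ∀ r b d, Mach.grabLoop.Run (5 * (fs.flatMap V.code).length + 2)
      (st (fs.flatMap V.code ++ r) b (List.replicate fs.length true) d)
      (st r ((fs.flatMap V.code).reverse ++ b) [] d) := by
  induction N with
  | zero =>
    intro fs hfs r b d
    match fs with
    | [] =>
      refine run_branch 2 _ _ (n := 1) rfl ?_
      rw [st_up2]; exact run_skip _
    | .nil :: fs => simp [V.code] at hfs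
    | .cons _ _ :: fs => simp [V.code] at hfs
  | succ N ih =>
    intro fs hfs r b d
    match fs with
    | [] =>
      refine run_branch 2 _ _ (n := 1) rfl ?_
      rw [st_up2]; exact run_skip _
    | .nil :: fs =>
      have h := ih fs (by simpa [V.code] using hfs) r (false :: b) d
      refine Mach.Run.mono (run_loop 2 _ _ (s' := st (fs.flatMap V.code ++ r) (false :: b)
        (List.replicate fs.length true) d) (n := 1 + 1) rfl ?_
        (m := 5 * (fs.flatMap V.code).length + 2) ?_) ?_
      · rw [st_up2]
        refine run_branch 0 _ _ rfl ?_
        rw [st_up0]; exact push1 _ _ _ _ _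
      · simpa [V.code, Mach.grabLoop] using h
      · simp [V.code]; omega
    | .cons a a' :: fs =>
      have h := ih (a :: a' :: fs) (by simp [V.code] at hfs ⊢; omega) r (true :: b) d
      refine Mach.Run.mono (run_loop 2 _ _ (s' := st ((a :: a' :: fs).flatMap V.code ++ r)
        (true :: b) (List.replicate (a :: a' :: fs).length true) d) (n := (1 + (1 + 1)) + 1) rfl ?_
        (m := 5 * ((a :: a' :: fs).flatMap V.code).length + 2) ?_) (m := _) ?_
      · rw [st_up2]
        refine run_branch 0 _ _ rfl ?_
        rw [st_up0]
        have := ((push1 true (((a :: a' :: fs).flatMap V.code) ++ r) b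
          (List.replicate fs.length true) d).seq ((push2 true _ _ _ _).seq (push2 true _ _ _ _)))
        simpa [V.code, br, List.replicate_succ] using this
      · simpa [V.code, Mach.grabLoop] using h
      · simp [V.code]; omega

theorem run_grab (v : V) (r b d : List Bool) :
    Mach.grab.Run (5 * v.code.length + 3) (st (v.code ++ r) b [] d)
      (st r (v.code.reverse ++ b) [] d) := by
  have h := run_grabLoop _ [v] le_rfl r b d
  simp only [List.flatMap_cons, List.flatMap_nil, List.append_nil] at h
  exact ((push2 true _ _ _ _).seq h).mono (by omega)

def Mach.dup : Mach := Mach.grab.seq ((Mach.forEach 1 fun x => (Mach.push 0 x).seq (.push 3 x)).seq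
  ((Mach.unload 3 1).seq (.unload 1 0)))

theorem run_dup (v : V) (r : List Bool) :
    Mach.dup.Run (12 * v.code.length + 9) (st (v.code ++ r) [] [] [])
      (st (v.code ++ (v.code ++ r)) [] [] []) := by
  have h := (run_grab v r [] []).seq ((copy1 _ _ _ _).seq
    ((unload31 _ _ _ _).seq (unload10 _ _ _ _)))
  simp only [List.append_nil, List.reverse_reverse, List.length_reverse] at h
  exact h.mono (by omega)

def Mach.drop : Mach := Mach.grab.seq (Mach.forEach 1 fun _ => .skip)

theorem run_drop (v : V) (r : List Bool) :
    Mach.drop.Run (7 * v.code.length + 5) (st (v.code ++ r) [] [] []) (st r [] [] []) := by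
  have h := (run_grab v r [] []).seq (clear1 _ _ _ _)
  simp only [List.append_nil, List.length_reverse] at h
  exact h.mono (by omega)

def Mach.swap : Mach := Mach.grab.seq ((Mach.unload 1 3).seq (Mach.grab.seq
  ((Mach.unload 3 2).seq ((Mach.unload 2 0).seq (.unload 1 0)))))

theorem run_swap (v w : V) (r : List Bool) :
    Mach.swap.Run (11 * (v.code.length + w.code.length) + 14) (st (v.code ++ (w.code ++ r)) [] [] [])
      (st (w.code ++ (v.code ++ r)) [] [] []) := by
  have h := (run_grab v (w.code ++ r) [] []).seq ((unload13 _ _ _ _).seq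
    ((run_grab w r [] _).seq ((unload32 _ _ _ _).seq ((unload20 _ _ _ _).seq (unload10 _ _ _ _)))))
  simp only [List.append_nil, List.reverse_reverse, List.length_reverse] at h
  exact h.mono (by omega)

/-- Pop a bit known to be present. -/
def Mach.pop (i : Fin 4) : Mach := .branch i (fun _ => .skip) fun _ => false

theorem run_pop0 (x : Bool) (a b c d : List Bool) :
    (Mach.pop 0).Run 2 (st (x :: a) b c d) (st a b c d) := by
  refine run_branch 0 _ _ rfl ?_
  rw [st_up0]; exact run_skip _

end DC

namespace DC

/-! ## Polynomial-time functions on encoded data -/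

/-- Data encoded as binary trees. -/
class Enc (α : Type) where
  enc : α → V

open Enc

def code {α : Type} [Enc α] (a : α) : List Bool := (enc a).code

def sz {α : Type} [Enc α] (a : α) : ℕ := (code a).length

instance : Enc Unit := ⟨fun _ => .nil⟩
instance : Enc Bool := ⟨fun b => bif b then .cons .nil .nil else .nil⟩
instance {α β : Type} [Enc α] [Enc β] : Enc (α × β) := ⟨fun p => .cons (enc p.1) (enc p.2)⟩

def encList {α : Type} [Enc α] : List α → V
  | [] => .nil
  | a :: l => .cons (enc a) (encList l)

instance {α : Type} [Enc α] : Enc (List α) := ⟨encList⟩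
instance : Enc ℕ := ⟨fun n => enc n.bits⟩

section
variable {α β γ : Type} [Enc α] [Enc β] [Enc γ]

theorem code_pair (a : α) (b : β) : code (a, b) = true :: (code a ++ code b) := rfl
theorem code_cons (a : α) (l : List α) : code (a :: l) = true :: (code a ++ code l) := rfl

theorem sz_pos (a : α) : 1 ≤ sz a := by
  unfold sz code; cases enc a <;> simp [V.code]

@[simp] theorem sz_pair (p : α × β) : sz p = sz p.1 + sz p.2 + 1 := by
  obtain ⟨a, b⟩ := p
  simp [sz, code_pair]
@[simp] theorem sz_nil : sz ([] : List α) = 1 := rfl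
@[simp] theorem sz_cons (a : α) (l : List α) : sz (a :: l) = sz a + sz l + 1 := by
  simp [sz, code_cons]
@[simp] theorem sz_unit (u : Unit) : sz u = 1 := rfl
theorem sz_bool (b : Bool) : sz b ≤ 3 := by cases b <;> decide

theorem sz_append (l l' : List α) : sz (l ++ l') + 1 = sz l + sz l' := by
  induction l with
  | nil => simp [Nat.add_comm]
  | cons a l ih => simp only [List.cons_append, sz_cons]; omega

theorem length_lt_sz (l : List α) : l.length < sz l := by
  induction l with
  | nil => simp
  | cons a l ih => simp; omega

theorem sz_mem {a : α} {l : List α} (h : a ∈ l) : sz a < sz l := by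
  induction l with
  | nil => simp at h
  | cons b l ih =>
    rcases List.mem_cons.1 h with rfl | h
    · simp only [sz_cons]; omega
    · have := ih h; simp only [sz_cons]; omega

theorem eval_mono (p : Polynomial ℕ) {n m : ℕ} (h : n ≤ m) : p.eval n ≤ p.eval m := by
  simp only [Polynomial.eval_eq_sum, Polynomial.sum]
  exact Finset.sum_le_sum fun i _ => by gcongr

/-- `f` is computed in polynomial time by a stack machine, in place on the top of stack `0`. -/
@[fun_prop] def PT (f : α → β) : Prop :=
  ∃ (M : Mach) (p : Polynomial ℕ), ∀ (a : α) (r : List Bool),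
    M.Run (p.eval (sz a)) (st (code a ++ r) [] [] []) (st (code (f a) ++ r) [] [] [])

theorem PT.size {f : α → β} (hf : PT f) : ∃ p : Polynomial ℕ, ∀ a, sz (f a) ≤ p.eval (sz a) := by
  obtain ⟨M, p, h⟩ := hf
  refine ⟨.X + p, fun a => ?_⟩
  have := (h a []).2
  simpa [tot, Fin.sum_univ_four, sz] using this

theorem PT.recode {f : α → β} (hf : ∀ a, enc (f a) = enc a) : PT f :=
  ⟨.skip, 1, fun a r => by simpa [code, hf] using run_skip _⟩

@[fun_prop] theorem PT.id : PT (fun a : α => a) := .recode fun _ => rfl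

@[fun_prop] theorem PT.comp {g : β → γ} {f : α → β} (hg : PT g) (hf : PT f) :
    PT fun a => g (f a) := by
  obtain ⟨q, hq⟩ := hf.size
  obtain ⟨M, p, h⟩ := hf
  obtain ⟨N, p', h'⟩ := hg
  refine ⟨M.seq N, p + p'.comp q, fun a r => ((h a r).seq (h' (f a) r)).mono ?_⟩
  simp only [Polynomial.eval_add, Polynomial.eval_comp]
  exact Nat.add_le_add_left (eval_mono _ (hq a)) _

def Mach.pushes : List Bool → Mach
  | [] => .skip
  | b :: l => (Mach.pushes l).seq (.push 0 b)

theorem run_pushes (l r : List Bool) :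
    (Mach.pushes l).Run (l.length + 1) (st r [] [] []) (st (l ++ r) [] [] []) := by
  induction l with
  | nil => exact run_skip _
  | cons b l ih => exact ih.seq (push0 _ _ _ _ _)

@[fun_prop] theorem PT.const (b : β) : PT fun _ : α => b := by
  refine ⟨Mach.drop.seq (.pushes (code b)), 7 * .X + .C (5 + ((code b).length + 1)), fun a r => ?_⟩
  refine ((run_drop (enc a) r).seq (run_pushes _ _)).mono ?_
  simp [sz, code]; omega

theorem run_unpair (a : α) (b : β) (r : List Bool) :
    (Mach.pop 0).Run 2 (st (code (a, b) ++ r) [] [] []) (st (code a ++ (code b ++ r)) [] [] []) := by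
  simpa [code_pair] using run_pop0 true (code a ++ (code b ++ r)) [] [] []

theorem run_pair (a : α) (b : β) (r : List Bool) :
    (Mach.push 0 true).Run 1 (st (code a ++ (code b ++ r)) [] [] []) (st (code (a, b) ++ r) [] [] []) := by
  simpa [code_pair] using push0 true (code a ++ (code b ++ r)) [] [] []

theorem PT.prod_fst : PT (Prod.fst : α × β → α) := by
  refine ⟨(Mach.pop 0).seq (Mach.swap.seq .drop), 18 * .X + 21, fun ⟨a, b⟩ r => ?_⟩
  refine ((run_unpair a b r).seq ((run_swap _ _ _).seq (run_drop (enc b) _))).mono ?_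
  have := sz_pair (a, b)
  simp [sz, code] at this ⊢; omega

theorem PT.prod_snd : PT (Prod.snd : α × β → β) := by
  refine ⟨(Mach.pop 0).seq .drop, 7 * .X + 7, fun ⟨a, b⟩ r => ?_⟩
  refine ((run_unpair a b r).seq (run_drop (enc a) _)).mono ?_
  have := sz_pair (a, b)
  simp [sz, code] at this ⊢; omega

@[fun_prop] theorem PT.fst {f : α → β × γ} (hf : PT f) : PT fun a => (f a).1 := prod_fst.comp hf
@[fun_prop] theorem PT.snd {f : α → β × γ} (hf : PT f) : PT fun a => (f a).2 := prod_snd.comp hf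

@[fun_prop] theorem PT.pair {f : α → β} {g : α → γ} (hf : PT f) (hg : PT g) : PT fun a => (f a, g a) := by
  obtain ⟨q, hq⟩ := hg.size
  obtain ⟨M, p, h⟩ := hf
  obtain ⟨N, p', h'⟩ := hg
  refine ⟨Mach.dup.seq (N.seq (Mach.swap.seq (M.seq (.push 0 true)))),
    12 * .X + 9 + (p' + (11 * (q + .X) + 14 + (p + 1))), fun a r => ?_⟩
  refine ((run_dup (enc a) r).seq ((h' a _).seq ((run_swap (enc (g a)) (enc a) _).seq ((h a _).seq (run_pair _ _ _))))).mono ?_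
  have := hq a
  simp only [sz, code] at this ⊢
  simp; omega

theorem PT.cond {c : α → Bool} {f g : α → β} (hc : PT c) (hf : PT f) (hg : PT g) :
    PT fun a => bif c a then f a else g a := by
  obtain ⟨N, p', h'⟩ := hc.pair (PT.id (α := α))
  obtain ⟨M₁, p₁, h₁⟩ := hf
  obtain ⟨M₂, p₂, h₂⟩ := hg
  refine ⟨N.seq ((Mach.pop 0).seq (.branch 0 (br .skip M₂ ((Mach.pop 0).seq ((Mach.pop 0).seq M₁)))
    fun _ => false)), p' + (2 + (p₁ + p₂ + 5)), fun a r => ?_⟩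
  refine ((h' a r).seq ((run_unpair _ _ _).seq (run_branch 0 _ _ (n := p₁.eval (sz a) + p₂.eval (sz a) + 4) rfl ?_))).mono (by simp)
  rw [st_up0]
  beta_reduce
  cases c a
  · show Mach.Run M₂ _ _ _
    refine (h₂ a r).mono ?_
    omega
  · show Mach.Run ((Mach.pop 0).seq ((Mach.pop 0).seq M₁)) _ _ _
    refine ((run_pop0 _ _ _ _ _).seq ((run_pop0 _ _ _ _ _).seq (h₁ a r))).mono ?_
    omega

theorem PT.casesList {l : α → List β} {f : α → γ} {g : α → β → List β → γ} (hl : PT l)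
    (hf : PT f) (hg : PT fun q : α × β × List β => g q.1 q.2.1 q.2.2) :
    PT fun a => match l a with
      | [] => f a
      | x :: t => g a x t := by
  obtain ⟨q, hq⟩ := hl.size
  obtain ⟨N, p', h'⟩ := hl.pair (PT.id (α := α))
  have hg' : PT fun q : (β × List β) × α => g q.2 q.1.1 q.1.2 :=
    hg.comp (f := fun q : (β × List β) × α => (q.2, q.1.1, q.1.2))
      (PT.pair (PT.snd PT.id) (PT.pair (PT.fst (PT.fst PT.id)) (PT.snd (PT.fst PT.id))))
  obtain ⟨M₁, p₁, h₁⟩ := hf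
  obtain ⟨M₂, p₂, h₂⟩ := hg'
  refine ⟨N.seq ((Mach.pop 0).seq (.branch 0 (br .skip M₁ ((Mach.push 0 true).seq
    ((Mach.push 0 true).seq M₂))) fun _ => false)),
    p' + (2 + (p₁ + p₂.comp (.X + q + 1) + 3)), fun a r => ?_⟩
  refine ((h' a r).seq ((run_unpair _ _ _).seq (run_branch 0 _ _
    (n := p₁.eval (sz a) + (p₂.comp (.X + q + 1)).eval (sz a) + 2) rfl ?_))).mono (by simp)
  rw [st_up0]
  have hqa := hq a
  beta_reduce
  cases e : l a with
  | nil =>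
    show Mach.Run M₁ _ _ _
    refine (h₁ a r).mono ?_
    omega
  | cons x t =>
    rw [e] at hqa
    have h3 : Mach.Run ((Mach.push 0 true).seq ((Mach.push 0 true).seq M₂))
        (1 + (1 + p₂.eval (sz ((x, t), a)))) (st ((code x ++ code t) ++ (code a ++ r)) [] [] []) _ :=
      (push0 true _ _ _ _).seq ((push0 true _ _ _ _).seq
        (by simpa [code_pair, -sz_pair] using h₂ ((x, t), a) r))
    show Mach.Run ((Mach.push 0 true).seq ((Mach.push 0 true).seq M₂)) _ _ _
    refine h3.mono ?_
    have : sz ((x, t), a) ≤ (Polynomial.X + q + 1).eval (sz a) := by simp at hqa ⊢; omega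
    have := eval_mono p₂ this
    rw [Polynomial.eval_comp]; omega

end

end DC

namespace DC

open Enc

section
variable {α β γ σ : Type} [Enc α] [Enc β] [Enc γ] [Enc σ]

theorem PT.congr {f g : α → β} (hf : PT f) (h : ∀ a, f a = g a) : PT g := funext h ▸ hf

def Mach.fold (G : Mach) : Mach :=
  .branch 0 (br .skip .skip ((Mach.push 0 true).seq ((Mach.push 0 true).seq (G.seq (.pop 0)))))
    fun x => x == some true

theorem run_fold {g : σ → β → σ} {G : Mach} {p : Polynomial ℕ}
    (hG : ∀ (a : (β × List β) × σ) (r : List Bool), G.Run (p.eval (sz a)) (st (code a ++ r) [] [] [])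
      (st (code (a.1.2, g a.2 a.1.1) ++ r) [] [] [])) (B : ℕ) (r : List Bool) : ∀ (l : List β) (s : σ),
    (∀ l₁ x t, l = l₁ ++ x :: t → sz ((x, t), l₁.foldl g s) ≤ B) →
    (Mach.fold G).Run ((p.eval B + 5) * l.length + 2) (st (code l ++ (code s ++ r)) [] [] [])
      (st (code (l.foldl g s) ++ r) [] [] []) := by
  intro l
  induction l with
  | nil =>
    intro s _
    exact run_branch 0 _ _ (n := 1) rfl (by rw [st_up0]; exact run_skip _)
  | cons x t ih =>
    intro s h
    have h1 := ih (g s x) fun l₁ y t' e => h (x :: l₁) y t' (by simp [e])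
    have h2 : Mach.Run ((Mach.push 0 true).seq ((Mach.push 0 true).seq (G.seq (.pop 0))))
        (1 + (1 + (p.eval (sz ((x, t), s)) + 2))) (st ((code x ++ code t) ++ (code s ++ r)) [] [] []) 
        (st (code t ++ (code (g s x) ++ r)) [] [] []) :=
      (push0 true _ _ _ _).seq ((push0 true _ _ _ _).seq (Mach.Run.seq
        (by simpa [code_pair, -sz_pair] using hG ((x, t), s) r) (run_unpair _ _ _)))
    refine Mach.Run.mono (run_loop 0 _ _ rfl ?_ h1) (m := (p.eval B + 5) * (x :: t).length + 2) 
      (n := 1 + (1 + (p.eval (sz ((x, t), s)) + 2)) + 1 + ((p.eval B + 5) * t.length + 2)) ?_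
    · rw [st_up0]; exact h2
    · have := eval_mono p (h [] x t rfl)
      simp only [List.length_cons, Nat.mul_add, List.foldl_nil] at this ⊢
      omega

theorem PT.foldl_aux {g : σ → β → σ} (hg : PT fun q : β × σ => g q.2 q.1) (l : α → List β) (s : α → σ)
    (hl : PT l) (hs : PT s) (b : Polynomial ℕ) (hb : ∀ a l₁ l₂, l a = l₁ ++ l₂ → sz (l₁.foldl g (s a)) ≤ b.eval (sz a)) :
    PT fun a => (l a).foldl g (s a) := by
  have hg' : PT fun q : (β × List β) × σ => (q.1.2, g q.2 q.1.1) := by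
    have := hg.comp (f := fun q : (β × List β) × σ => (q.1.1, q.2)) (by fun_prop)
    exact PT.pair (by fun_prop) this
  obtain ⟨q, hq⟩ := hl.size
  obtain ⟨G, p, hG⟩ := hg'
  obtain ⟨N, p', hN⟩ := hl.pair hs
  refine ⟨N.seq ((Mach.pop 0).seq (.fold G)),
    p' + (2 + ((p.comp (q + b + 1) + 5) * q + 2)), fun a r => ?_⟩
  refine ((hN a r).seq ((run_unpair _ _ _).seq (run_fold hG ((q + b + 1).eval (sz a)) r _ _ ?_))).mono ?_
  · intro l₁ x t e
    have h1 := hq a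
    have h2 := hb a l₁ _ e
    have h3 := sz_append l₁ (x :: t)
    have := sz_pos l₁
    rw [← e] at h3
    simp at h3 ⊢
    omega
  · have h1 := hq a
    have h2 := length_lt_sz (l a)
    simp only [Polynomial.eval_add, Polynomial.eval_mul, Polynomial.eval_comp, Polynomial.eval_ofNat,
      Polynomial.eval_one]
    gcongr
    omega

theorem sz_foldl {σ β : Type} [Enc σ] (g : σ → β → σ) (B : ℕ) (l : List β) (s : σ)
    (h : ∀ s, ∀ x ∈ l, sz (g s x) ≤ sz s + B) : sz (l.foldl g s) ≤ sz s + l.length * B := by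
  induction l generalizing s with
  | nil => simp
  | cons x l ih =>
    have h1 := ih (g s x) fun s y hy => h s y (by simp [hy])
    have h2 := h s x (by simp)
    simp only [List.foldl_cons, List.length_cons, Nat.add_mul]
    omega

/-- Iteration along a list, provided each step increases the size additively. -/
theorem PT.foldl {l : α → List β} {s : α → σ} {g : α → σ → β → σ}
    (hg : PT fun q : α × σ × β => g q.1 q.2.1 q.2.2) (hl : PT l) (hs : PT s)
    (hb : ∃ p : Polynomial ℕ, ∀ a s, ∀ x ∈ l a, sz (g a s x) ≤ sz s + p.eval (sz (a, x))) :
    PT fun a => (l a).foldl (g a) (s a) := by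
  obtain ⟨p, hp⟩ := hb
  obtain ⟨q, hq⟩ := hl.size
  obtain ⟨q', hq'⟩ := hs.size
  have key : ∀ a (l : List β) s, (l.foldl (fun (c : α × σ) x => (c.1, g c.1 c.2 x)) (a, s))
      = (a, l.foldl (g a) s) := by
    intro a l
    induction l with
    | nil => intro s; rfl
    | cons x l ih => intro s; simp [ih]
  have hg' : PT fun q : β × α × σ => (q.2.1, g q.2.1 q.2.2 q.1) :=
    PT.pair (by fun_prop) (hg.comp (f := fun q : β × α × σ => (q.2.1, q.2.2, q.1)) (by fun_prop))
  have := PT.foldl_aux (g := fun (c : α × σ) x => (c.1, g c.1 c.2 x)) hg' l (fun a => (a, s a)) hl (by fun_prop)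
    (.X + (q' + q * p.comp (.X + q + 1)) + 1) ?_
  · simp only [key] at this
    exact this.snd
  · intro a l₁ l₂ e
    rw [key]
    have h1 := sz_foldl (g a) ((p.comp (.X + q + 1)).eval (sz a)) l₁ (s a) (fun s x hx => by
      have hx' : x ∈ l a := by simp [e, hx]
      refine (hp a s x hx').trans ?_
      rw [Polynomial.eval_comp]
      gcongr
      refine eval_mono p ?_
      have := hq a
      have := sz_mem hx'
      simp; omega)
    have h2 := hq' a
    have h3 : l₁.length ≤ q.eval (sz a) := by
      have := length_lt_sz (l a)
      have := hq a
      simp [e] at *; omega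
    have h4 := Nat.mul_le_mul_right ((p.comp (.X + q + 1)).eval (sz a)) h3
    simp only [sz_pair, Polynomial.eval_add, Polynomial.eval_mul, Polynomial.eval_X, Polynomial.eval_one]
    omega

@[fun_prop] theorem PT.cons {f : α → β} {l : α → List β} (hf : PT f) (hl : PT l) : PT fun a => f a :: l a :=
  (PT.recode (f := fun q : β × List β => q.1 :: q.2) fun _ => rfl).comp (hf.pair hl)

@[fun_prop] theorem PT.reverse {l : α → List β} (hl : PT l) : PT fun a => (l a).reverse := by
  have : PT fun a => (l a).foldl (fun s x => x :: s) [] :=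
    PT.foldl (by fun_prop) hl (by fun_prop) ⟨.X + 1, fun a s x _ => by simp; omega⟩
  simpa using this

@[fun_prop] theorem PT.append {l l' : α → List β} (hl : PT l) (hl' : PT l') : PT fun a => l a ++ l' a := by
  have : PT fun a => (l a).reverse.foldl (fun s x => x :: s) (l' a) :=
    PT.foldl (by fun_prop) (by fun_prop) (by fun_prop) ⟨.X + 1, fun a s x _ => by simp; omega⟩
  simpa using this

theorem PT.flatMap {l : α → List β} {f : α → β → List γ} (hl : PT l)
    (hf : PT fun q : α × β => f q.1 q.2) : PT fun a => (l a).flatMap (f a) := by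
  obtain ⟨p, hp⟩ := hf.size
  have : PT fun a => (l a).foldl (fun s x => s ++ f a x) [] := by
    refine PT.foldl (PT.append (by fun_prop) ?_) hl (by fun_prop) ⟨p, fun a s x _ => ?_⟩
    · exact hf.comp (f := fun q : α × List γ × β => (q.1, q.2.2)) (by fun_prop)
    · have := hp (a, x)
      have := sz_append s (f a x)
      simp only at *; omega
  have h : ∀ (g : β → List γ) (l : List β) s, l.foldl (fun s x => s ++ g x) s = s ++ l.flatMap g := by
    intro g l
    induction l with
    | nil => simp
    | cons x l ih => intro s; simp [ih]
  simpa [h] using this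

theorem PT.map {l : α → List β} {f : α → β → γ} (hl : PT l)
    (hf : PT fun q : α × β => f q.1 q.2) : PT fun a => (l a).map (f a) := by
  have : PT fun a => (l a).flatMap fun x => [f a x] := PT.flatMap hl (hf.cons (.const _))
  simpa [List.map_eq_flatMap] using this

theorem PT.filter {l : α → List β} {f : α → β → Bool} (hl : PT l)
    (hf : PT fun q : α × β => f q.1 q.2) : PT fun a => (l a).filter (f a) := by
  have : PT fun a => (l a).flatMap fun x => bif f a x then [x] else [] :=
    PT.flatMap hl (PT.cond hf (by fun_prop) (by fun_prop))
  refine this.congr fun a => ?_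
  induction l a with
  | nil => rfl
  | cons x l ih => simp only [List.flatMap_cons, ih, List.filter_cons]; cases f a x <;> simp

@[fun_prop] theorem PT.and {f g : α → Bool} (hf : PT f) (hg : PT g) : PT fun a => f a && g a := by
  have : PT fun a => bif f a then g a else false := PT.cond hf hg (.const _)
  refine this.congr fun a => ?_
  cases f a <;> rfl

@[fun_prop] theorem PT.not {f : α → Bool} (hf : PT f) : PT fun a => !f a := by
  have : PT fun a => bif f a then false else true := PT.cond hf (.const _) (.const _)
  refine this.congr fun a => ?_
  cases f a <;> rfl

@[fun_prop] theorem PT.or {f g : α → Bool} (hf : PT f) (hg : PT g) : PT fun a => f a || g a := by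
  have : PT fun a => bif f a then true else g a := PT.cond hf (.const _) hg
  refine this.congr fun a => ?_
  cases f a <;> rfl

theorem PT.any {l : α → List β} {f : α → β → Bool} (hl : PT l)
    (hf : PT fun q : α × β => f q.1 q.2) : PT fun a => (l a).any (f a) := by
  have : PT fun a => (l a).foldl (fun s x => s || f a x) false := by
    refine PT.foldl (PT.or (by fun_prop) ?_) hl (by fun_prop) ⟨3, fun a s x _ => ?_⟩
    · exact hf.comp (f := fun q : α × Bool × β => (q.1, q.2.2)) (by fun_prop)
    · have := sz_bool (s || f a x)
      simp; omega
  have h : ∀ (g : β → Bool) (l : List β) s, l.foldl (fun s x => s || g x) s = (s || l.any g) := by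
    intro g l
    induction l with
    | nil => simp
    | cons x l ih => intro s; simp [ih, Bool.or_assoc]
  simpa [h] using this

theorem PT.headD {l : α → List β} {d : α → β} (hl : PT l) (hd : PT d) : PT fun a => (l a).headD (d a) := by
  have := PT.casesList hl hd (g := fun _ x _ => x) (by fun_prop)
  refine this.congr fun a => ?_
  cases l a <;> rfl

@[fun_prop] theorem PT.tail {l : α → List β} (hl : PT l) : PT fun a => (l a).tail := by
  have := PT.casesList hl (.const []) (g := fun _ _ t => t) (by fun_prop)
  refine this.congr fun a => ?_
  cases l a <;> rfl

@[fun_prop] theorem PT.isEmpty {l : α → List β} (hl : PT l) : PT fun a => (l a).isEmpty := by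
  have := PT.casesList hl (.const true) (g := fun _ _ _ => false) (by fun_prop)
  refine this.congr fun a => ?_
  cases l a <;> rfl

theorem PT.drop {l : α → List β} (n : ℕ) (hl : PT l) : PT fun a => (l a).drop n := by
  induction n with
  | zero => simpa using hl
  | succ n ih => simpa [List.tail_drop] using ih.tail

theorem PT.getD {l : α → List β} (n : ℕ) (d : β) (hl : PT l) : PT fun a => (l a).getD n d := by
  have := (PT.drop n hl).headD (.const d)
  refine this.congr fun a => ?_
  simp [List.headD_eq_head?_getD, List.getD_eq_getElem?_getD]

/-- Polynomial-time decidable equality. -/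
class PTEq (α : Type) [Enc α] [DecidableEq α] : Prop where
  pt : PT fun q : α × α => decide (q.1 = q.2)

@[fun_prop] theorem PT.decideEq [DecidableEq β] [PTEq β] {f g : α → β} (hf : PT f) (hg : PT g) :
    PT fun a => decide (f a = g a) :=
  PTEq.pt.comp (hf.pair hg)

instance : PTEq Bool := ⟨by
  have : PT fun q : Bool × Bool => bif q.1 then q.2 else !q.2 := PT.cond (by fun_prop) (by fun_prop) (by fun_prop)
  refine PT.congr this fun ⟨a, b⟩ => ?_
  cases a <;> cases b <;> rfl⟩

instance [DecidableEq α] [DecidableEq β] [PTEq α] [PTEq β] : PTEq (α × β) := ⟨by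
  have : PT fun q : (α × β) × (α × β) => decide (q.1.1 = q.2.1) && decide (q.1.2 = q.2.2) := by fun_prop
  refine PT.congr this fun ⟨a, b⟩ => ?_
  simp [Prod.ext_iff]⟩

/-- One step of the comparison of two lists. -/
def eqStep [DecidableEq α] (s : Bool × List α) (x : α) : Bool × List α :=
  match s.2 with
  | [] => (false, [])
  | y :: t => (s.1 && decide (x = y), t)

theorem foldl_eqStep {δ : Type} [DecidableEq δ] (l : List δ) (s : Bool × List δ) :
    ((l.foldl eqStep s).1 && (l.foldl eqStep s).2.isEmpty) = (s.1 && decide (l = s.2)) := by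
  induction l generalizing s with
  | nil => obtain ⟨b, l'⟩ := s; cases l' <;> simp
  | cons x l ih =>
    obtain ⟨b, l'⟩ := s
    rw [List.foldl_cons, ih]
    cases l' with
    | nil => simp [eqStep]
    | cons y t => rw [Bool.eq_iff_iff]; simp [eqStep, and_assoc]; intros; exact decide_eq_true_iff

instance [DecidableEq α] [PTEq α] : PTEq (List α) := ⟨by
  have hg : PT fun q : (List α × List α) × (Bool × List α) × α => eqStep q.2.1 q.2.2 := by
    have := PT.casesList (α := (List α × List α) × (Bool × List α) × α) (l := fun q => q.2.1.2)
      (f := fun _ => ((false, []) : Bool × List α))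
      (g := fun q y t => ((q.2.1.1 && decide (q.2.2 = y), t) : Bool × List α)) (by fun_prop) (by fun_prop) (by fun_prop)
    refine this.congr fun q => ?_
    unfold eqStep
    cases q.2.1.2 <;> rfl
  have h1 : PT fun q : List α × List α => q.1.foldl eqStep (true, q.2) := by
    refine PT.foldl (g := fun _ => eqStep) hg (by fun_prop) (by fun_prop) ⟨3, fun a s x _ => ?_⟩
    obtain ⟨b, l⟩ := s
    cases l with
    | nil => have := sz_bool false; simp [eqStep]; omega
    | cons y t => have := sz_bool (b && decide (x = y)); simp [eqStep]; omega
  refine PT.congr (h1.fst.and h1.snd.isEmpty) fun ⟨a, b⟩ => ?_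
  simp [foldl_eqStep]⟩

@[fun_prop] theorem PT.bits {f : α → ℕ} (hf : PT f) : PT fun a => (f a).bits :=
  (PT.recode (f := Nat.bits) fun _ => rfl).comp hf

theorem bits_injective : Function.Injective Nat.bits := fun a b h => by
  have := congrArg (fun l => l.foldr (fun b n => Nat.bit b n) 0) h
  have key : ∀ n : ℕ, n.bits.foldr (fun b n => Nat.bit b n) 0 = n := by
    intro n
    induction n using Nat.binaryRec' with
    | zero => simp
    | bit b n h ih => rw [Nat.bits_append_bit n b h]; simp [ih]
  simpa [key] using this

instance : PTEq ℕ := ⟨by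
  have : PT fun q : ℕ × ℕ => decide (q.1.bits = q.2.bits) := by fun_prop
  refine PT.congr this fun ⟨a, b⟩ => ?_
  simp [bits_injective.eq_iff]⟩

theorem PT.elem [DecidableEq β] [PTEq β] {f : α → β} {l : α → List β} [∀ a, Decidable (f a ∈ l a)]
    (hf : PT f) (hl : PT l) : PT fun a => decide (f a ∈ l a) := by
  have : PT fun a => (l a).any fun x => decide (f a = x) :=
    PT.any hl (PT.decideEq (by fun_prop) (by fun_prop))
  refine this.congr fun a => ?_
  simp [List.any_eq]

end

end DC

namespace DC

open Enc

/-! ## From stack machines to Turing machines -/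

def symEquiv : Sym ≃ Fin (78 + 3) := finFunctionFinEquiv (m := 3) (n := 4)

theorem symEquiv_zero : symEquiv 0 = 0 := by decide

theorem symEquiv_bsym (b : Bool) : symEquiv (Function.update 0 0 (bsym b)) = if b then 2 else 1 := by
  cases b <;> decide

theorem exists_stateEquiv (M : Mach) : ∃ (q : ℕ) (e : Option M.Q ≃ Fin (q + 1)), e (some M.entry) = 0 := by
  have := M.fin
  classical
  let e₀ : Option M.Q ≃ Fin (Fintype.card M.Q + 1) := Fintype.equivFinOfCardEq (by simp)
  exact ⟨_, e₀.trans (Equiv.swap (e₀ (some M.entry)) 0), by simp⟩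

def Mach.toTM (M : Mach) (q : ℕ) (e : Option M.Q ≃ Fin (q + 1)) : TM where
  q := q
  k := 78
  δ := fun s a => (e.symm s).map fun s' =>
    (e (M.δ s' (symEquiv.symm a)).1, symEquiv (M.δ s' (symEquiv.symm a)).2.1, (M.δ s' (symEquiv.symm a)).2.2)

def Conf.toTM (M : Mach) {q : ℕ} (e : Option M.Q ≃ Fin (q + 1)) (c : Conf M.Q) : TMCfg (M.toTM q e) :=
  ⟨e c.st, fun z => symEquiv (c.tape z), c.head⟩

theorem Reach.toTM {M : Mach} {q : ℕ} (e : Option M.Q ≃ Fin (q + 1)) {n : ℕ} {c d : Conf M.Q}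
    (h : Reach M.δ n c d) : (M.toTM q e).iter n (c.toTM M e) = some (d.toTM M e) := by
  induction h with
  | refl => rfl
  | @step n s T h c _ ih =>
    rw [TM.iter]
    have : (M.toTM q e).step (Conf.toTM M e ⟨some s, T, h⟩) = some (Conf.toTM M e
        ⟨(M.δ s (T h)).1, Function.update T h (M.δ s (T h)).2.1, mv (M.δ s (T h)).2.2 h⟩) := by
      simp only [TM.step, Mach.toTM, Conf.toTM, Equiv.symm_apply_apply, Option.map_some, mv]
      congr 2
      funext z
      by_cases hz : z = h
      · subst hz; simp
      · simp [hz]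
    rw [this]
    exact ih

theorem cell_reverse (x : List Bool) (z : ℤ) : cell x.reverse z =
    if h : 0 ≤ z ∧ z.toNat < x.length then bsym (x.get ⟨z.toNat, h.2⟩) else 0 := by
  induction x using List.reverseRecOn with
  | nil => simp [cell]
  | append_singleton x b ih =>
    simp only [List.reverse_append, List.reverse_singleton, List.singleton_append, cell, ih, List.length_reverse]
    split_ifs with h1 h2 h3 h4 h5
    · subst h1; simp
    · simp at h2; omega
    · congr 1
      simp [List.getElem_append_left h3.2]
    · simp at h4; omega
    · simp at h5; omega
    · rfl

theorem tp_reverse (x : List Bool) (z : ℤ) : tp (st x.reverse [] [] []) z =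
    if h : 0 ≤ z ∧ z.toNat < x.length then Function.update (0 : Sym) 0 (bsym (x.get ⟨z.toNat, h.2⟩)) else 0 := by
  funext i
  have h0 : tp (st x.reverse [] [] []) z 0 = cell x.reverse z := rfl
  have h1 : ∀ i ≠ 0, tp (st x.reverse [] [] []) z i = 0 := by
    intro i hi
    fin_cases i
    · simp at hi
    all_goals rfl
  by_cases hi : i = 0
  · subst hi
    rw [h0, cell_reverse]
    split_ifs <;> simp
  · rw [h1 i hi]
    split_ifs <;> simp [hi]

theorem polyTime_of_mach {f : List Bool → List Bool} (M : Mach) (p : Polynomial ℕ)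
    (h : ∀ x, M.Run (p.eval x.length) (st x.reverse [] [] []) (st (f x).reverse [] [] [])) :
    PolyTimeComputable f := by
  obtain ⟨q, e, he⟩ := exists_stateEquiv M
  refine ⟨M.toTM q e, p * (2 * (.X + p) + 4), fun x => ?_⟩
  obtain ⟨⟨t, ht, hr⟩, -⟩ := h x
  have hsym : ∀ b, symEquiv (Function.update 0 0 (bsym b)) = (M.toTM q e).boolSym b := symEquiv_bsym
  have hz : symEquiv 0 = (0 : Fin ((M.toTM q e).k + 3)) := symEquiv_zero
  have hi : (M.toTM q e).init x = Conf.toTM M e ⟨some M.entry, tp (st x.reverse [] [] []), 0⟩ := by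
    simp only [TM.init, Conf.toTM, he, tp_reverse]
    congr 1
    funext z
    split_ifs
    · exact (hsym _).symm
    · exact hz.symm
  refine ⟨t, ?_, _, ⟨hi ▸ hr.toTM e, ?_⟩, ?_, ?_⟩
  · simpa [tot, Fin.sum_univ_four] using ht
  · simp [TM.step, Conf.toTM, Mach.toTM]
  · intro i
    simp only [Conf.toTM, tp_reverse]
    rw [dif_pos (by simp)]
    exact hsym _
  · simp only [Conf.toTM, tp_reverse]
    rw [dif_neg (by simp)]
    exact hz

theorem unload12 (b a c d : List Bool) :
    (Mach.unload 1 2).Run (2 * b.length + 2) (st a b c d) (st a [] (b.reverse ++ c) d) := by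
  induction b generalizing c with
  | nil => exact run_forEach_nil _ _ rfl
  | cons x l ih =>
    have h := run_forEach_cons 1 (Mach.push 2) (s := st a (x :: l) c d) rfl
      (by rw [st_up1]; exact push2 _ _ _ _ _) (ih (x :: c))
    simpa [Mach.unload] using Mach.Run.mono h (by simp; omega)

/-- Push the cell of an encoded list of bits. -/
def Mach.pushBit (b : Bool) : Mach :=
  bif b then (Mach.push 1 false).seq ((Mach.push 1 false).seq ((Mach.push 1 true).seq (.push 1 true)))
  else (Mach.push 1 false).seq (.push 1 true)

theorem run_pushBit (x : Bool) (a b c d : List Bool) :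
    (Mach.pushBit x).Run 4 (st a b c d) (st a (true :: (code x ++ b)) c d) := by
  cases x
  · exact ((push1 false _ _ _ _).seq (push1 true _ _ _ _)).mono (by omega)
  · exact (push1 false _ _ _ _).seq ((push1 false _ _ _ _).seq
      ((push1 true _ _ _ _).seq (push1 true _ _ _ _)))

def Mach.encode : Mach := (Mach.push 1 false).seq ((Mach.forEach 0 .pushBit).seq
  ((Mach.unload 1 2).seq (.unload 2 0)))

theorem sz_bools (x : List Bool) : sz x ≤ 4 * x.length + 1 := by
  induction x with
  | nil => simp
  | cons b x ih => have := sz_bool b; simp; omega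

theorem run_encode (x : List Bool) :
    Mach.encode.Run (21 * x.length + 11) (st x.reverse [] [] []) (st (code x) [] [] []) := by
  have key : ∀ l y : List Bool, (Mach.forEach 0 .pushBit).Run (5 * l.length + 2) (st l (code y) [] [])
      (st [] (code (l.reverse ++ y)) [] []) := by
    intro l
    induction l with
    | nil => intro y; exact run_forEach_nil _ _ rfl
    | cons b l ih =>
      intro y
      have h := run_forEach_cons 0 Mach.pushBit (s := st (b :: l) (code y) [] []) rfl
        (by rw [st_up0]; exact run_pushBit b _ _ _ _) (ih (b :: y))
      simpa using Mach.Run.mono h (by simp; omega)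
  have h := (push1 false x.reverse [] [] []).seq ((key x.reverse []).seq
    ((unload12 _ _ _ _).seq (unload20 _ _ _ _)))
  simp only [List.append_nil, List.reverse_reverse, List.length_reverse] at h
  refine h.mono ?_
  have := sz_bools x
  unfold sz at this
  omega

def Mach.decode : Mach := Mach.seq (.branch 0 (br .skip .skip (.branch 0 (br .skip (.push 1 false)
    ((Mach.pop 0).seq ((Mach.pop 0).seq (.push 1 true)))) fun _ => false)) fun x => x == some true)
  ((Mach.unload 1 2).seq (.unload 2 0))

theorem run_decode (x : List Bool) :
    Mach.decode.Run (11 * x.length + 7) (st (code x) [] [] []) (st x.reverse [] [] []) := by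
  have key : ∀ l y : List Bool, (Mach.branch 0 (br .skip .skip (.branch 0 (br .skip (.push 1 false)
      ((Mach.pop 0).seq ((Mach.pop 0).seq (.push 1 true)))) fun _ => false)) fun x => x == some true).Run
      (7 * l.length + 2) (st (code l) y [] []) (st [] (l.reverse ++ y) [] []) := by
    intro l
    induction l with
    | nil => intro y; exact run_branch 0 _ _ (n := 1) rfl (by rw [st_up0]; exact run_skip _)
    | cons b l ih =>
      intro y
      have := run_loop 0 (br .skip .skip (.branch 0 (br .skip (.push 1 false)
        ((Mach.pop 0).seq ((Mach.pop 0).seq (.push 1 true)))) fun _ => false)) (fun x => x == some true)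
        (s := st (code (b :: l)) y [] []) (n := 6) rfl ?_ (ih (b :: y))
      · simpa using Mach.Run.mono this (by simp; omega)
      · rw [st_up0]
        refine run_branch 0 _ _ (n := 5) rfl ?_
        rw [st_up0]
        cases b
        · exact Mach.Run.mono (push1 false _ _ _ _) (by omega)
        · exact (run_pop0 _ _ _ _ _).seq ((run_pop0 _ _ _ _ _).seq (push1 _ _ _ _ _))
  have h := (key x []).seq ((unload12 _ _ _ _).seq (unload20 _ _ _ _))
  simp only [List.append_nil, List.reverse_reverse, List.length_reverse] at h
  exact h.mono (by omega)

theorem PT.polyTime {f : List Bool → List Bool} (hf : PT f) : PolyTimeComputable f := by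
  obtain ⟨q, hq⟩ := hf.size
  obtain ⟨M, p, h⟩ := hf
  refine polyTime_of_mach (Mach.encode.seq (M.seq .decode))
    (21 * .X + 11 + (p.comp (4 * .X + 1) + (11 * q.comp (4 * .X + 1) + 7))) fun x => ?_
  have h1 := (run_encode x).seq (Mach.Run.seq (by simpa using h x []) (run_decode (f x)))
  refine h1.mono ?_
  have h2 := eval_mono p (sz_bools x)
  have h3 := eval_mono q (sz_bools x)
  have h4 := hq x
  have h5 := length_lt_sz (f x)
  simp
  omega

end DC

namespace DC

open Enc

/-! ## Simulating Turing machines -/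

instance {n : ℕ} : Enc (Fin n) := ⟨fun i => enc (i : ℕ)⟩

@[fun_prop] theorem PT.val {α : Type} [Enc α] {n : ℕ} {f : α → Fin n} (hf : PT f) : PT fun a => (f a : ℕ) :=
  (PT.recode (f := fun i : Fin n => (i : ℕ)) fun _ => rfl).comp hf

instance {n : ℕ} : PTEq (Fin n) := ⟨by
  have : PT fun q : Fin n × Fin n => decide ((q.1 : ℕ) = q.2) := by fun_prop
  refine this.congr fun q => ?_
  simp [Fin.ext_iff]⟩

theorem PT.of_fintype {α β : Type} [Enc α] [Enc β] [Fintype α] [DecidableEq α] [PTEq α] (f : α → β) : PT f := by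
  rcases isEmpty_or_nonempty α with h | ⟨⟨d⟩⟩
  · exact ⟨.skip, 0, fun a => h.elim a⟩
  have key : ∀ l : List α, ∃ g : α → β, PT g ∧ ∀ a ∈ l, g a = f a := by
    intro l
    induction l with
    | nil => exact ⟨fun _ => f d, by fun_prop, by simp⟩
    | cons x l ih =>
      obtain ⟨g, hg, hgf⟩ := ih
      refine ⟨fun a => bif decide (a = x) then f x else g a, PT.cond (by fun_prop) (by fun_prop) hg, ?_⟩
      intro a ha
      by_cases e : a = x
      · simp [e]
      · simp [e, hgf a ((List.mem_cons.1 ha).resolve_left e)]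
  obtain ⟨g, hg, hgf⟩ := key Finset.univ.toList
  exact hg.congr fun a => hgf a (by simp)

/-- Simulated configurations: state, tape left of the head, tape from the head on, and the number of
cells left of the origin. -/
abbrev SimCfg (M : TM) : Type :=
  Fin (M.q + 1) × List (Fin (M.k + 3)) × List (Fin (M.k + 3)) × List Unit

def simAct (M : TM) (q : Fin (M.q + 1) × Fin (M.k + 3)) : Bool × Fin (M.q + 1) × Fin (M.k + 3) × Bool :=
  (M.δ q.1 q.2).elim (false, 0, 0, false) fun r => (true, r)

def simMove {M : TM} (u : SimCfg M) (r : Fin (M.q + 1) × Fin (M.k + 3) × Bool) : SimCfg M :=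
  bif r.2.2 then (r.1, r.2.1 :: u.2.1, u.2.2.1.tail, u.2.2.2)
  else (r.1, u.2.1.tail, u.2.1.headD 0 :: r.2.1 :: u.2.2.1.tail,
    bif u.2.1.isEmpty then () :: u.2.2.2 else u.2.2.2)

def simStep {M : TM} (u : SimCfg M) : SimCfg M :=
  bif (simAct M (u.1, u.2.2.1.headD 0)).1 then simMove u (simAct M (u.1, u.2.2.1.headD 0)).2 else u

theorem PT.simMove (M : TM) :
    PT fun u : SimCfg M × (Fin (M.q + 1) × Fin (M.k + 3) × Bool) => simMove u.1 u.2 := by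
  have h1 : PT fun u : SimCfg M × (Fin (M.q + 1) × Fin (M.k + 3) × Bool) => u.1.2.1.headD 0 :=
    PT.headD (by fun_prop) (.const _)
  have h4 : PT fun u : SimCfg M × (Fin (M.q + 1) × Fin (M.k + 3) × Bool) =>
      bif u.1.2.1.isEmpty then () :: u.1.2.2.2 else u.1.2.2.2 :=
    PT.cond (α := SimCfg M × (Fin (M.q + 1) × Fin (M.k + 3) × Bool)) (c := fun u => u.1.2.1.isEmpty)
      (f := fun u => () :: u.1.2.2.2) (g := fun u => u.1.2.2.2) (by fun_prop) (by fun_prop) (by fun_prop)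
  have h5 : PT fun u : SimCfg M × (Fin (M.q + 1) × Fin (M.k + 3) × Bool) =>
      ((u.2.1, u.1.2.1.tail, u.1.2.1.headD 0 :: u.2.2.1 :: u.1.2.2.1.tail,
        bif u.1.2.1.isEmpty then () :: u.1.2.2.2 else u.1.2.2.2) : SimCfg M) := by fun_prop
  have h6 : PT fun u : SimCfg M × (Fin (M.q + 1) × Fin (M.k + 3) × Bool) =>
      ((u.2.1, u.2.2.1 :: u.1.2.1, u.1.2.2.1.tail, u.1.2.2.2) : SimCfg M) := by fun_prop
  exact (PT.cond (c := fun u => u.2.2.2) (by fun_prop) h6 h5).congr fun u => rfl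

theorem PT.simStep (M : TM) : PT (simStep (M := M)) := by
  have h1 : PT fun u : SimCfg M => u.2.2.1.headD 0 := PT.headD (by fun_prop) (.const _)
  have h0 : PT fun u : SimCfg M => (u.1, u.2.2.1.headD 0) := by fun_prop
  have h2 : PT fun u : SimCfg M => simAct M (u.1, u.2.2.1.headD 0) :=
    (PT.of_fintype (simAct M)).comp h0
  have h3 := (PT.simMove M).comp (PT.id.pair h2.snd)
  exact (PT.cond h2.fst h3 PT.id).congr fun u => rfl

theorem exists_sz_fin (n : ℕ) : ∃ B, ∀ i : Fin n, sz i ≤ B :=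
  ⟨Finset.univ.sup fun i : Fin n => sz i, fun i => Finset.le_sup (f := fun i : Fin n => sz i) (Finset.mem_univ i)⟩

theorem sz_tail_le {α : Type} [Enc α] (l : List α) : sz l.tail ≤ sz l := by
  cases l with
  | nil => simp
  | cons x t => simp only [List.tail_cons, sz_cons]; omega

theorem sz_simStep (M : TM) : ∃ B, ∀ u : SimCfg M, sz (simStep u) ≤ sz u + B := by
  obtain ⟨B, hB⟩ := exists_sz_fin (M.q + 1)
  obtain ⟨C, hC⟩ := exists_sz_fin (M.k + 3)
  refine ⟨B + 2 * C + 10, fun u => ?_⟩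
  obtain ⟨s, L, R, o⟩ := u
  unfold simStep
  cases e : (simAct M (((s, L, R, o) : SimCfg M).1, R.headD 0)).1
  · simp only [cond_false]; omega
  simp only [cond_true]
  generalize (simAct M _).2 = r
  obtain ⟨s', a, b⟩ := r
  have h1 := hB s'
  have h2 := hC a
  have h3 := hC (L.headD 0)
  have h4 := sz_tail_le L
  have h5 := sz_tail_le R
  cases b
  · have h6 : sz (bif L.isEmpty then () :: o else o) ≤ sz o + 3 := by
      cases L.isEmpty
      · simp
      · simp only [cond_true, sz_cons, sz_unit]; omega
    simp only [cond_false, simMove, sz_pair, sz_cons]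
    omega
  · simp only [cond_true, simMove, sz_pair, sz_cons]
    omega

structure SimRel {M : TM} (c : TMCfg M) (u : SimCfg M) : Prop where
  state : c.state = u.1
  left : ∀ i : ℕ, c.tape (c.head - 1 - i) = u.2.1.getD i 0
  right : ∀ i : ℕ, c.tape (c.head + i) = u.2.2.1.getD i 0
  origin : c.head + u.2.2.2.length = u.2.1.length

theorem SimRel.halt {M : TM} {c : TMCfg M} {u : SimCfg M} (h : SimRel c u) (hs : M.step c = none) :
    DC.simStep u = u := by
  have h0 := h.right 0
  unfold TM.step at hs
  have : M.δ u.1 (u.2.2.1.headD 0) = none := by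
    rw [← h.state]
    have e : u.2.2.1.headD 0 = c.tape c.head := by
      rw [Nat.cast_zero, add_zero] at h0; rw [h0]; cases u.2.2.1 <;> rfl
    rw [e]
    cases e : M.δ c.state (c.tape c.head) with
    | none => rfl
    | some r => simp [e] at hs
  simp only [DC.simStep, simAct, this]
  rfl

theorem SimRel.step {M : TM} {c c' : TMCfg M} {u : SimCfg M} (h : SimRel c u) (hs : M.step c = some c') :
    SimRel c' (DC.simStep u) := by
  obtain ⟨hst, hl, hr, ho⟩ := h
  obtain ⟨s, L, R, o⟩ := u
  obtain ⟨cs, T, hd⟩ := c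
  simp only at hst hl hr ho
  subst hst
  have e : R.headD 0 = T hd := by
    have h0 := hr 0
    rw [Nat.cast_zero, add_zero] at h0; rw [h0]; cases R <;> rfl
  unfold TM.step at hs
  simp only at hs
  cases hδ : M.δ cs (T hd) with
  | none => simp [hδ] at hs
  | some r =>
    obtain ⟨s', a', b⟩ := r
    simp only [hδ, Option.some.injEq] at hs
    subst hs
    have htl : ∀ i : ℕ, T (hd + 1 + i) = R.tail.getD i 0 := fun i => by
      have := hr (i + 1)
      rw [show hd + 1 + (i : ℤ) = hd + ((i + 1 : ℕ) : ℤ) by push_cast; ring, this]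
      cases R <;> simp
    have hll : ∀ i : ℕ, T (hd - 1 - 1 - i) = L.tail.getD i 0 := fun i => by
      have := hl (i + 1)
      rw [show hd - 1 - 1 - (i : ℤ) = hd - 1 - ((i + 1 : ℕ) : ℤ) by push_cast; ring, this]
      cases L <;> simp
    cases b
    · have : DC.simStep ((cs, L, R, o) : SimCfg M) = (s', L.tail, L.headD 0 :: a' :: R.tail,
          bif L.isEmpty then () :: o else o) := by
        simp only [DC.simStep, e, simAct, hδ]; rfl
      rw [this]
      refine ⟨rfl, fun i => ?_, fun i => ?_, ?_⟩
      · simp only [Bool.false_eq_true, if_false]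
        rw [Function.update_of_ne (by omega)]
        exact hll i
      · simp only [Bool.false_eq_true, if_false]
        match i with
        | 0 =>
          rw [Function.update_of_ne (by simp)]
          have := hl 0
          simp only [Nat.cast_zero, sub_zero, add_zero] at this ⊢
          rw [this]; cases L <;> simp
        | 1 => simp
        | i + 2 =>
          rw [Function.update_of_ne (by push_cast; omega)]
          have := htl i
          simp only [List.getD_cons_succ]
          rw [← this]; congr 1; push_cast; ring
      · cases L with
        | nil => simp at ho ⊢; omega
        | cons x L => simp at ho ⊢; omega
    · have : DC.simStep ((cs, L, R, o) : SimCfg M) = (s', a' :: L, R.tail, o) := by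
        simp only [DC.simStep, e, simAct, hδ]; rfl
      rw [this]
      refine ⟨rfl, fun i => ?_, fun i => ?_, ?_⟩
      · simp only [if_true]
        match i with
        | 0 => simp
        | i + 1 =>
          rw [Function.update_of_ne (by push_cast; omega)]
          have := hl i
          simp only [List.getD_cons_succ]
          rw [← this]; congr 1; push_cast; ring
      · simp only [if_true]
        rw [Function.update_of_ne (by omega)]
        exact htl i
      · simp at ho ⊢; omega

theorem SimRel.iterate {M : TM} (t n : ℕ) (htn : t ≤ n) : ∀ {c c' : TMCfg M} {u : SimCfg M}, SimRel c u →
    M.iter t c = some c' → M.step c' = none → SimRel c' (DC.simStep^[n] u) := by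
  induction t generalizing n with
  | zero =>
    intro c c' u h hi hs
    simp only [TM.iter, Option.some.injEq] at hi
    subst hi
    rwa [Function.iterate_fixed (h.halt hs)]
  | succ t ih =>
    intro c c' u h hi hs
    obtain ⟨n, rfl⟩ : ∃ k, n = k + 1 := ⟨n - 1, by omega⟩
    rw [TM.iter, Option.bind_eq_some_iff] at hi
    obtain ⟨d, hd, hi⟩ := hi
    rw [Function.iterate_succ_apply]
    exact ih n (by omega) (h.step hd) hi hs

theorem fin_two_ne {k : ℕ} : (2 : Fin (k + 3)) ≠ 0 ∧ (2 : Fin (k + 3)) ≠ 1 := by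
  have h2 : ((2 : Fin (k + 3)) : ℕ) = 2 := Nat.mod_eq_of_lt (show 2 < k + 3 by omega)
  have h1 : ((1 : Fin (k + 3)) : ℕ) = 1 := Nat.mod_eq_of_lt (show 1 < k + 3 by omega)
  have h0 : ((0 : Fin (k + 3)) : ℕ) = 0 := rfl
  constructor <;> intro h <;> have := congrArg Fin.val h <;> omega

/-- One step of reading off the output. -/
def readStep {k : ℕ} (acc : List Bool) (c : Fin (k + 3)) : List Bool :=
  bif decide (c = 1) then false :: acc else bif decide (c = 2) then true :: acc else []

theorem foldr_readStep {M : TM} (y : List Bool) : ∀ T : List (Fin (M.k + 3)),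
    (∀ i (h : i < y.length), T.getD i 0 = M.boolSym y[i]) → T.getD y.length 0 = 0 →
    T.foldr (fun c acc => readStep acc c) [] = y := by
  induction y with
  | nil =>
    intro T _ h
    cases T with
    | nil => rfl
    | cons a T =>
      simp at h; subst h
      have : (0 : Fin (M.k + 3)) ≠ 2 := fin_two_ne.1.symm
      simp [readStep, this]
  | cons b y ih =>
    intro T h h'
    cases T with
    | nil =>
      have := h 0 (by simp)
      have h2 : (0 : Fin (M.k + 3)) ≠ 2 := fin_two_ne.1.symm
      cases b <;> simp [TM.boolSym] at this
      exact absurd this h2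
    | cons a T =>
      have h0 := h 0 (by simp)
      have := ih T (fun i hi => by
        have := h (i + 1) (by simp; omega)
        simpa only [List.getD_cons_succ, List.getElem_cons_succ] using this) (by simpa using h')
      simp only [List.foldr_cons, this]
      simp at h0
      subst h0
      have h2 : (2 : Fin (M.k + 3)) ≠ 1 := fin_two_ne.2
      cases b <;> simp [TM.boolSym, readStep, h2]

def simInit (M : TM) (x : List Bool) : SimCfg M := (0, [], x.map M.boolSym, [])

theorem simInit_rel (M : TM) (x : List Bool) : SimRel (M.init x) (simInit M x) := by
  refine ⟨rfl, fun i => ?_, fun i => ?_, by simp [TM.init, simInit]⟩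
  · simp only [TM.init, simInit]
    rw [dif_neg (by omega)]; simp
  · simp only [TM.init, simInit, zero_add, Int.toNat_natCast, Nat.cast_nonneg, true_and]
    split_ifs with h
    · simp [h]
    · simp [h]

def simOut {M : TM} (u : SimCfg M) : List Bool :=
  (u.2.2.2.foldl (fun s _ => s.tail) (u.2.1.reverse ++ u.2.2.1)).reverse.foldl readStep []

theorem simOut_eq {M : TM} {c : TMCfg M} {u : SimCfg M} (h : SimRel c u) {y : List Bool}
    (hy : M.OutputIs c y) : simOut u = y := by
  obtain ⟨s, L, R, o⟩ := u
  have hdrop : ∀ (o : List Unit) (l : List (Fin (M.k + 3))), o.foldl (fun s _ => s.tail) l = l.drop o.length := by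
    intro o
    induction o with
    | nil => simp
    | cons x o ih => intro l; simp [ih, List.drop_tail]
  have ht : ∀ j : ℕ, c.tape j = ((L.reverse ++ R).drop o.length).getD j 0 := by
    intro j
    have ho := h.origin
    have hLl : ((s, L, R, o) : SimCfg M).2.1.length = L.length := rfl
    simp only at ho
    rw [List.getD_eq_getElem?_getD, List.getElem?_drop, ← List.getD_eq_getElem?_getD]
    by_cases hj : o.length + j < L.length
    · have h1 := h.left (L.length - 1 - (o.length + j))
      rw [show c.head - 1 - ((L.length - 1 - (o.length + j) : ℕ) : ℤ) = j by omega] at h1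
      rw [h1, List.getD_append _ _ _ _ (by simpa using hj)]
      rw [List.getD_eq_getElem _ _ (by simp only; omega), List.getD_eq_getElem _ _ (by rw [List.length_reverse]; exact hj), List.getElem_reverse]
    · have h1 := h.right (o.length + j - L.length)
      rw [show c.head + ((o.length + j - L.length : ℕ) : ℤ) = j by omega] at h1
      rw [h1, List.getD_append_right _ _ _ _ (by rw [List.length_reverse]; omega)]
      simp
  simp only [simOut, hdrop, List.foldl_reverse]
  refine foldr_readStep y _ (fun i hi => ?_) ?_
  · rw [← ht]; exact hy.1 ⟨i, hi⟩
  · rw [← ht]; exact hy.2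

theorem PT.simOut (M : TM) : PT (simOut (M := M)) := by
  have h1 : PT fun u : SimCfg M => u.2.2.2.foldl (fun s _ => s.tail) (u.2.1.reverse ++ u.2.2.1) := by
    refine PT.foldl (g := fun (_ : SimCfg M) (s : List (Fin (M.k + 3))) (_ : Unit) => s.tail) (by fun_prop) (by fun_prop) (by fun_prop)
      ⟨0, fun a s x _ => ?_⟩
    cases s with
    | nil => simp
    | cons y t => simp only [List.tail_cons, sz_cons]; omega
  refine PT.foldl (g := fun _ => readStep) ?_ h1.reverse (.const _) ⟨5, fun a s x _ => ?_⟩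
  · exact PT.cond (by fun_prop) (by fun_prop) (PT.cond (by fun_prop) (by fun_prop) (by fun_prop))
  · have := sz_bool false
    have := sz_bool true
    have := sz_pos s
    simp only [readStep, Polynomial.eval_ofNat]
    cases decide (x = 1) <;> cases decide (x = 2) <;> simp <;> omega

theorem exists_clock {α β : Type} [Enc α] [Enc β] {l : α → List β} (hl : PT l) (p : Polynomial ℕ) :
    ∃ c : α → List Unit, PT c ∧ ∀ a, (c a).length = p.eval (l a).length := by
  induction p using Polynomial.induction_on' with
  | add p q hp hq =>
    obtain ⟨c, hc, h⟩ := hp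
    obtain ⟨c', hc', h'⟩ := hq
    exact ⟨fun a => c a ++ c' a, by fun_prop, fun a => by simp [h, h']⟩
  | monomial n k =>
    induction n with
    | zero => exact ⟨fun _ => List.replicate k (), by fun_prop, fun a => by simp⟩
    | succ n ih =>
      obtain ⟨c, hc, h⟩ := ih
      refine ⟨fun a => (c a).flatMap fun _ => (l a).map fun _ => (),
        PT.flatMap hc (PT.map (f := fun _ _ => ()) (hl.comp (by fun_prop)) (by fun_prop)), fun a => ?_⟩
      simp only [Polynomial.eval_monomial] at h ⊢
      simp [h, pow_succ, mul_assoc]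

theorem PT.of_polyTime {f : List Bool → List Bool} (hf : PolyTimeComputable f) : PT f := by
  obtain ⟨M, p, h⟩ := hf
  obtain ⟨c, hc, hcl⟩ := exists_clock (PT.id (α := List Bool)) p
  have h0 : PT (simInit M) := by
    have : PT fun x : List Bool => x.map M.boolSym :=
      PT.map (f := fun _ => M.boolSym) (by fun_prop) ((PT.of_fintype M.boolSym).comp (by fun_prop))
    unfold simInit
    fun_prop
  have h1 : PT fun x => (c x).foldl (fun u _ => DC.simStep u) (simInit M x) := by
    refine PT.foldl (g := fun _ u _ => DC.simStep u) ((PT.simStep M).comp (by fun_prop)) hc h0 ?_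
    obtain ⟨B, hB⟩ := sz_simStep M
    exact ⟨Polynomial.C B, fun a s x _ => by rw [Polynomial.eval_C]; exact hB s⟩
  refine ((PT.simOut M).comp h1).congr fun x => ?_
  obtain ⟨t, ht, c', ⟨hi, hs⟩, ho⟩ := h x
  rw [List.foldl_const]
  exact simOut_eq (SimRel.iterate t _ (by rw [hcl]; exact ht) (simInit_rel M x) hi hs) ho

end DC

namespace DC

open Enc

/-! ## Encoding and decoding lists of number lists -/

theorem PT.of_enc {α β γ : Type} [Enc α] [Enc β] [Enc γ] {f : α → β} {g : α → γ} (hg : PT g)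
    (h : ∀ a, enc (f a) = enc (g a)) : PT f := by
  obtain ⟨M, p, hM⟩ := hg
  refine ⟨M, p, fun a r => ?_⟩
  have e : code (f a) = code (g a) := by rw [code, code, h]
  rw [e]
  exact hM a r

theorem PT.foldr {α β σ : Type} [Enc α] [Enc β] [Enc σ] {l : α → List β} {s : α → σ} {g : α → β → σ → σ}
    (hg : PT fun q : α × β × σ => g q.1 q.2.1 q.2.2) (hl : PT l) (hs : PT s)
    (hb : ∃ p : Polynomial ℕ, ∀ a s, ∀ x ∈ l a, sz (g a x s) ≤ sz s + p.eval (sz (a, x))) :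
    PT fun a => (l a).foldr (g a) (s a) := by
  obtain ⟨p, hp⟩ := hb
  have : PT fun a => (l a).reverse.foldl (fun s x => g a x s) (s a) := by
    refine PT.foldl (g := fun a s x => g a x s) ?_ hl.reverse hs ⟨p, fun a s x hx => hp a s x (by simpa using hx)⟩
    exact hg.comp (f := fun q : α × σ × β => (q.1, q.2.2, q.2.1)) (by fun_prop)
  exact this.congr fun a => by rw [List.foldl_reverse]

@[fun_prop] theorem PT.bit {α : Type} [Enc α] {b : α → Bool} {n : α → ℕ} (hb : PT b) (hn : PT n) :
    PT fun a => Nat.bit (b a) (n a) := by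
  have : PT fun a => bif !b a && decide (n a = 0) then [] else b a :: (n a).bits :=
    PT.cond (c := fun a => !b a && decide (n a = 0)) (f := fun _ => []) (g := fun a => b a :: (n a).bits)
      (by fun_prop) (by fun_prop) (by fun_prop)
  refine this.of_enc fun a => ?_
  change enc (Nat.bits _) = _
  congr 1
  cases hb : b a <;> by_cases hn : n a = 0
  · simp [hn]
  · simp [hn]
  · simp [hn]
  · simp [hn]

theorem sz_nat (n : ℕ) : sz n = sz n.bits := rfl

theorem sz_bit_le (b : Bool) (n : ℕ) : sz (Nat.bit b n) ≤ sz n + 4 := by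
  have h1 := sz_bool b
  by_cases h : n = 0 ∧ b = false
  · obtain ⟨rfl, rfl⟩ := h; simp [Nat.bit]
  · rw [sz_nat, sz_nat, Nat.bits_append_bit n b (fun h0 => by
      cases b with
      | false => exact absurd ⟨h0, rfl⟩ h
      | true => rfl), sz_cons]
    omega

def ofBits (w : List Bool) : ℕ := w.foldr Nat.bit 0

@[simp] theorem ofBits_bits (n : ℕ) : ofBits n.bits = n := by
  induction n using Nat.binaryRec' with
  | zero => rfl
  | bit b n h ih => rw [Nat.bits_append_bit n b h]; simp only [ofBits, List.foldr_cons] at ih ⊢; rw [ih]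

@[fun_prop] theorem PT.ofBits {α : Type} [Enc α] {w : α → List Bool} (hw : PT w) : PT fun a => ofBits (w a) := by
  refine PT.comp (g := DC.ofBits) ?_ hw
  exact PT.foldr (g := fun _ b n => Nat.bit b n) (by fun_prop) (by fun_prop) (by fun_prop)
    ⟨4, fun a s x _ => by have := sz_bit_le x s; simpa using this⟩

/-- Parsing step for `encListAux`, reading from the right. -/
def decStep (b : Bool) (s : List (List Bool) × List Bool) : List (List Bool) × List Bool :=
  bif s.2.isEmpty then (s.1, [b])
  else bif decide (b = s.2.headD false) then ((b :: s.1.headD []) :: s.1.tail, []) else ([] :: s.1, [])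

def decList (x : List Bool) : List (List Bool) := (x.foldr decStep ([], [])).1

@[simp] theorem decList_encListAux (l : List (List Bool)) : decList (encListAux l) = l := by
  suffices h : (encListAux l).foldr decStep ([], []) = (l, []) by rw [decList, h]
  induction l with
  | nil => rfl
  | cons x l ih =>
    simp only [encListAux, List.flatMap_cons, List.foldr_append] at ih ⊢
    rw [ih]
    have : [false, true].foldr decStep (l, []) = ([] :: l, []) := rfl
    rw [this]
    induction x with
    | nil => rfl
    | cons b x ih =>
      rw [List.flatMap_cons, List.foldr_append, ih]
      cases b <;> rfl

@[fun_prop] theorem PT.decList {α : Type} [Enc α] {x : α → List Bool} (hx : PT x) : PT fun a => decList (x a) := by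
  refine PT.comp (g := DC.decList) ?_ hx
  have hst : PT fun q : List Bool × Bool × (List (List Bool) × List Bool) => decStep q.2.1 q.2.2 := by
    have h1 : PT fun q : List Bool × Bool × (List (List Bool) × List Bool) => q.2.2.2.headD false :=
      PT.headD (by fun_prop) (by fun_prop)
    have h2 : PT fun q : List Bool × Bool × (List (List Bool) × List Bool) => q.2.2.1.headD [] :=
      PT.headD (by fun_prop) (by fun_prop)
    have h3 : PT fun q : List Bool × Bool × (List (List Bool) × List Bool) => (q.2.2.1, [q.2.1]) := by fun_prop
    have h4 : PT fun q : List Bool × Bool × (List (List Bool) × List Bool) =>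
      ((q.2.1 :: q.2.2.1.headD []) :: q.2.2.1.tail, ([] : List Bool)) := by fun_prop
    have h5 : PT fun q : List Bool × Bool × (List (List Bool) × List Bool) => ([] :: q.2.2.1, ([] : List Bool)) := by
      fun_prop
    have h6 : PT fun q : List Bool × Bool × (List (List Bool) × List Bool) =>
      decide (q.2.1 = q.2.2.2.headD false) := by fun_prop
    have h7 : PT fun q : List Bool × Bool × (List (List Bool) × List Bool) => q.2.2.2.isEmpty := by fun_prop
    exact (PT.cond h7 h3 (PT.cond h6 h4 h5)).congr fun q => rfl
  have : PT fun x : List Bool => x.foldr decStep ([], []) := by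
    refine PT.foldr (g := fun _ => decStep) hst (by fun_prop) (by fun_prop) ⟨.C 8, fun a s x _ => ?_⟩
    obtain ⟨A, P⟩ := s
    have h1 := sz_bool x
    rw [Polynomial.eval_C]
    cases P with
    | nil => simp [decStep]; omega
    | cons c P =>
      simp only [decStep, List.isEmpty_cons, cond_false, List.headD_cons]
      have h2 := sz_pos c
      have h3 := sz_pos P
      have h4 := sz_bool c
      by_cases e : x = c
      · cases A with
        | nil => simp [e]; omega
        | cons y A => simp [e]; omega
      · simp [e]; omega
  unfold DC.decList
  exact this.fst

@[fun_prop] theorem PT.encListAux {α : Type} [Enc α] {l : α → List (List Bool)} (hl : PT l) :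
    PT fun a => encListAux (l a) := by
  refine PT.comp (g := _root_.encListAux) ?_ hl
  have h : PT fun q : List (List Bool) × List Bool => q.2.flatMap fun b => [b, b] :=
    PT.flatMap (f := fun _ b => [b, b]) (by fun_prop) (by fun_prop)
  exact PT.flatMap (l := fun l : List (List Bool) => l) (f := fun _ x => (x.flatMap fun b => [b, b]) ++ [false, true])
    (by fun_prop) (by fun_prop)

def encLL (l : List (List ℕ)) : List Bool := encListAux (l.map encNats)
def decLL (x : List Bool) : List (List ℕ) := (decList x).map fun y => (decList y).map ofBits

@[simp] theorem decLL_encLL (l : List (List ℕ)) : decLL (encLL l) = l := by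
  simp [decLL, encLL, encNats, encNat, Function.comp_def]

theorem PT.encLL : PT encLL := by
  have h : PT fun q : List (List ℕ) × List ℕ => encNats q.2 := by
    have : PT fun q : List (List ℕ) × List ℕ => q.2.map encNat :=
      PT.map (f := fun _ => encNat) (by fun_prop) (by unfold encNat; fun_prop)
    unfold encNats; fun_prop
  have : PT fun l : List (List ℕ) => l.map encNats := PT.map (f := fun _ => encNats) (by fun_prop) h
  unfold DC.encLL
  fun_prop

theorem PT.decLL : PT decLL := by
  have h : PT fun q : List Bool × List Bool => (DC.decList q.2).map DC.ofBits :=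
    PT.map (f := fun _ => DC.ofBits) (by fun_prop) (by fun_prop)
  exact PT.map (l := DC.decList) (f := fun _ y => (DC.decList y).map DC.ofBits) (by fun_prop) h

/-- A fact as a list of numbers: the predicate followed by the arguments. -/
def factList {m : ℕ} {ar : Fin m → ℕ} (a : GAtom (inSchema m ar) ℕ) : List ℕ := (a.p : Fin m).val :: List.ofFn a.args

theorem encDB_eq {m : ℕ} {ar : Fin m → ℕ} (l : List (GAtom (inSchema m ar) ℕ)) :
    encDB l = encLL (l.map factList) := by
  simp only [encDB, encLL, List.map_map]
  rfl

theorem encOut_eq {k : ℕ} (l : List (Fin k → ℕ)) : encOut l = encLL (l.map List.ofFn) := by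
  simp only [encOut, encLL, List.map_map]
  rfl

theorem dbPTime_iff {m : ℕ} {ar : Fin m → ℕ} {k : ℕ} (Q : Query m ar k) :
    DBPTime Q ↔ ∃ g : List (List ℕ) → List (List ℕ), PT g ∧ ∀ dbl : List (GAtom (inSchema m ar) ℕ),
      ∃ out : List (Fin k → ℕ), g (dbl.map factList) = out.map List.ofFn ∧ ∀ t, t ∈ out ↔ t ∈ Q {a | a ∈ dbl} := by
  constructor
  · rintro ⟨f, hf, h⟩
    refine ⟨fun l => decLL (f (encLL l)), PT.decLL.comp ((PT.of_polyTime hf).comp PT.encLL), fun dbl => ?_⟩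
    obtain ⟨out, h1, h2⟩ := h dbl
    refine ⟨out, ?_, h2⟩
    simp only
    rw [← encDB_eq, h1, encOut_eq, decLL_encLL]
  · rintro ⟨g, hg, h⟩
    refine ⟨fun x => encLL (g (decLL x)), (PT.encLL.comp (hg.comp PT.decLL)).polyTime, fun dbl => ?_⟩
    obtain ⟨out, h1, h2⟩ := h dbl
    refine ⟨out, ?_, h2⟩
    simp only
    rw [encDB_eq, decLL_encLL, h1, encOut_eq]

end DC

namespace DC

/-! ## Stable models -/

theorem isStable_iff {α : Type} {P : GProgram α} {M : Set α} :
    IsStableModel P M ↔ (∀ r ∈ P, r.Sat M) ∧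
      ∀ N : Set α, (∀ r ∈ P, (∀ a ∈ r.neg, a ∉ M) → r.pos ⊆ N → r.head ∈ N) → M ⊆ N := by
  have hmod : ∀ N : Set α, IsModel (reduct P M) N ↔
      ∀ r ∈ P, (∀ a ∈ r.neg, a ∉ M) → r.pos ⊆ N → r.head ∈ N := fun N => by
    constructor
    · intro h r hr hn hp
      exact h ⟨r.head, r.pos, ∅⟩ ⟨r, hr, hn, rfl⟩ hp (by simp)
    · rintro h _ ⟨r, hr, hn, rfl⟩ hp _
      exact h r hr hn hp
  constructor
  · intro h
    have h2 : ∀ N : Set α, (∀ r ∈ P, (∀ a ∈ r.neg, a ∉ M) → r.pos ⊆ N → r.head ∈ N) → M ⊆ N := by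
      intro N hN
      rw [IsStableModel] at h
      rw [h]
      exact Set.sInter_subset_of_mem ((hmod N).2 hN)
    refine ⟨fun r hr hp hn => ?_, h2⟩
    rw [IsStableModel] at h
    rw [h]
    intro N hN
    exact (hmod N).1 hN r hr hn (hp.trans (h2 N ((hmod N).1 hN)))
  · rintro ⟨h1, h2⟩
    refine Set.Subset.antisymm (fun x hx N hN => h2 N ((hmod N).1 hN) hx) ?_
    exact Set.sInter_subset_of_mem ((hmod M).2 fun r hr hn hp => h1 r hr hp hn)

theorem stable_induction {α : Type} {P : GProgram α} {M : Set α} (h : IsStableModel P M) (N : Set α)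
    (hN : ∀ r ∈ P, r.pos ⊆ M → (∀ a ∈ r.neg, a ∉ M) → r.pos ⊆ N → r.head ∈ N) : M ⊆ N := by
  rw [isStable_iff] at h
  have := h.2 (M ∩ N) fun r hr hn hp => ⟨h.1 r hr (fun x hx => (hp hx).1) hn,
    hN r hr (fun x hx => (hp hx).1) hn fun x hx => (hp hx).2⟩
  exact fun x hx => (this hx).2

theorem stable_supported {α : Type} {P : GProgram α} {M : Set α} (h : IsStableModel P M) {x : α} (hx : x ∈ M) :
    ∃ r ∈ P, r.head = x ∧ r.pos ⊆ M ∧ ∀ a ∈ r.neg, a ∉ M :=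
  stable_induction h {x | ∃ r ∈ P, r.head = x ∧ r.pos ⊆ M ∧ ∀ a ∈ r.neg, a ∉ M}
    (fun r hr hp hn _ => ⟨r, hr, rfl, hp, hn⟩) hx

/-- The atoms of a rule. -/
def atomsOf {S : Schema} {C : Type} (r : CRule S C) : List (Atom S C) := r.head :: (r.pos ++ r.neg)

theorem mem_consts {S : Schema} {C : Type} {P : CProgram S C} {c : C} :
    c ∈ CProgram.consts P ↔ ∃ r ∈ P, ∃ a ∈ atomsOf r, ∃ i, a.args i = .const c := by
  simp only [CProgram.consts, Set.mem_ofPred_eq, Atom.consts, atomsOf, List.mem_cons, List.mem_append]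
  constructor
  · rintro ⟨r, hr, h | ⟨a, ha, h⟩ | ⟨a, ha, h⟩⟩
    · exact ⟨r, hr, r.head, .inl rfl, h⟩
    · exact ⟨r, hr, a, .inr (.inl ha), h⟩
    · exact ⟨r, hr, a, .inr (.inr ha), h⟩
  · rintro ⟨r, hr, a, rfl | ha | ha, h⟩
    · exact ⟨r, hr, .inl h⟩
    · exact ⟨r, hr, .inr (.inl ⟨a, ha, h⟩)⟩
    · exact ⟨r, hr, .inr (.inr ⟨a, ha, h⟩)⟩

theorem finite_of_terms {S : Schema} {C β : Type} (P : CProgram S C) (f : β → Term C)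
    (hf : Function.Injective f) : {c | ∃ r ∈ P, ∃ a ∈ atomsOf r, ∃ i, a.args i = f c}.Finite := by
  have : {c | ∃ r ∈ P, ∃ a ∈ atomsOf r, ∃ i, a.args i = f c} =
      ⋃ r ∈ {r | r ∈ P}, ⋃ a ∈ {a | a ∈ atomsOf r}, ⋃ i, f ⁻¹' {a.args i} := by
    ext c; simp [eq_comm]
  rw [this]
  refine (List.finite_toSet P).biUnion fun r _ => (List.finite_toSet _).biUnion fun a _ =>
    Set.finite_iUnion fun i => (Set.finite_singleton _).preimage hf.injOn

theorem consts_finite {S : Schema} {C : Type} (P : CProgram S C) : (CProgram.consts P).Finite := by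
  refine (finite_of_terms P Term.const fun a b h => by injection h).subset fun c hc => mem_consts.1 hc

theorem exists_var_bound {S : Schema} {C : Type} (P : CProgram S C) :
    ∃ R, ∀ r ∈ P, ∀ a ∈ atomsOf r, ∀ i v, a.args i = .var v → v < R := by
  obtain ⟨R, hR⟩ := (finite_of_terms P Term.var fun a b h => by injection h).bddAbove
  exact ⟨R + 1, fun r hr a ha i v h => Nat.lt_succ_of_le (hR ⟨r, hr, a, ha, i, h⟩)⟩

end DC

namespace DC

/-! ## Choice-free programs cannot count -/

/-- Two tuples with the same equality pattern, the same constants, and otherwise entries in `A`, `A'`. -/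
def TupSim (A A' : Finset ℕ) (C : Set ℕ) {n : ℕ} (u v : Fin n → ℕ) : Prop :=
  (∀ i j, u i = u j ↔ v i = v j) ∧ ∀ i, (u i ∈ C ∧ v i = u i) ∨ (u i ∈ A ∧ v i ∈ A')

theorem TupSim.symm {A A' : Finset ℕ} {C : Set ℕ} {n : ℕ} {u v : Fin n → ℕ} (h : TupSim A A' C u v) :
    TupSim A' A C v u :=
  ⟨fun i j => (h.1 i j).symm, fun i => (h.2 i).imp (fun h => ⟨by rw [h.2]; exact h.1, h.2.symm⟩) And.symm⟩

theorem exists_extension {A A' : Finset ℕ} {C : Set ℕ} (hA : ∀ a ∈ A, a ∉ C) {R n : ℕ}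
    (hA' : R ≤ A'.card) (ν : ℕ → ℕ) {u w : Fin n → ℕ} (huw : TupSim A A' C u w)
    (hu : ∀ i, u i ∈ C ∨ ∃ v < R, u i = ν v) :
    ∃ φ : ℕ → ℕ, (∀ c ∈ C, φ c = c) ∧ (∀ i, φ (u i) = w i) ∧ (∀ v < R, ν v ∈ A → φ (ν v) ∈ A') ∧
      ∀ v < R, ∀ v' < R, ν v ∈ A → ν v' ∈ A → φ (ν v) = φ (ν v') → ν v = ν v' := by
  classical
  let T : Finset ℕ := ((Finset.range R).image ν).filter (· ∈ A)
  have hT : ∀ {x}, x ∈ T ↔ (∃ v < R, ν v = x) ∧ x ∈ A := by intro x; simp [T]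
  let f : T → ℕ := fun x => if h : ∃ i, u i = x then w h.choose else 0
  have hf : ∀ (x : T) i, u i = x → f x = w i := fun x i h => by
    have h' : ∃ i, u i = x := ⟨i, h⟩
    simp only [f, dif_pos h']
    exact (huw.1 _ _).1 (h'.choose_spec.trans h.symm)
  let s : Finset T := Finset.univ.filter fun x => ∃ i, u i = x
  have hs : ∀ {x : T}, x ∈ s ↔ ∃ i, u i = x := by intro x; simp [s]
  have himg : s.image f ⊆ A' := by
    intro y hy
    obtain ⟨x, hx, rfl⟩ := Finset.mem_image.1 hy
    obtain ⟨i, hi⟩ := hs.1 hx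
    rw [hf x i hi]
    rcases huw.2 i with h | h
    · exact absurd (hi ▸ h.1) (hA _ (hT.1 x.2).2)
    · exact h.2
  have hcT : T.card ≤ R := (Finset.card_filter_le _ _).trans (Finset.card_image_le.trans (by simp))
  obtain ⟨t, ht1, ht2, ht3⟩ := Finset.exists_subsuperset_card_eq himg
    (n := T.card) (Finset.card_image_le.trans ((Finset.card_le_univ s).trans (by simp))) (hcT.trans hA')
  obtain ⟨g, hg⟩ := Finset.exists_equiv_extend_of_card_eq (α := T) (by simp [ht3]) ht1 (by
    intro x hx y hy hxy
    obtain ⟨i, hi⟩ := hs.1 hx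
    obtain ⟨j, hj⟩ := hs.1 hy
    rw [hf x i hi, hf y j hj, ← huw.1] at hxy
    exact Subtype.ext (hi.symm.trans (hxy.trans hj)))
  refine ⟨fun x => if h : x ∈ T then g ⟨x, h⟩ else x, fun c hc => ?_, fun i => ?_, fun v hv ha => ?_,
    fun v hv v' hv' ha ha' h => ?_⟩
  · exact dif_neg fun h => hA c (hT.1 h).2 hc
  · simp only
    rcases huw.2 i with h | h
    · rw [dif_neg fun h' => hA _ (hT.1 h').2 h.1, h.2]
    · have hi : u i ∈ T := hT.2 ⟨by
        obtain ⟨v, hv, e⟩ := (hu i).resolve_left (hA _ h.1)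
        exact ⟨v, hv, e.symm⟩, h.1⟩
      rw [dif_pos hi, hg _ (hs.2 ⟨i, rfl⟩), hf _ i rfl]
  · simp only [dif_pos (hT.2 ⟨⟨v, hv, rfl⟩, ha⟩)]
    exact ht2 (g _).2
  · simp only [dif_pos (hT.2 ⟨⟨v, hv, rfl⟩, ha⟩), dif_pos (hT.2 ⟨⟨v', hv', rfl⟩, ha'⟩)] at h
    have := g.injective (Subtype.ext h)
    exact congrArg Subtype.val this

theorem transfer {S : Schema} {P : CProgram S ℕ} (hP : ∀ r ∈ P, r.cgoals = []) {σ : S.pred → ℕ}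
    (hσ : StratifiedBy P σ) {R : ℕ} (hR0 : 0 < R)
    (hR : ∀ r ∈ P, ∀ a ∈ atomsOf r, ∀ i v, a.args i = .var v → v < R)
    {A A' : Finset ℕ} (hA : ∀ a ∈ A, a ∉ CProgram.consts P) (hA' : ∀ a ∈ A', a ∉ CProgram.consts P)
    (hcA' : R ≤ A'.card) {E E' : Set (GAtom S ℕ)}
    (hE : ∀ p u v, TupSim A A' (CProgram.consts P) u v → (⟨p, u⟩ : GAtom S ℕ) ∈ E → ⟨p, v⟩ ∈ E')
    {M M' : Set (FAtom S ℕ)} (hM : IsStableModel (foeD P (A ∪ CProgram.consts P) E) M)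
    (hM' : IsStableModel (foeD P (A' ∪ CProgram.consts P) E') M') {ℓ : ℕ}
    (ih : ∀ p u v, σ p < ℓ → TupSim A A' (CProgram.consts P) u v →
      FAtom.base ⟨p, v⟩ ∈ M' → FAtom.base ⟨p, u⟩ ∈ M) :
    ∀ p u v, σ p ≤ ℓ → TupSim A A' (CProgram.consts P) u v →
      FAtom.base ⟨p, u⟩ ∈ M → FAtom.base ⟨p, v⟩ ∈ M' := by
  set C := CProgram.consts P with hC
  intro p u v hp huv hx
  refine stable_induction hM {x | ∀ p u v, x = FAtom.base ⟨p, u⟩ → σ p ≤ ℓ → TupSim A A' C u v →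
      FAtom.base ⟨p, v⟩ ∈ M'} ?_ hx p u v rfl hp huv
  rw [isStable_iff] at hM'
  rintro _ ((((⟨a, ha, rfl⟩ | ⟨i, ν, hν, hi, rfl⟩) | ⟨i, ν, hν, hi, rfl⟩) | ⟨i, ν, hν, hi, rfl⟩) |
    ⟨i, g, hg, -⟩) hpos hneg hN
  · rintro p u v h hp huv
    simp only [FAtom.base.injEq] at h
    subst h
    exact hM'.1 ⟨.base ⟨p, v⟩, ∅, ∅⟩ (.inl (.inl (.inl (.inl ⟨_, hE p u v huv ha, rfl⟩)))) (by simp) (by simp)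
  · have hmem := List.get_mem P i
    generalize hr : P.get i = r at *
    rintro p u w h hp huw
    simp only [FAtom.base.injEq] at h
    obtain ⟨hd, pos, neg, cg, h1, h2⟩ := r
    obtain ⟨hdp, hda⟩ := hd
    simp only [Atom.ground] at h
    obtain ⟨rfl, h⟩ := GAtom.mk.inj h
    obtain rfl := eq_of_heq h
    clear h
    have hconst : ∀ a ∈ atomsOf (⟨⟨hdp, hda⟩, pos, neg, cg, h1, h2⟩ : CRule S ℕ), ∀ j c, a.args j = .const c → c ∈ C :=
      fun a ha j c hc => mem_consts.2 ⟨_, hmem, a, ha, j, hc⟩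
    obtain ⟨φ, f1, f2, f3, f4⟩ := exists_extension hA hcA' ν huw (fun j => by
      cases e : hda j with
      | var v => exact .inr ⟨v, hR _ hmem ⟨hdp, hda⟩ (by simp [atomsOf]) j v e, rfl⟩
      | const c => exact .inl (hconst ⟨hdp, hda⟩ (by simp [atomsOf]) j c e))
    have hφ : ∀ v < R, φ (ν v) ∈ (A' : Set ℕ) ∪ C := fun v hv => by
      rcases hν v with h | h
      · exact .inl (f3 v hv h)
      · exact .inr (by rw [f1 _ h]; exact h)
    let ν' : ℕ → ℕ := fun v => if v < R then φ (ν v) else φ (ν 0)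
    have hν' : ∀ v, ν' v ∈ (A' : Set ℕ) ∪ C := fun v => by
      simp only [ν']; split_ifs with h
      · exact hφ v h
      · exact hφ 0 hR0
    have hev : ∀ a ∈ atomsOf (⟨⟨hdp, hda⟩, pos, neg, cg, h1, h2⟩ : CRule S ℕ), ∀ j,
        (a.args j).eval ν' = φ ((a.args j).eval ν) := fun a ha j => by
      cases e : a.args j with
      | var v =>
        have := hR _ hmem a ha j v e
        simp [Term.eval, ν', this]
      | const c => exact (f1 c (hconst a ha j c e)).symm
    have hval : ∀ a ∈ atomsOf (⟨⟨hdp, hda⟩, pos, neg, cg, h1, h2⟩ : CRule S ℕ), ∀ j,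
        (a.args j).eval ν ∈ C ∨ ∃ v < R, (a.args j).eval ν = ν v ∧ ν v ∈ A := fun a ha j => by
      cases e : a.args j with
      | var v =>
        rcases hν v with h | h
        · exact .inr ⟨v, hR _ hmem a ha j v e, rfl, h⟩
        · exact .inl h
      | const c => exact .inl (hconst a ha j c e)
    have hsim : ∀ a ∈ atomsOf (⟨⟨hdp, hda⟩, pos, neg, cg, h1, h2⟩ : CRule S ℕ),
        TupSim A A' C (a.ground ν).args (a.ground ν').args := by
      intro a ha
      refine ⟨fun (j j' : Fin (S.ar a.p)) => ?_, fun (j : Fin (S.ar a.p)) => ?_⟩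
      · change (a.args j).eval ν = (a.args j').eval ν ↔ (a.args j).eval ν' = (a.args j').eval ν'
        rw [hev a ha, hev a ha]
        refine ⟨fun h => congrArg φ h, fun h => ?_⟩
        rcases hval a ha j with h1 | ⟨v, hv, h1, h1'⟩ <;> rcases hval a ha j' with h2 | ⟨v', hv', h2, h2'⟩
        · rwa [f1 _ h1, f1 _ h2] at h
        · rw [f1 _ h1, h2] at h
          exact absurd h1 (hA' _ (h ▸ f3 v' hv' h2'))
        · rw [f1 _ h2, h1] at h
          exact absurd h2 (hA' _ (h ▸ f3 v hv h1'))
        · rw [h1, h2] at h ⊢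
          exact f4 v hv v' hv' h1' h2' h
      · change ((a.args j).eval ν ∈ C ∧ (a.args j).eval ν' = (a.args j).eval ν) ∨ ((a.args j).eval ν ∈ A ∧ (a.args j).eval ν' ∈ A')
        rw [hev a ha]
        rcases hval a ha j with h | ⟨v, hv, h, h'⟩
        · exact .inl ⟨h, f1 _ h⟩
        · rw [h]; exact .inr ⟨h', f3 v hv h'⟩
    have hhead : (⟨hdp, w⟩ : GAtom S ℕ) = Atom.ground ⟨hdp, hda⟩ ν' := by
      simp only [Atom.ground]
      congr 1
      funext j
      rw [← f2 j]
      exact (hev ⟨hdp, hda⟩ (by simp [atomsOf]) j).symm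
    rw [hhead]
    have hst := hσ _ hmem
    refine hM'.1 ⟨.base (Atom.ground ⟨hdp, hda⟩ ν'), posBody (P.get i) ν', negBody (P.get i) ν'⟩
      (.inl (.inl (.inl (.inr ⟨i, ν', hν', by rw [hr]; exact hi, by rw [hr]⟩)))) ?_ ?_
    · rw [hr]
      rintro _ ⟨a, ha, rfl⟩
      exact hN (show FAtom.base (a.ground ν) ∈ _ from ⟨a, ha, rfl⟩) a.p _ _ rfl ((hst.1 a ha).trans hp)
        (hsim a (by simp [atomsOf]; exact .inr (.inl ha)))
    · rw [hr]
      rintro _ ⟨a, ha, rfl⟩ hcon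
      refine hneg (FAtom.base (a.ground ν)) ⟨a, ha, rfl⟩ ?_
      exact ih a.p _ _ ((hst.2 a ha).trans_le hp) (hsim a (by simp [atomsOf]; exact .inr (.inr ha))) hcon
  · exact absurd (hP _ (List.get_mem P i)) hi
  · exact absurd (hP _ (List.get_mem P i)) hi
  · rw [hP _ (List.get_mem P i)] at hg
    simp at hg

/-- The parity query on a unary relation. -/
def parityQuery : Query 1 (fun _ => 1) 0 := fun db => {_t | Odd db.ncard}

theorem generic_parityQuery : Generic parityQuery := by
  intro π db
  have h : renameDB π db = (fun b : GAtom (inSchema 1 fun _ => 1) ℕ =>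
      (⟨b.p, fun i => π (b.args i)⟩ : GAtom (inSchema 1 fun _ => 1) ℕ)) '' db := by
    ext a; simp [renameDB, eq_comm]
  have hc : (renameDB π db).ncard = db.ncard := by
    rw [h]
    refine Set.ncard_image_of_injective _ fun a b hab => ?_
    obtain ⟨p, u⟩ := a
    obtain ⟨q, v⟩ := b
    obtain ⟨rfl, h2⟩ := GAtom.mk.inj hab
    congr 1
    funext i
    exact π.injective (congrFun (eq_of_heq h2) i)
  ext t
  simp only [parityQuery, hc, Set.mem_ofPred_eq]
  exact ⟨fun h => ⟨t, h, funext fun i => i.elim0⟩, fun ⟨_, h, _⟩ => h⟩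

/-- Collect the distinct elements of a list and the parity of their number. -/
def parityStep (s : List (List ℕ) × Bool) (x : List ℕ) : List (List ℕ) × Bool :=
  bif decide (x ∈ s.1) then s else (x :: s.1, !s.2)

theorem parityStep_foldl (l : List (List ℕ)) : ∀ s : List (List ℕ) × Bool, s.1.Nodup → s.2 = decide (Odd s.1.length) →
    (l.foldl parityStep s).1.Nodup ∧ (l.foldl parityStep s).2 = decide (Odd (l.foldl parityStep s).1.length) ∧
      ∀ x, x ∈ (l.foldl parityStep s).1 ↔ x ∈ s.1 ∨ x ∈ l := by
  induction l with
  | nil => intro s h1 h2; exact ⟨h1, h2, by simp⟩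
  | cons a l ih =>
    intro s h1 h2
    rw [List.foldl_cons]
    by_cases ha : a ∈ s.1
    · have e : parityStep s a = s := by simp [parityStep, ha]
      rw [e]
      obtain ⟨g1, g2, g3⟩ := ih s h1 h2
      refine ⟨g1, g2, fun x => ?_⟩
      rw [g3, List.mem_cons]
      constructor
      · tauto
      · rintro (h | rfl | h) <;> tauto
    · have e : parityStep s a = (a :: s.1, !s.2) := by simp [parityStep, ha]
      rw [e]
      obtain ⟨g1, g2, g3⟩ := ih (a :: s.1, !s.2) (List.nodup_cons.2 ⟨ha, h1⟩) (by
        simp [h2, Nat.odd_add_one, -Nat.not_odd_iff_even])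
      refine ⟨g1, g2, fun x => ?_⟩
      rw [g3, List.mem_cons, List.mem_cons]
      tauto

theorem factList_injective {m : ℕ} {ar : Fin m → ℕ} : Function.Injective (factList (m := m) (ar := ar)) := by
  rintro ⟨p, u⟩ ⟨q, v⟩ h
  simp only [factList, List.cons.injEq] at h
  obtain ⟨h1, h2⟩ := h
  obtain rfl : p = q := Fin.ext h1
  congr 1
  exact List.ofFn_injective h2

theorem dbPTime_parityQuery : DBPTime parityQuery := by
  rw [dbPTime_iff]
  have hst : PT fun q : List (List ℕ) × (List (List ℕ) × Bool) × List ℕ => parityStep q.2.1 q.2.2 := by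
    have h1 : PT fun q : List (List ℕ) × (List (List ℕ) × Bool) × List ℕ => decide (q.2.2 ∈ q.2.1.1) :=
      PT.elem (f := fun q : List (List ℕ) × (List (List ℕ) × Bool) × List ℕ => q.2.2) (l := fun q => q.2.1.1)
        (by fun_prop) (by fun_prop)
    have h2 : PT fun q : List (List ℕ) × (List (List ℕ) × Bool) × List ℕ => (q.2.2 :: q.2.1.1, !q.2.1.2) := by
      fun_prop
    exact (PT.cond h1 (f := fun q => q.2.1) (by fun_prop) h2).congr fun q => rfl
  have hf : PT fun l : List (List ℕ) => l.foldl parityStep ([], false) := by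
    refine PT.foldl (l := fun l : List (List ℕ) => l) (s := fun _ => (([], false) : List (List ℕ) × Bool))
      (g := fun _ => parityStep) hst (by fun_prop) (by fun_prop) ⟨.X + 4, fun a s x _ => ?_⟩
    have h3 := sz_bool (!s.2)
    have h1 := sz_pos s.2
    simp only [parityStep, sz_pair, Polynomial.eval_add, Polynomial.eval_X, Polynomial.eval_ofNat]
    by_cases h : x ∈ s.1
    · simp [h]
    · simp [h]; omega
  refine ⟨fun l => bif (l.foldl parityStep ([], false)).2 then [[]] else [], PT.cond hf.snd (by fun_prop) (by fun_prop),
    fun dbl => ?_⟩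
  obtain ⟨h1, h2, h3⟩ := parityStep_foldl (dbl.map factList) ([], false) (by simp) (by simp)
  set r := (dbl.map factList).foldl parityStep ([], false) with hr
  have hc : {a | a ∈ dbl}.ncard = r.1.length := by
    rw [← Set.ncard_image_of_injective _ factList_injective, ← List.toFinset_card_of_nodup h1, ← Set.ncard_coe_finset]
    congr 1
    ext x
    simp [h3]
  by_cases ho : Odd r.1.length
  · refine ⟨[fun i => i.elim0], ?_, fun t => ?_⟩
    · simp [← hr, h2, ho]
    · have : t = fun i => i.elim0 := funext fun i => i.elim0
      simp [parityQuery, hc, ho, this]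
  · refine ⟨[], ?_, fun t => ?_⟩
    · simp [← hr, h2, ho]
    · simp [parityQuery, hc, ho]

theorem not_expressible_parityQuery : ¬ ExpressibleNoChoice parityQuery := by
  rintro ⟨n, arAux, P, σ, ans, hk, hP, hhead, hσ, h⟩
  obtain ⟨R, hR⟩ := exists_var_bound P
  obtain ⟨B, hB⟩ := (consts_finite P).bddAbove
  obtain ⟨A, hAC, hcard⟩ : ∃ A : ℕ → Finset ℕ, (∀ K, ∀ a ∈ A K, a ∉ CProgram.consts P) ∧ ∀ K, (A K).card = K := by
    refine ⟨fun K => Finset.Ioc B (B + K), fun K a ha hc => ?_, fun K => by simp⟩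
    have := hB hc
    simp only [Finset.mem_Ioc] at ha
    omega
  let db : ℕ → Set (GAtom (inSchema 1 fun _ => 1) ℕ) := fun K => (fun x => ⟨(0 : Fin 1), fun _ => x⟩) '' (A K : Set ℕ)
  have hinj : Function.Injective fun x : ℕ => (⟨(0 : Fin 1), fun _ => x⟩ : GAtom (inSchema 1 fun _ => 1) ℕ) := fun x y hxy =>
    congrFun (eq_of_heq (GAtom.mk.inj hxy).2) (0 : Fin 1)
  have hdbc : ∀ K, (db K).ncard = K := fun K => by
    rw [Set.ncard_image_of_injective _ hinj, Set.ncard_coe_finset, hcard]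
  have hfin : ∀ K, (db K).Finite := fun K => (A K).finite_toSet.image _
  let E : ℕ → Set (GAtom ⟨Fin 1 ⊕ Fin n, Sum.elim (fun _ => 1) arAux⟩ ℕ) := fun K => {b | ∃ a ∈ db K, b = embDB (arAux := arAux) a}
  have hE : ∀ K b, b ∈ E K ↔ ∃ x ∈ A K, b = ⟨Sum.inl 0, fun _ => x⟩ := fun K b => by
    constructor
    · rintro ⟨_, ⟨x, hx, rfl⟩, rfl⟩; exact ⟨x, hx, rfl⟩
    · rintro ⟨x, hx, rfl⟩; exact ⟨_, ⟨x, hx, rfl⟩, rfl⟩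
  have hdom : ∀ K, gdom P (E K) = (A K : Set ℕ) ∪ CProgram.consts P := fun K => by
    unfold gdom
    refine congrArg (· ∪ CProgram.consts P) ?_
    ext c
    constructor
    · rintro ⟨b, hb, i, rfl⟩
      obtain ⟨x, hx, rfl⟩ := (hE K b).1 hb
      exact hx
    · intro hc
      exact ⟨_, (hE K _).2 ⟨c, hc, rfl⟩, (0 : Fin 1), rfl⟩
  have hEE : ∀ K K' p u v, TupSim (A K) (A K') (CProgram.consts P) u v →
      (⟨p, u⟩ : GAtom ⟨Fin 1 ⊕ Fin n, Sum.elim (fun _ => 1) arAux⟩ ℕ) ∈ E K → ⟨p, v⟩ ∈ E K' := by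
    intro K K' p u v huv hu
    obtain ⟨x, hx, e⟩ := (hE _ _).1 hu
    obtain ⟨rfl, h2⟩ := GAtom.mk.inj e
    obtain rfl := eq_of_heq h2
    refine (hE _ _).2 ⟨v (0 : Fin 1), ?_, ?_⟩
    · exact ((huv.2 (0 : Fin 1)).resolve_left fun h => hAC K _ hx h.1).2
    · congr 1
      funext i
      exact congrArg v (Subsingleton.elim (α := Fin 1) _ _)
  obtain ⟨⟨M, hM⟩, hMQ⟩ := h (db (R + 1)) (hfin _)
  obtain ⟨⟨M', hM'⟩, hMQ'⟩ := h (db (R + 2)) (hfin _)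
  have e1 := hMQ M hM (fun i => i.elim0)
  have e2 := hMQ' M' hM' (fun i => i.elim0)
  change IsStableModel (foeD P (gdom P (E _)) (E _)) _ at hM hM'
  rw [hdom] at hM hM'
  have hR' : ∀ r ∈ P, ∀ a ∈ atomsOf r, ∀ i v, a.args i = .var v → v < R + 1 := fun r hr a ha i v e =>
    (hR r hr a ha i v e).trans (Nat.lt_succ_self R)
  clear h
  clear_value E
  have key : ∀ ℓ p u v, σ p ≤ ℓ → TupSim (A (R + 1)) (A (R + 2)) (CProgram.consts P) u v →
      (FAtom.base ⟨p, u⟩ ∈ M ↔ FAtom.base ⟨p, v⟩ ∈ M') := by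
    intro ℓ
    induction ℓ using Nat.strong_induction_on with
    | _ ℓ ih =>
      intro p u v hp huv
      constructor
      · refine transfer hP hσ (Nat.succ_pos R) hR' (hAC _) (hAC _) (by rw [hcard]; omega) (hEE _ _) hM hM'
          (fun p u v hl h => (ih (σ p) hl p u v le_rfl h).2) p u v hp huv
      · refine transfer hP hσ (Nat.succ_pos R) hR' (hAC _) (hAC _) (by rw [hcard]) (hEE _ _) hM' hM
          (fun p u v hl h => (ih (σ p) hl p v u le_rfl h.symm).1) p v u hp huv.symm
  have e3 := key _ (Sum.inr ans) (fun i => (Fin.cast hk i).elim0) (fun i => (Fin.cast hk i).elim0) le_rfl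
    ⟨fun i => (Fin.cast hk i).elim0, fun i => (Fin.cast hk i).elim0⟩
  have e4 : Odd (R + 1) ↔ Odd (R + 2) := by
    have q1 : ((fun i => i.elim0 : Fin 0 → ℕ) ∈ parityQuery (db (R + 1))) ↔ Odd (R + 1) := by
      simp only [parityQuery, hdbc, Set.mem_ofPred_eq]
    have q2 : ((fun i => i.elim0 : Fin 0 → ℕ) ∈ parityQuery (db (R + 2))) ↔ Odd (R + 2) := by
      simp only [parityQuery, hdbc, Set.mem_ofPred_eq]
    exact q1.symm.trans (e1.symm.trans (e3.trans (e2.trans q2)))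
  have := Nat.odd_add_one (n := R + 1)
  tauto

end DC

namespace DC

/-! ## Greedy evaluation of stratified choice programs -/

section Greedy

variable {S : Schema}

/-- A ground atom as a list of numbers, the predicate being coded by `c`. -/
def codeAtom (c : S.pred → ℕ) (a : GAtom S ℕ) : List ℕ := c a.p :: List.ofFn a.args

/-- The valuation given by a list of values. -/
def val (env : List ℕ) (v : ℕ) : ℕ := env.getD v 0

/-- The groundings of a rule by `e` and `e'` violate one of its choice goals. -/
def conf (r : CRule S ℕ) (e e' : List ℕ) : Bool :=
  r.cgoals.any fun g => g.1.all (fun v => decide (val e v = val e' v)) &&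
    g.2.any fun v => !decide (val e v = val e' v)

/-- The instance of rule `r` (number `i`) by `env` is applicable in the state `T`, in which
`(K + i) :: e` records that the instance by `e` has been applied. -/
def enabled (c : S.pred → ℕ) (K : ℕ) (r : CRule S ℕ) (i : ℕ) (env : List ℕ) (T : List (List ℕ)) : Bool :=
  (r.pos.all fun a => decide (codeAtom c (a.ground (val env)) ∈ T)) &&
  ((r.neg.all fun a => !decide (codeAtom c (a.ground (val env)) ∈ T)) &&
  !(T.any fun e => decide (e = (K + i) :: e.tail) && conf r env e.tail))

def fire (c : S.pred → ℕ) (K : ℕ) (r : CRule S ℕ) (i : ℕ) (env : List ℕ) (T : List (List ℕ)) : List (List ℕ) :=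
  bif enabled c K r i env T && !decide ((K + i) :: env ∈ T) then
    codeAtom c (r.head.ground (val env)) :: ((K + i) :: env) :: T else T

/-- Try all rules of stratum `l` on one valuation. -/
def fireAll (c : S.pred → ℕ) (K : ℕ) (P : CProgram S ℕ) (σ : S.pred → ℕ) (l : ℕ) (T : List (List ℕ))
    (env : List ℕ) : List (List ℕ) :=
  (List.finRange P.length).foldl
    (fun T i => bif decide (σ (P.get i).head.p = l) then fire c K (P.get i) i env T else T) T

/-- Evaluate the first `l` strata, each with the list `L` of valuations. -/
def evalStrata (c : S.pred → ℕ) (K : ℕ) (P : CProgram S ℕ) (σ : S.pred → ℕ) (L : List (List ℕ)) :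
    ℕ → List (List ℕ) → List (List ℕ)
  | 0, T => T
  | l + 1, T => L.foldl (fireAll c K P σ l) (evalStrata c K P σ L l T)

/-- All valuations of `R` variables in `D`. -/
def envs (D : List ℕ) : ℕ → List (List ℕ)
  | 0 => [[]]
  | R + 1 => D.flatMap fun d => (envs D R).map (List.cons d)

/-- The valuations `envs D R`, repeated often enough to reach a fixpoint. -/
def schedule (D : List ℕ) (R q : ℕ) : List (List ℕ) :=
  ((List.range q).flatMap fun _ => envs D R).flatMap fun _ => envs D R

variable {c : S.pred → ℕ} {K : ℕ} {P : CProgram S ℕ} {σ : S.pred → ℕ}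

theorem mem_envs {D : List ℕ} {R : ℕ} {e : List ℕ} : e ∈ envs D R ↔ e.length = R ∧ ∀ x ∈ e, x ∈ D := by
  induction R generalizing e with
  | zero => simp [envs]; rintro rfl; simp
  | succ R ih =>
    simp only [envs, List.mem_flatMap, List.mem_map]
    constructor
    · rintro ⟨d, hd, e, he, rfl⟩
      simp [ih.1 he, hd]
      exact (ih.1 he).2
    · rintro ⟨h1, h2⟩
      cases e with
      | nil => simp at h1
      | cons d e => exact ⟨d, h2 d (by simp), e, ih.2 ⟨by simpa using h1, fun x hx => h2 x (by simp [hx])⟩, rfl⟩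

theorem conf_iff {r : CRule S ℕ} {e e' : List ℕ} : conf r e e' = true ↔
    ∃ g ∈ r.cgoals, (∀ v ∈ g.1, val e v = val e' v) ∧ ∃ v ∈ g.2, val e v ≠ val e' v := by
  simp [conf]

theorem conf_symm {r : CRule S ℕ} {e e' : List ℕ} (h : conf r e e' = true) : conf r e' e = true := by
  rw [conf_iff] at h ⊢
  obtain ⟨g, hg, h1, v, hv, h2⟩ := h
  exact ⟨g, hg, fun v hv => (h1 v hv).symm, v, hv, h2.symm⟩

theorem conf_irrefl {r : CRule S ℕ} {e : List ℕ} : conf r e e = false := by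
  rw [Bool.eq_false_iff]; intro h
  rw [conf_iff] at h
  obtain ⟨g, hg, h1, v, hv, h2⟩ := h
  exact h2 rfl

theorem enabled_iff {r : CRule S ℕ} {i : ℕ} {env : List ℕ} {T : List (List ℕ)} :
    enabled c K r i env T = true ↔ (∀ a ∈ r.pos, codeAtom c (a.ground (val env)) ∈ T) ∧
      (∀ a ∈ r.neg, codeAtom c (a.ground (val env)) ∉ T) ∧
      ∀ e, (K + i) :: e ∈ T → conf r env e = false := by
  simp only [enabled, Bool.and_eq_true, List.all_eq_true, decide_eq_true_eq, Bool.not_eq_true',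
    decide_eq_false_iff_not, List.any_eq_false, not_and, Bool.not_eq_true]
  refine and_congr_right fun _ => and_congr_right fun _ => ⟨fun h e he => h _ he rfl, fun h e he h1 => ?_⟩
  rw [h1] at he ⊢
  exact h _ he

theorem fire_cases (r : CRule S ℕ) (i : ℕ) (env : List ℕ) (T : List (List ℕ)) :
    (fire c K r i env T = T ∧ (enabled c K r i env T = true → (K + i) :: env ∈ T)) ∨
    (fire c K r i env T = codeAtom c (r.head.ground (val env)) :: ((K + i) :: env) :: T ∧
      enabled c K r i env T = true ∧ (K + i) :: env ∉ T) := by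
  unfold fire
  cases h : enabled c K r i env T <;> by_cases h' : (K + i) :: env ∈ T <;> simp [h']

/-- Invariants of the evaluation. -/
theorem fireAll_induct {l : ℕ} {env : List ℕ} (Inv : List (List ℕ) → Prop)
    (h : ∀ (i : Fin P.length) T, σ (P.get i).head.p = l → Inv T → Inv (fire c K (P.get i) i env T)) {T : List (List ℕ)}
    (hT : Inv T) : Inv (fireAll c K P σ l T env) := by
  unfold fireAll
  generalize List.finRange P.length = F
  induction F generalizing T with
  | nil => exact hT
  | cons i F ih =>
    rw [List.foldl_cons]
    refine ih ?_
    by_cases hl : σ (P.get i).head.p = l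
    · rw [decide_eq_true hl]; exact h i T hl hT
    · rw [decide_eq_false hl]; exact hT

theorem foldl_induct {l : ℕ} {L : List (List ℕ)} (Inv : List (List ℕ) → Prop)
    (h : ∀ (i : Fin P.length) T, ∀ env ∈ L, σ (P.get i).head.p = l → Inv T → Inv (fire c K (P.get i) i env T))
    {T : List (List ℕ)} (hT : Inv T) : Inv (L.foldl (fireAll c K P σ l) T) := by
  induction L generalizing T with
  | nil => exact hT
  | cons e L ih =>
    exact ih (fun i T env he => h i T env (by simp [he])) (fireAll_induct Inv (fun i T => h i T e (by simp)) hT)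

theorem suffix_fire (r : CRule S ℕ) (i : ℕ) (env : List ℕ) (T : List (List ℕ)) : T <:+ fire c K r i env T := by
  rcases fire_cases (c := c) (K := K) r i env T with h | h
  · rw [h.1]
  · rw [h.1]; exact ⟨[_, _], rfl⟩

theorem suffix_fireAll {l : ℕ} (T : List (List ℕ)) (env : List ℕ) : T <:+ fireAll c K P σ l T env :=
  fireAll_induct (T <:+ ·) (fun _ _ _ h => h.trans (suffix_fire _ _ _ _)) (List.suffix_refl T)

theorem suffix_foldl {l : ℕ} (L T : List (List ℕ)) : T <:+ L.foldl (fireAll c K P σ l) T :=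
  foldl_induct (T <:+ ·) (fun _ _ _ _ _ h => h.trans (suffix_fire _ _ _ _)) (List.suffix_refl T)

theorem foldl_fixed {α β : Type} {f : List α → β → List α} (hf : ∀ T b, T <:+ f T b) {L : List β} {T : List α}
    (h : L.foldl f T = T) : ∀ b ∈ L, f T b = T := by
  have hs : ∀ (L : List β) T, T <:+ L.foldl f T := fun L => by
    induction L with
    | nil => intro T; exact List.suffix_refl T
    | cons b L ih => exact fun T => (hf T b).trans (ih _)
  induction L with
  | nil => simp
  | cons b L ih =>
    rw [List.foldl_cons] at h
    have h1 : f T b = T := by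
      have h2 := (hf T b).length_le
      have h3 := (hs L (f T b)).length_le
      rw [h] at h3
      exact ((hf T b).eq_of_length (by omega)).symm
    rw [h1] at h
    intro b' hb'
    rcases List.mem_cons.1 hb' with rfl | hb'
    · exact h1
    · exact ih h b' hb'

theorem iterate_fixed {α : Type} (f : α → α) (μ : α → ℕ) (B : ℕ) (hB : ∀ a, μ a ≤ B)
    (hf : ∀ a, f a ≠ a → μ a < μ (f a)) (a : α) {n : ℕ} (hn : B < n + 1) : f (f^[n] a) = f^[n] a := by
  by_contra hne
  have key : ∀ j ≤ n + 1, j ≤ μ (f^[j] a) := by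
    intro j
    induction j with
    | zero => intro _; exact Nat.zero_le _
    | succ j ih =>
      intro hj
      have h1 : f (f^[j] a) ≠ f^[j] a := by
        intro h
        refine hne ?_
        have : ∀ d, f^[j + d] a = f^[j] a := by
          intro d
          induction d with
          | zero => rfl
          | succ d ihd => rw [← add_assoc, Function.iterate_succ_apply', ihd, h]
        obtain ⟨d, rfl⟩ := Nat.exists_eq_add_of_le (Nat.le_of_succ_le_succ hj)
        rw [this, h]
      have := hf _ h1
      rw [Function.iterate_succ_apply']
      have := ih (by omega)
      omega
  have := key (n + 1) le_rfl
  have := hB (f^[n + 1] a)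
  omega

theorem foldl_flatMap_const {α β γ : Type} (f : α → β → α) (E : List β) (C : List γ) (a : α) :
    (C.flatMap fun _ => E).foldl f a = (fun a => E.foldl f a)^[C.length] a := by
  induction C generalizing a with
  | nil => rfl
  | cons c C ih => rw [List.flatMap_cons, List.foldl_append, ih, List.length_cons, Function.iterate_succ_apply]

theorem fireAll_fixed {l : ℕ} {T : List (List ℕ)} {env : List ℕ} (h : fireAll c K P σ l T env = T) (i : Fin P.length)
    (hi : σ (P.get i).head.p = l) : fire c K (P.get i) i env T = T := by
  have := foldl_fixed (f := fun T (i : Fin P.length) =>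
    bif decide (σ (P.get i).head.p = l) then fire c K (P.get i) i env T else T) (fun T i => by
      by_cases hl : σ (P.get i).head.p = l
      · rw [decide_eq_true hl]; exact suffix_fire _ _ _ _
      · rw [decide_eq_false hl]; exact List.suffix_refl T) h i (List.mem_finRange i)
  rwa [decide_eq_true hi] at this

open Classical in
theorem schedule_fixed {l : ℕ} (D : List ℕ) (R : ℕ) (T : List (List ℕ)) (i : Fin P.length) {env : List ℕ}
    (henv : env ∈ envs D R) (hi : σ (P.get i).head.p = l) :
    fire c K (P.get i) i env ((schedule D R P.length).foldl (fireAll c K P σ l) T) =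
      (schedule D R P.length).foldl (fireAll c K P σ l) T := by
  set T' := (schedule D R P.length).foldl (fireAll c K P σ l) T with hT'
  suffices h : (envs D R).foldl (fireAll c K P σ l) T' = T' from
    fireAll_fixed (foldl_fixed (fun T b => suffix_fireAll T b) h env henv) i hi
  let I : Finset (Fin P.length × List ℕ) := Finset.univ ×ˢ (envs D R).toFinset
  have hcard : I.card ≤ ((List.range P.length).flatMap fun _ => envs D R).length := by
    have : ∀ C : List ℕ, (C.flatMap fun _ => envs D R).length = C.length * (envs D R).length := fun C => by
      induction C with
      | nil => simp
      | cons c C ih => rw [List.flatMap_cons, List.length_append, ih, List.length_cons]; ring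
    rw [this, Finset.card_product, List.length_range, Finset.card_univ, Fintype.card_fin]
    exact Nat.mul_le_mul_left _ (List.toFinset_card_le _)
  rw [schedule, foldl_flatMap_const] at hT'
  rw [hT']
  refine iterate_fixed (fun a => (envs D R).foldl (fireAll c K P σ l) a)
    (fun T => (I.filter fun x => (K + x.1) :: x.2 ∈ T).card) I.card (fun T => Finset.card_filter_le _ _) ?_ T
    (Nat.lt_succ_of_le hcard)
  intro T hne
  by_contra hlt
  refine hne ?_
  have hsub : ∀ T₁ T₂ : List (List ℕ), T₁ <:+ T₂ → (I.filter fun x => (K + x.1) :: x.2 ∈ T₁) ⊆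
      I.filter fun x => (K + x.1) :: x.2 ∈ T₂ := fun T₁ T₂ h x hx => by
    rw [Finset.mem_filter] at hx ⊢
    exact ⟨hx.1, h.subset hx.2⟩
  have heq := Finset.eq_of_subset_of_card_le (hsub _ _ (suffix_foldl (c := c) (K := K) (P := P) (σ := σ) (l := l) (envs D R) T)) (not_lt.1 hlt)
  have hmarks : ∀ (i : Fin P.length), ∀ e ∈ envs D R, (K + i) :: e ∈ (envs D R).foldl (fireAll c K P σ l) T →
      (K + i) :: e ∈ T := fun i e he h => by
    have : (i, e) ∈ I.filter fun x => (K + x.1) :: x.2 ∈ T := by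
      rw [heq]; simp [I, he, h]
    exact (Finset.mem_filter.1 this).2
  clear heq hne hlt hT'
  generalize hU : (envs D R).foldl (fireAll c K P σ l) T = U at hmarks
  have main : ∀ L : List (List ℕ), (∀ e ∈ L, e ∈ envs D R) → L.foldl (fireAll c K P σ l) T <:+ U →
      L.foldl (fireAll c K P σ l) T = T := by
    intro L
    induction L using List.reverseRecOn with
    | nil => intros; rfl
    | append_singleton L e ih =>
      intro hL hs
      rw [List.foldl_append, List.foldl_cons, List.foldl_nil] at hs ⊢
      have h0 := ih (fun e he => hL e (by simp [he])) ((suffix_fireAll _ e).trans hs)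
      rw [h0] at hs ⊢
      unfold fireAll at hs ⊢
      generalize List.finRange P.length = F at hs ⊢
      induction F using List.reverseRecOn with
      | nil => rfl
      | append_singleton F i ihF =>
        rw [List.foldl_append, List.foldl_cons, List.foldl_nil] at hs ⊢
        by_cases hl : σ (P.get i).head.p = l
        · rw [decide_eq_true hl, cond_true] at hs ⊢
          have h1 := ihF ((suffix_fire _ _ _ _).trans hs)
          rw [h1] at hs ⊢
          rcases fire_cases (c := c) (K := K) (P.get i) i e T with h | h
          · exact h.1
          · refine absurd (hmarks i e (hL e (by simp)) (hs.subset ?_)) h.2.2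
            rw [h.1]; simp
        · rw [decide_eq_false hl, cond_false] at hs ⊢
          exact ihF hs
  rw [← hU]
  exact main _ (fun _ h => h) (hU ▸ List.suffix_refl _)

end Greedy

end DC

namespace DC

section GreedyStable

variable {S : Schema} {c : S.pred → ℕ} {K : ℕ} {P : CProgram S ℕ} {σ : S.pred → ℕ}

theorem codeAtom_injective (hc : Function.Injective c) : Function.Injective (codeAtom (S := S) c) := by
  rintro ⟨p, x⟩ ⟨p', y⟩ h
  simp only [codeAtom, List.cons.injEq] at h
  obtain rfl := hc h.1
  rw [List.ofFn_injective h.2]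

theorem codeAtom_ne (hK : ∀ p, c p < K) (a : GAtom S ℕ) (i : ℕ) (e : List ℕ) : codeAtom c a ≠ (K + i) :: e := by
  intro h
  simp only [codeAtom, List.cons.injEq] at h
  have := hK a.p
  omega

theorem ground_congr {C : Type} {a : Atom S C} {ν ν' : ℕ → C} (h : ∀ i v, a.args i = .var v → ν v = ν' v) :
    a.ground ν = a.ground ν' := by
  unfold Atom.ground
  congr 1
  funext i
  cases hi : a.args i with
  | var v => exact h i v hi
  | const c => rfl

theorem mem_W {C : Type} {r : CRule S C} {v : ℕ} : v ∈ r.W ↔ ∃ g ∈ r.cgoals, v ∈ g.1 ∨ v ∈ g.2 := by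
  simp [CRule.W, List.mem_dedup]

theorem val_range {R : ℕ} (ν : ℕ → ℕ) {v : ℕ} (hv : v < R) : val ((List.range R).map ν) v = ν v := by
  simp [val, hv]

theorem exists_valuation {D : List ℕ} {R : ℕ} (hR : 0 < R) {e : List ℕ} (he : e ∈ envs D R) :
    ∃ ν : ℕ → ℕ, (∀ v, ν v ∈ D) ∧ ∀ v < R, ν v = val e v := by
  rw [mem_envs] at he
  have hm : ∀ v < R, val e v ∈ D := fun v hv => by
    rw [val, List.getD_eq_getElem _ _ (by omega)]
    exact he.2 _ (List.getElem_mem _)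
  refine ⟨fun v => if v < R then val e v else val e 0, fun v => ?_, fun v hv => if_pos hv⟩
  beta_reduce
  split_ifs with h
  · exact hm v h
  · exact hm 0 hR

theorem mem_foldl_fireAll {l : ℕ} {L T : List (List ℕ)} {x : List ℕ} (hx : x ∈ L.foldl (fireAll c K P σ l) T) :
    x ∈ T ∨ ∃ (i : Fin P.length) (e : List ℕ), σ (P.get i).head.p = l ∧
      (x = codeAtom c ((P.get i).head.ground (val e)) ∨ x = (K + i) :: e) := by
  refine foldl_induct (c := c) (K := K) (P := P) (σ := σ) (l := l) (L := L) (fun T' => ∀ x ∈ T', x ∈ T ∨ ∃ (i : Fin P.length) (e : List ℕ),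
    σ (P.get i).head.p = l ∧ (x = codeAtom c ((P.get i).head.ground (val e)) ∨ x = (K + i) :: e)) ?_
    (fun x hx => .inl hx) x hx
  intro i T' e _ hi h x hx
  rcases fire_cases (c := c) (K := K) (P.get i) i e T' with h' | h'
  · rw [h'.1] at hx; exact h x hx
  · rw [h'.1] at hx
    rcases List.mem_cons.1 hx with rfl | hx
    · exact .inr ⟨i, e, hi, .inl rfl⟩
    · rcases List.mem_cons.1 hx with rfl | hx
      · exact .inr ⟨i, e, hi, .inr rfl⟩
      · exact h x hx

theorem evalStrata_suffix {L T : List (List ℕ)} {l l' : ℕ} (h : l ≤ l') :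
    evalStrata c K P σ L l T <:+ evalStrata c K P σ L l' T := by
  induction l', h using Nat.le_induction with
  | base => exact List.suffix_refl _
  | succ l' _ ih => exact ih.trans (suffix_foldl _ _)

theorem mem_evalStrata {L T : List (List ℕ)} {l l' : ℕ} (h : l ≤ l') {x : List ℕ}
    (hx : x ∈ evalStrata c K P σ L l' T) : x ∈ evalStrata c K P σ L l T ∨
      ∃ (i : Fin P.length) (e : List ℕ), l ≤ σ (P.get i).head.p ∧
      (x = codeAtom c ((P.get i).head.ground (val e)) ∨ x = (K + i) :: e) := by
  induction l', h using Nat.le_induction with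
  | base => exact .inl hx
  | succ l' hl ih =>
    rcases mem_foldl_fireAll hx with h | ⟨i, e, hi, h⟩
    · exact ih h
    · exact .inr ⟨i, e, hi ▸ hl, h⟩

theorem mem_evalStrata_atom (hc : Function.Injective c) (hK : ∀ p, c p < K) {L T : List (List ℕ)} {l l' : ℕ}
    (h : l ≤ l') {a : GAtom S ℕ} (ha : σ a.p < l) (hx : codeAtom c a ∈ evalStrata c K P σ L l' T) :
    codeAtom c a ∈ evalStrata c K P σ L l T := by
  rcases mem_evalStrata h hx with h | ⟨i, e, hl, h | h⟩
  · exact h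
  · obtain rfl := codeAtom_injective hc h
    have : σ (P.get i).head.p < l := ha
    omega
  · exact absurd h (codeAtom_ne hK _ _ _)

/-- What the evaluation achieves. -/
structure Evaluated (c : S.pred → ℕ) (K : ℕ) (P : CProgram S ℕ) (E T₀ T : List (List ℕ)) : Prop where
  start : ∀ x ∈ T₀, x ∈ T
  closed : ∀ (i : Fin P.length), ∀ e ∈ E, enabled c K (P.get i) i e T = true →
    (K + i) :: e ∈ T ∧ codeAtom c ((P.get i).head.ground (val e)) ∈ T
  noConf : ∀ (i : Fin P.length) (e e' : List ℕ), (K + i) :: e ∈ T → (K + i) :: e' ∈ T → conf (P.get i) e e' = false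
  just : ∀ s x, x :: s <:+ T → x ∈ T₀ ∨ ∃ (i : Fin P.length), ∃ e ∈ E,
    (∀ a ∈ (P.get i).pos, codeAtom c (a.ground (val e)) ∈ s) ∧
    (∀ a ∈ (P.get i).neg, codeAtom c (a.ground (val e)) ∉ T) ∧
    (x = (K + i) :: e ∨ x = codeAtom c ((P.get i).head.ground (val e)) ∧ (K + i) :: e ∈ s)

theorem evaluated (hc : Function.Injective c) (hK : ∀ p, c p < K) (hσ : StratifiedBy P σ) (D : List ℕ) (R : ℕ)
    {B : ℕ} (hB : ∀ r ∈ P, σ r.head.p < B) {T₀ : List (List ℕ)} (hT₀ : ∀ x ∈ T₀, ∃ a, x = codeAtom c a) :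
    Evaluated c K P (envs D R) T₀ (evalStrata c K P σ (schedule D R P.length) B T₀) := by
  set L := schedule D R P.length with hL
  set T := evalStrata c K P σ L B T₀ with hT
  have hLE : ∀ e ∈ L, e ∈ envs D R := fun e he => by
    simp only [hL, schedule, List.mem_flatMap] at he
    obtain ⟨_, _, h⟩ := he; exact h
  have hneg : ∀ (i : Fin P.length) l, σ (P.get i).head.p = l → ∀ T', evalStrata c K P σ L l T₀ <:+ T' → ∀ (e : List ℕ),
      (∀ a ∈ (P.get i).neg, codeAtom c (a.ground (val e)) ∉ T') → ∀ a ∈ (P.get i).neg, codeAtom c (a.ground (val e)) ∉ T := by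
    rintro i _ rfl T' hs e h a ha h'
    refine h a ha (hs.subset (mem_evalStrata_atom hc hK (hB _ (List.get_mem P i)).le ?_ h'))
    exact (hσ _ (List.get_mem P i)).2 a ha
  -- the invariant of the evaluation
  let Inv : List (List ℕ) → Prop := fun T' =>
    (∀ (i : Fin P.length) (e e' : List ℕ), (K + i) :: e ∈ T' → (K + i) :: e' ∈ T' → conf (P.get i) e e' = false) ∧
    (∀ s x, x :: s <:+ T' → x ∈ T₀ ∨ ∃ (i : Fin P.length), ∃ e ∈ envs D R,
      (∀ a ∈ (P.get i).pos, codeAtom c (a.ground (val e)) ∈ s) ∧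
      (∀ a ∈ (P.get i).neg, codeAtom c (a.ground (val e)) ∉ T) ∧
      (x = (K + i) :: e ∨ x = codeAtom c ((P.get i).head.ground (val e)) ∧ (K + i) :: e ∈ s)) ∧
    ∀ (i : Fin P.length) (e : List ℕ), (K + i) :: e ∈ T' → codeAtom c ((P.get i).head.ground (val e)) ∈ T'
  have hinv : ∀ l, Inv (evalStrata c K P σ L l T₀) := by
    intro l
    induction l with
    | zero =>
      have hno : ∀ (i : ℕ) (e : List ℕ), (K + i) :: e ∉ T₀ := fun i e h => by
        obtain ⟨a, ha⟩ := hT₀ _ h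
        exact codeAtom_ne hK a i e ha.symm
      exact ⟨fun i e e' h => absurd h (hno _ _), fun s x h => .inl (h.subset (by simp)), fun i e h => absurd h (hno _ _)⟩
    | succ l ih =>
      refine (foldl_induct (fun T' => evalStrata c K P σ L l T₀ <:+ T' ∧ Inv T') ?_ ⟨List.suffix_refl _, ih⟩).2
      rintro i T' e he hi ⟨hs, h1, h2, h3⟩
      refine ⟨hs.trans (suffix_fire _ _ _ _), ?_⟩
      rcases fire_cases (c := c) (K := K) (P.get i) i e T' with h' | ⟨h', hen, hnm⟩
      · rw [h'.1]; exact ⟨h1, h2, h3⟩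
      rw [h']
      rw [enabled_iff] at hen
      have hmem : ∀ (j : Fin P.length) e₁, (K + j) :: e₁ ∈ codeAtom c ((P.get i).head.ground (val e)) :: ((K + i) :: e) :: T' →
          (j = i ∧ e₁ = e) ∨ (K + j) :: e₁ ∈ T' := by
        intro j e₁ h
        rcases List.mem_cons.1 h with h | h
        · exact absurd h.symm (codeAtom_ne hK _ _ _)
        rcases List.mem_cons.1 h with h | h
        · simp only [List.cons.injEq, Nat.add_left_cancel_iff] at h
          exact .inl ⟨Fin.ext h.1, h.2⟩
        · exact .inr h
      refine ⟨fun j e₁ e₂ he₁ he₂ => ?_, fun s x hx => ?_, fun j e₁ he₁ => ?_⟩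
      · rcases hmem j e₁ he₁ with ⟨rfl, rfl⟩ | g₁ <;> rcases hmem _ e₂ he₂ with ⟨h4, rfl⟩ | g₂
        · exact conf_irrefl
        · exact hen.2.2 _ g₂
        · subst h4
          rw [Bool.eq_false_iff]; intro h
          have := conf_symm h
          rw [hen.2.2 _ g₁] at this
          cases this
        · exact h1 _ _ _ g₁ g₂
      · rcases List.suffix_cons_iff.1 hx with h | h
        · simp only [List.cons.injEq] at h
          obtain ⟨rfl, rfl⟩ := h
          exact .inr ⟨i, e, hLE e he, fun a ha => List.mem_cons_of_mem _ (hen.1 a ha), hneg i l hi T' hs e hen.2.1,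
            .inr ⟨rfl, by simp⟩⟩
        rcases List.suffix_cons_iff.1 h with h | h
        · simp only [List.cons.injEq] at h
          obtain ⟨rfl, rfl⟩ := h
          exact .inr ⟨i, e, hLE e he, fun a ha => hen.1 a ha, hneg i l hi _ hs e hen.2.1, .inl rfl⟩
        · exact h2 s x h
      · rcases hmem j e₁ he₁ with ⟨rfl, rfl⟩ | g₁
        · simp
        · exact List.mem_cons_of_mem _ (List.mem_cons_of_mem _ (h3 j e₁ g₁))
  refine ⟨fun x hx => (evalStrata_suffix (Nat.zero_le B)).subset hx, fun i e he hen => ?_, (hinv B).1, (hinv B).2.1⟩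
  have hi := hB _ (List.get_mem P i)
  set l := σ (P.get i).head.p with hl
  have hle : l + 1 ≤ B := hi
  have hsub := evalStrata_suffix (c := c) (K := K) (P := P) (σ := σ) (L := L) (T := T₀) hle
  have hfix := schedule_fixed (c := c) (K := K) (P := P) (σ := σ) (l := l) D R (evalStrata c K P σ L l T₀) i he rfl
  have hmark : (K + i) :: e ∈ evalStrata c K P σ L (l + 1) T₀ := by
    change fire c K (P.get i) i e (evalStrata c K P σ L (l + 1) T₀) = _ at hfix
    rcases fire_cases (c := c) (K := K) (P.get i) i e (evalStrata c K P σ L (l + 1) T₀) with h' | h'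
    · refine h'.2 ?_
      rw [enabled_iff] at hen ⊢
      refine ⟨fun a ha => mem_evalStrata_atom hc hK hle ?_ (hen.1 a ha), fun a ha h => hen.2.1 a ha (hsub.subset h),
        fun e' he' => hen.2.2 e' (hsub.subset he')⟩
      exact Nat.lt_succ_of_le ((hσ _ (List.get_mem P i)).1 a ha)
    · rw [h'.1] at hfix
      have := congrArg List.length hfix
      change _ + 1 + 1 = List.length (evalStrata c K P σ L (l + 1) T₀) at this
      omega
  exact ⟨hsub.subset hmark, hsub.subset ((hinv (l + 1)).2.2 i e hmark)⟩

theorem head_mem_atomsOf {C : Type} (r : CRule S C) : r.head ∈ atomsOf r := List.mem_cons_self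

theorem pos_mem_atomsOf {C : Type} {r : CRule S C} {a : Atom S C} (h : a ∈ r.pos) : a ∈ atomsOf r :=
  List.mem_cons_of_mem _ (List.mem_append_left _ h)

theorem neg_mem_atomsOf {C : Type} {r : CRule S C} {a : Atom S C} (h : a ∈ r.neg) : a ∈ atomsOf r :=
  List.mem_cons_of_mem _ (List.mem_append_right _ h)

theorem map_W_conf {i : Fin P.length} {e₁ e₂ : List ℕ} {ν₁ ν₂ : ℕ → ℕ}
    (h₁ : (P.get i).W.map ν₁ = (P.get i).W.map (val e₁)) (h₂ : (P.get i).W.map ν₂ = (P.get i).W.map (val e₂)) :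
    conf (P.get i) e₁ e₂ = true ↔
      ∃ g ∈ (P.get i).cgoals, (∀ v ∈ g.1, ν₁ v = ν₂ v) ∧ ∃ v ∈ g.2, ν₁ v ≠ ν₂ v := by
  rw [List.map_inj_left] at h₁ h₂
  rw [conf_iff]
  refine exists_congr fun g => and_congr_right fun hg => ?_
  have hW : ∀ v, v ∈ g.1 ∨ v ∈ g.2 → v ∈ (P.get i).W := fun v hv => mem_W.2 ⟨g, hg, hv⟩
  refine and_congr (forall₂_congr fun v hv => ?_) (exists_congr fun v => and_congr_right fun hv => ?_)
  · rw [h₁ v (hW v (.inl hv)), h₂ v (hW v (.inl hv))]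
  · rw [h₁ v (hW v (.inr hv)), h₂ v (hW v (.inr hv))]

/-- The stable model described by the final state of the evaluation. -/
def greedyModel (c : S.pred → ℕ) (K : ℕ) (P : CProgram S ℕ) (D : Set ℕ) (T : List (List ℕ)) : Set (FAtom S ℕ) :=
  {x | match x with
    | .base a => codeAtom c a ∈ T
    | .chosen j w => ∃ i : Fin P.length, j = i ∧ (P.get i).cgoals ≠ [] ∧ ∃ e : List ℕ, (K + i) :: e ∈ T ∧
        w = (P.get i).W.map (val e)
    | .diff j w => ∃ i : Fin P.length, j = i ∧ ∃ g ∈ (P.get i).cgoals, ∃ ν ν' : ℕ → ℕ, (∀ v, ν v ∈ D) ∧ (∀ v, ν' v ∈ D) ∧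
        (∀ v ∈ g.1, ν v = ν' v) ∧ (∃ v ∈ g.2, ν v ≠ ν' v) ∧ w = (P.get i).W.map ν ∧
        ∃ e : List ℕ, (K + i) :: e ∈ T ∧ (P.get i).W.map ν' = (P.get i).W.map (val e)}

theorem Evaluated.isStable {D : List ℕ} {R : ℕ} (hR : 0 < R)
    (hRa : ∀ r ∈ P, ∀ a ∈ atomsOf r, ∀ i v, a.args i = .var v → v < R) (hRW : ∀ r ∈ P, ∀ v ∈ r.W, v < R)
    (hc : Function.Injective c) (hK : ∀ p, c p < K) {dbl : List (GAtom S ℕ)} {T : List (List ℕ)}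
    (h : Evaluated c K P (envs D R) (dbl.map (codeAtom c)) T) :
    IsStableModel (foeD P {d | d ∈ D} {a | a ∈ dbl}) (greedyModel c K P {d | d ∈ D} T) := by
  have htr : ∀ ν : ℕ → ℕ, (∀ v, ν v ∈ D) → (List.range R).map ν ∈ envs D R := fun ν hν => by
    rw [mem_envs]; exact ⟨by simp, fun x hx => by obtain ⟨v, _, rfl⟩ := List.mem_map.1 hx; exact hν v⟩
  have hgr : ∀ (i : Fin P.length) (ν ν' : ℕ → ℕ), (∀ v < R, ν v = ν' v) → ∀ a ∈ atomsOf (P.get i), a.ground ν = a.ground ν' :=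
    fun i ν ν' hν a ha => ground_congr fun j v hv => hν v (hRa _ (List.get_mem P i) a ha j v hv)
  have hWc : ∀ (i : Fin P.length) (ν ν' : ℕ → ℕ), (∀ v < R, ν v = ν' v) → (P.get i).W.map ν = (P.get i).W.map ν' :=
    fun i ν ν' hν => List.map_inj_left.2 fun v hv => hν v (hRW _ (List.get_mem P i) v hv)
  -- applicability of an instance
  have hen : ∀ (i : Fin P.length) (ν : ℕ → ℕ), (∀ v, ν v ∈ D) →
      posBody (P.get i) ν ⊆ greedyModel c K P {d | d ∈ D} T →
      (∀ a ∈ negBody (P.get i) ν, a ∉ greedyModel c K P {d | d ∈ D} T) →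
      (∀ e, (K + i) :: e ∈ T → conf (P.get i) ((List.range R).map ν) e = false) →
      (K + i) :: (List.range R).map ν ∈ T ∧ codeAtom c ((P.get i).head.ground ν) ∈ T := by
    intro i ν hν hp hn hcf
    have hval : ∀ v < R, val ((List.range R).map ν) v = ν v := fun v hv => val_range ν hv
    have := h.closed i _ (htr ν hν) (enabled_iff.2 ⟨fun a ha => ?_, fun a ha => ?_, hcf⟩)
    · rwa [hgr i _ _ hval _ (head_mem_atomsOf _)] at this
    · rw [hgr i _ _ hval a (pos_mem_atomsOf ha)]
      exact hp ⟨a, ha, rfl⟩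
    · rw [hgr i _ _ hval a (neg_mem_atomsOf ha)]
      exact hn _ ⟨a, ha, rfl⟩
  have hcW : ∀ (i : Fin P.length) (ν : ℕ → ℕ), (P.get i).W.map ν = (P.get i).W.map (val ((List.range R).map ν)) :=
    fun i ν => (hWc i _ _ fun v hv => val_range ν hv).symm
  rw [isStable_iff]
  constructor
  · rintro _ ((((⟨a, ha, rfl⟩ | ⟨i, ν, hν, hi, rfl⟩) | ⟨i, ν, hν, hi, rfl⟩) | ⟨i, ν, hν, hi, rfl⟩) |
      ⟨i, g, hg, ν, ν', hν, hν', h1, h2, rfl⟩)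
    · exact fun _ _ => h.start _ (List.mem_map.2 ⟨a, ha, rfl⟩)
    · intro hp hn
      refine (hen i ν hν hp hn fun e _ => ?_).2
      rw [conf, hi]; rfl
    · intro hp hn
      obtain ⟨i', hii, -, e, he, hw⟩ := hp (Set.mem_insert _ _)
      obtain rfl : i = i' := Fin.ext hii
      refine (hen i ν hν (fun x hx => hp (Set.mem_insert_of_mem _ hx)) hn fun e' he' => ?_).2
      have := h.noConf i e e' he he'
      rw [Bool.eq_false_iff] at this ⊢
      refine fun h' => this ((map_W_conf hw rfl).2 ((map_W_conf (hcW i ν) rfl).1 h'))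
    · intro hp hn
      have := hen i ν hν hp (fun a ha => hn a (Set.mem_insert_of_mem _ ha)) fun e he => ?_
      · exact ⟨i, rfl, hi, _, this.1, hcW i ν⟩
      · rw [Bool.eq_false_iff]
        intro hcf
        have heE : e ∈ envs D R := by
          obtain ⟨s, t, hst⟩ := List.append_of_mem he
          rcases h.just t _ ⟨s, hst.symm⟩ with h' | ⟨i', e', he', -, -, h' | h'⟩
          · obtain ⟨a, -, ha⟩ := List.mem_map.1 h'
            exact absurd ha (codeAtom_ne hK _ _ _)
          · simp only [List.cons.injEq] at h'
            rw [h'.2]; exact he'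
          · exact absurd h'.1.symm (codeAtom_ne hK _ _ _)
        obtain ⟨ν', hν', hve⟩ := exists_valuation hR heE
        obtain ⟨g, hg, h1, h2⟩ := (map_W_conf (hcW i ν) (hWc i ν' (val e) hve)).1 hcf
        exact hn _ (Set.mem_insert _ _) ⟨i, rfl, g, hg, ν, ν', hν, hν', h1, h2, rfl, e, he, hWc i ν' (val e) hve⟩
    · intro hp _
      obtain ⟨i', hii, -, e, he, hw⟩ := hp (Set.mem_singleton _)
      obtain rfl : i = i' := Fin.ext hii
      exact ⟨i, rfl, g, hg, ν, ν', hν, hν', h1, h2, rfl, e, he, hw⟩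
  · intro N hN
    have key : ∀ s, s <:+ T → (∀ a, codeAtom c a ∈ s → FAtom.base a ∈ N) ∧
        ∀ (i : Fin P.length) (e : List ℕ), (K + i) :: e ∈ s → (P.get i).cgoals ≠ [] →
          FAtom.chosen i ((P.get i).W.map (val e)) ∈ N := by
      intro s
      induction s with
      | nil => intro _; simp
      | cons x s ih =>
        intro hs
        obtain ⟨ih1, ih2⟩ := ih ((List.suffix_cons x s).trans hs)
        rcases h.just s x hs with hx | ⟨i, e, he, hp, hn, hx⟩
        · obtain ⟨a, ha, rfl⟩ := List.mem_map.1 hx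
          refine ⟨fun a' ha' => ?_, fun i e hie => ?_⟩
          · rcases List.mem_cons.1 ha' with h' | h'
            · obtain rfl := codeAtom_injective hc h'
              exact hN ⟨FAtom.base a', ∅, ∅⟩ (.inl (.inl (.inl (.inl ⟨a', ha, rfl⟩)))) (by simp) (by simp)
            · exact ih1 a' h'
          · rcases List.mem_cons.1 hie with h' | h'
            · exact absurd h'.symm (codeAtom_ne hK _ _ _)
            · exact ih2 i e h'
        · obtain ⟨ν, hν, hve⟩ := exists_valuation hR he
          have hp' : posBody (P.get i) ν ⊆ N := by
            rintro _ ⟨a, ha, rfl⟩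
            rw [hgr i _ _ hve a (pos_mem_atomsOf ha)]
            exact ih1 _ (hp a ha)
          have hn' : ∀ a ∈ negBody (P.get i) ν, a ∉ greedyModel c K P {d | d ∈ D} T := by
            rintro _ ⟨a, ha, rfl⟩
            rw [hgr i _ _ hve a (neg_mem_atomsOf ha)]
            exact hn a ha
          rcases hx with rfl | ⟨rfl, hm⟩
          · refine ⟨fun a' ha' => ?_, fun i' e' hie hcg => ?_⟩
            · rcases List.mem_cons.1 ha' with h' | h'
              · exact absurd h' (codeAtom_ne hK _ _ _)
              · exact ih1 a' h'
            · rcases List.mem_cons.1 hie with h' | h'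
              · simp only [List.cons.injEq, Nat.add_left_cancel_iff] at h'
                obtain ⟨h1, rfl⟩ := h'
                obtain rfl := Fin.ext h1
                rw [← hWc _ _ _ hve]
                refine hN ⟨FAtom.chosen i' ((P.get i').W.map ν), posBody (P.get i') ν,
                  insert (FAtom.diff i' ((P.get i').W.map ν)) (negBody (P.get i') ν)⟩ (.inl (.inr ⟨i', ν, hν, hcg, rfl⟩)) ?_ hp'
                rintro a (rfl | ha)
                · rintro ⟨j, hij, g, hg, ν₁, ν₂, -, -, h1, h2, hw, e₂, he₂, hw₂⟩
                  obtain rfl : i' = j := Fin.ext hij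
                  have h3 := h.noConf i' e' e₂ (hs.subset (by simp)) he₂
                  rw [Bool.eq_false_iff] at h3
                  exact h3 ((map_W_conf (hw.symm.trans (hWc _ _ _ hve)) hw₂).2 ⟨g, hg, h1, h2⟩)
                · exact hn' a ha
              · exact ih2 i' e' h' hcg
          · refine ⟨fun a' ha' => ?_, fun i' e' hie hcg => ?_⟩
            · rcases List.mem_cons.1 ha' with h' | h'
              · obtain rfl := codeAtom_injective hc h'
                rw [← hgr i _ _ hve _ (head_mem_atomsOf _)]
                by_cases hcg : (P.get i).cgoals = []
                · exact hN ⟨FAtom.base ((P.get i).head.ground ν), posBody (P.get i) ν, negBody (P.get i) ν⟩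
                    (.inl (.inl (.inl (.inr ⟨i, ν, hν, hcg, rfl⟩)))) hn' hp'
                · refine hN ⟨FAtom.base ((P.get i).head.ground ν), insert (FAtom.chosen i ((P.get i).W.map ν)) (posBody (P.get i) ν),
                    negBody (P.get i) ν⟩ (.inl (.inl (.inr ⟨i, ν, hν, hcg, rfl⟩))) hn' ?_
                  rintro x (rfl | hx)
                  · rw [hWc _ _ _ hve]
                    exact ih2 i e hm hcg
                  · exact hp' hx
              · exact ih1 a' h'
            · rcases List.mem_cons.1 hie with h' | h'
              · exact absurd h'.symm (codeAtom_ne hK _ _ _)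
              · exact ih2 i' e' h' hcg
    obtain ⟨k1, k2⟩ := key T (List.suffix_refl T)
    rintro (a | ⟨j, w⟩ | ⟨j, w⟩) hx
    · exact k1 a hx
    · obtain ⟨i, rfl, hi, e, he, rfl⟩ := hx
      exact k2 i e he hi
    · obtain ⟨i, rfl, g, hg, ν, ν', hν, hν', h1, h2, rfl, e, he, hw⟩ := hx
      refine hN ⟨FAtom.diff i ((P.get i).W.map ν), {FAtom.chosen i ((P.get i).W.map ν')}, ∅⟩
        (.inr ⟨i, g, hg, ν, ν', hν, hν', h1, h2, rfl⟩) (by simp) ?_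
      rintro x rfl
      rw [hw]
      exact k2 i e he (List.ne_nil_of_mem hg)

end GreedyStable

end DC

namespace DC

/-! ## The evaluation runs in polynomial time -/

section GreedyPT

variable {S : Schema} {c : S.pred → ℕ} {K : ℕ} {P : CProgram S ℕ} {σ : S.pred → ℕ}

theorem PT.ofFn {α β : Type} [Enc α] [Enc β] {n : ℕ} {f : Fin n → α → β} (hf : ∀ i, PT (f i)) :
    PT fun a => List.ofFn fun i => f i a := by
  induction n with
  | zero => simpa using PT.const (α := α) ([] : List β)
  | succ n ih =>
    simp only [List.ofFn_succ]
    exact PT.cons (hf 0) (ih fun i => hf i.succ)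

theorem PT.allFixed {α ι : Type} [Enc α] (F : List ι) {f : ι → α → Bool} (hf : ∀ i, PT (f i)) :
    PT fun a => F.all fun i => f i a := by
  induction F with
  | nil => exact PT.const true
  | cons i F ih => simpa only [List.all_cons] using PT.and (hf i) ih

theorem PT.anyFixed {α ι : Type} [Enc α] (F : List ι) {f : ι → α → Bool} (hf : ∀ i, PT (f i)) :
    PT fun a => F.any fun i => f i a := by
  induction F with
  | nil => exact PT.const false
  | cons i F ih => simpa only [List.any_cons] using PT.or (hf i) ih

theorem PT.valD {α : Type} [Enc α] {e : α → List ℕ} (he : PT e) (v : ℕ) : PT fun a => DC.val (e a) v :=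
  PT.getD v 0 he

theorem PT.codeAtom_ground (a : Atom S ℕ) : PT fun e : List ℕ => codeAtom c (a.ground (DC.val e)) := by
  have : ∀ i, PT fun e : List ℕ => (a.args i).eval (DC.val e) := fun i => by
    cases a.args i with
    | var v => exact PT.valD PT.id v
    | const d => exact PT.const d
  have h : PT fun e : List ℕ => c a.p :: List.ofFn fun i => (a.args i).eval (DC.val e) := PT.cons (PT.const _) (PT.ofFn this)
  exact h

theorem PT.conf (r : CRule S ℕ) : PT fun q : List ℕ × List ℕ => DC.conf r q.1 q.2 := by
  have h : ∀ v, PT fun q : List ℕ × List ℕ => decide (DC.val q.1 v = DC.val q.2 v) := fun v =>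
    PT.decideEq (PT.valD (by fun_prop) v) (PT.valD (by fun_prop) v)
  exact PT.anyFixed _ fun g => PT.and (PT.allFixed _ h) (PT.anyFixed _ fun v => PT.not (h v))

theorem PT.enabled (r : CRule S ℕ) (i : ℕ) : PT fun q : List (List ℕ) × List ℕ => DC.enabled c K r i q.2 q.1 := by
  have h : ∀ a : Atom S ℕ, PT fun q : List (List ℕ) × List ℕ => decide (codeAtom c (a.ground (DC.val q.2)) ∈ q.1) :=
    fun a => PT.elem (f := fun q : List (List ℕ) × List ℕ => codeAtom c (a.ground (DC.val q.2))) (l := fun q => q.1)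
      ((PT.codeAtom_ground a).comp (f := fun q : List (List ℕ) × List ℕ => q.2) (by fun_prop)) (by fun_prop)
  have h1 : PT fun q : (List (List ℕ) × List ℕ) × List ℕ => decide (q.2 = (K + i) :: q.2.tail) := by fun_prop
  have h2 : PT fun q : (List (List ℕ) × List ℕ) × List ℕ => DC.conf r q.1.2 q.2.tail :=
    (PT.conf r).comp (f := fun q : (List (List ℕ) × List ℕ) × List ℕ => (q.1.2, q.2.tail)) (by fun_prop)
  have h3 : PT fun q : List (List ℕ) × List ℕ => q.1.any fun e => decide (e = (K + i) :: e.tail) && DC.conf r q.2 e.tail :=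
    PT.any (l := fun q : List (List ℕ) × List ℕ => q.1)
      (f := fun q e => decide (e = (K + i) :: e.tail) && DC.conf r q.2 e.tail) (by fun_prop) (PT.and h1 h2)
  exact PT.and (PT.allFixed _ h) (PT.and (PT.allFixed _ fun a => PT.not (h a)) (PT.not h3))

theorem PT.fire (r : CRule S ℕ) (i : ℕ) : PT fun q : List (List ℕ) × List ℕ => DC.fire c K r i q.2 q.1 := by
  have h1 : PT fun q : List (List ℕ) × List ℕ => DC.enabled c K r i q.2 q.1 && !decide ((K + i) :: q.2 ∈ q.1) :=
    PT.and (PT.enabled r i) (PT.not (PT.elem (f := fun q : List (List ℕ) × List ℕ => (K + i) :: q.2)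
      (l := fun q => q.1) (by fun_prop) (by fun_prop)))
  have h2 : PT fun q : List (List ℕ) × List ℕ => codeAtom c (r.head.ground (DC.val q.2)) :: ((K + i) :: q.2) :: q.1 :=
    PT.cons ((PT.codeAtom_ground r.head).comp (f := fun q : List (List ℕ) × List ℕ => q.2) (by fun_prop)) (by fun_prop)
  exact (PT.cond h1 h2 (by fun_prop)).congr fun q => rfl

theorem sz_fire (r : CRule S ℕ) (i : ℕ) : ∃ p : Polynomial ℕ, ∀ T e, sz (fire c K r i e T) ≤ sz T + p.eval (sz e) := by
  obtain ⟨p, hp⟩ := (PT.codeAtom_ground (c := c) r.head).size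
  obtain ⟨B, hB⟩ : ∃ B, sz (K + i) = B := ⟨_, rfl⟩
  refine ⟨p + Polynomial.X + Polynomial.C (B + 3), fun T e => ?_⟩
  have h1 := hp e
  simp only [Polynomial.eval_add, Polynomial.eval_X, Polynomial.eval_C]
  rcases fire_cases (c := c) (K := K) r i e T with h | h
  · rw [h.1]; omega
  · rw [h.1, sz_cons, sz_cons, sz_cons, hB]; omega

theorem PT.foldl_const {ι τ β : Type} [Enc τ] [Enc β] {g : ι → τ → β → τ}
    (hg : ∀ i, PT fun q : τ × β => g i q.1 q.2) (F : List ι) : PT fun q : τ × β => F.foldl (fun T i => g i T q.2) q.1 := by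
  induction F using List.reverseRecOn with
  | nil => exact PT.fst PT.id
  | append_singleton F i ih =>
    simp only [List.foldl_append, List.foldl_cons, List.foldl_nil]
    exact (hg i).comp (PT.pair ih (PT.snd PT.id))

theorem PT.fireAll (l : ℕ) : PT fun q : List (List ℕ) × List ℕ => DC.fireAll c K P σ l q.1 q.2 := by
  refine PT.foldl_const (g := fun (i : Fin P.length) (T : List (List ℕ)) (e : List ℕ) =>
    bif decide (σ (P.get i).head.p = l) then DC.fire c K (P.get i) i e T else T) (fun i => ?_) _
  by_cases hl : σ (P.get i).head.p = l
  · simp only [decide_eq_true hl, cond_true]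
    exact PT.fire _ _
  · simp only [decide_eq_false hl, cond_false]
    exact PT.fst PT.id

theorem sz_fireAll (l : ℕ) : ∃ p : Polynomial ℕ, ∀ T e, sz (fireAll c K P σ l T e) ≤ sz T + p.eval (sz e) := by
  unfold fireAll
  induction List.finRange P.length using List.reverseRecOn with
  | nil => exact ⟨0, fun T e => by simp⟩
  | append_singleton F i ih =>
    simp only [List.foldl_append, List.foldl_cons, List.foldl_nil]
    by_cases hl : σ (P.get i).head.p = l
    · simp only [decide_eq_true hl, cond_true]
      obtain ⟨p, hp⟩ := ih
      obtain ⟨q, hq⟩ := sz_fire (c := c) (K := K) (P.get i) i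
      refine ⟨p + q, fun T e => (hq _ e).trans ?_⟩
      have := hp T e
      rw [Polynomial.eval_add]
      omega
    · simp only [decide_eq_false hl, cond_false]
      exact ih

theorem PT.evalStrata {α : Type} [Enc α] {L T : α → List (List ℕ)} (hL : PT L) (hT : PT T) (l : ℕ) :
    PT fun a => DC.evalStrata c K P σ (L a) l (T a) := by
  induction l with
  | zero => exact hT
  | succ l ih =>
    obtain ⟨p, hp⟩ := sz_fireAll (c := c) (K := K) (P := P) (σ := σ) l
    refine PT.foldl (l := L) (s := fun a => DC.evalStrata c K P σ (L a) l (T a)) (g := fun _ => DC.fireAll c K P σ l)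
      ((PT.fireAll l).comp (f := fun q : α × List (List ℕ) × List ℕ => q.2) (by fun_prop)) hL ih
      ⟨p, fun a s x _ => (hp s x).trans ?_⟩
    have := eval_mono p (show sz x ≤ sz (a, x) by rw [sz_pair]; simp only; omega)
    omega

theorem PT.envs {α : Type} [Enc α] {D : α → List ℕ} (hD : PT D) (R : ℕ) : PT fun a => DC.envs (D a) R := by
  induction R with
  | zero => exact PT.const _
  | succ R ih =>
    refine PT.flatMap (l := D) (f := fun a d => (DC.envs (D a) R).map (List.cons d)) hD ?_
    refine PT.map (l := fun q : α × ℕ => DC.envs (D q.1) R) (f := fun q e => q.2 :: e)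
      (ih.comp (f := fun q : α × ℕ => q.1) (by fun_prop)) (by fun_prop)

theorem PT.schedule {α : Type} [Enc α] {D : α → List ℕ} (hD : PT D) (R q : ℕ) : PT fun a => DC.schedule (D a) R q := by
  have h1 : PT fun a => (List.range q).flatMap fun _ => DC.envs (D a) R :=
    PT.flatMap (l := fun _ => List.range q) (f := fun a _ => DC.envs (D a) R) (PT.const _)
      ((PT.envs hD R).comp (f := fun q : α × ℕ => q.1) (by fun_prop))
  exact PT.flatMap (f := fun a _ => DC.envs (D a) R) h1
    ((PT.envs hD R).comp (f := fun q : α × List ℕ => q.1) (by fun_prop))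

end GreedyPT

section

variable {m n : ℕ} {ar : Fin m → ℕ} {arAux : Fin n → ℕ}

/-- The numbering of the predicates of a program. -/
def predCode (m n : ℕ) : Fin m ⊕ Fin n → ℕ := Sum.elim (fun p => p) (fun j => m + j)

theorem predCode_injective (m n : ℕ) : Function.Injective (predCode m n) := by
  rintro (p | j) (p' | j') h
  · exact congrArg _ (Fin.ext h)
  · simp [predCode] at h; omega
  · simp [predCode] at h; omega
  · simp [predCode] at h; exact congrArg _ (Fin.ext h)

theorem predCode_lt (p : Fin m ⊕ Fin n) : predCode m n p < m + n := by
  rcases p with p | j <;> simp [predCode]; omega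

theorem factList_eq (a : GAtom (inSchema m ar) ℕ) :
    factList a = codeAtom (S := ⟨Fin m ⊕ Fin n, Sum.elim ar arAux⟩) (predCode m n) (embDB a) := rfl

theorem exists_rule_bounds {S : Schema} (P : CProgram S ℕ) (σ : S.pred → ℕ) :
    ∃ R, 0 < R ∧ (∀ r ∈ P, ∀ a ∈ atomsOf r, ∀ i v, a.args i = .var v → v < R) ∧ (∀ r ∈ P, ∀ v ∈ r.W, v < R) ∧
      ∀ r ∈ P, σ r.head.p < R := by
  obtain ⟨R, hR⟩ := exists_var_bound P
  obtain ⟨R', hR'⟩ : ∃ R', ∀ v ∈ P.flatMap CRule.W, v < R' := ⟨(P.flatMap CRule.W).sum + 1, fun v hv =>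
    Nat.lt_succ_of_le (List.le_sum_of_mem hv)⟩
  obtain ⟨R'', hR''⟩ : ∃ R', ∀ v ∈ P.map fun r => σ r.head.p, v < R' := ⟨(P.map fun r => σ r.head.p).sum + 1, fun v hv =>
    Nat.lt_succ_of_le (List.le_sum_of_mem hv)⟩
  refine ⟨R + R' + R'' + 1, by omega, fun r hr a ha i v h => ?_, fun r hr v hv => ?_, fun r hr => ?_⟩
  · have := hR r hr a ha i v h; omega
  · have := hR' v (List.mem_flatMap.2 ⟨r, hr, hv⟩); omega
  · have := hR'' _ (List.mem_map.2 ⟨r, hr, rfl⟩); omega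

/-- A stratified choice program has a stable model, computed in polynomial time. -/
theorem exists_stable (P : CProgram ⟨Fin m ⊕ Fin n, Sum.elim ar arAux⟩ ℕ) (σ : Fin m ⊕ Fin n → ℕ) (hσ : StratifiedBy P σ) :
    ∃ T : List (List ℕ) → List (List ℕ), PT T ∧ ∀ dbl : List (GAtom (inSchema m ar) ℕ),
      ∃ M, IsStableModel (foeD P (gdom P {b | ∃ a ∈ {a | a ∈ dbl}, b = embDB (arAux := arAux) a})
        {b | ∃ a ∈ {a | a ∈ dbl}, b = embDB (arAux := arAux) a}) M ∧
        ∀ a, FAtom.base a ∈ M ↔ codeAtom (predCode m n) a ∈ T (dbl.map factList) := by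
  obtain ⟨R, hR, hRa, hRW, hRσ⟩ := exists_rule_bounds P σ
  have hcf := consts_finite P
  set C := hcf.toFinset.toList with hC
  let D : List (List ℕ) → List ℕ := fun x => x.flatMap List.tail ++ C
  have hD : PT D := PT.append (PT.flatMap (l := fun x : List (List ℕ) => x) (f := fun _ y => y.tail) (by fun_prop) (by fun_prop))
    (PT.const C)
  refine ⟨fun x => evalStrata (predCode m n) (m + n) P σ (schedule (D x) R P.length) R x,
    PT.evalStrata (PT.schedule hD R _) PT.id R, fun dbl => ?_⟩
  have hx : dbl.map factList = (dbl.map (embDB (arAux := arAux))).map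
      (codeAtom (S := ⟨Fin m ⊕ Fin n, Sum.elim ar arAux⟩) (predCode m n)) := by
    rw [List.map_map]; rfl
  have hdb : {b | ∃ a ∈ {a | a ∈ dbl}, b = embDB (arAux := arAux) a} = {b | b ∈ dbl.map (embDB (arAux := arAux))} := by
    ext b; simp [eq_comm]
  have hgd : gdom P {b | ∃ a ∈ {a | a ∈ dbl}, b = embDB (arAux := arAux) a} = {d | d ∈ D (dbl.map factList)} := by
    ext d
    simp only [gdom, activeDom, Set.mem_union, Set.mem_ofPred_eq, D, List.mem_append, hC, Finset.mem_toList,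
      Set.Finite.mem_toFinset, List.mem_flatMap, List.mem_map]
    refine or_congr_left ⟨?_, ?_⟩
    · rintro ⟨_, ⟨a, ha, rfl⟩, i, rfl⟩
      exact ⟨_, ⟨a, ha, rfl⟩, (List.mem_ofFn' a.args _).2 ⟨i, rfl⟩⟩
    · rintro ⟨_, ⟨a, ha, rfl⟩, h⟩
      obtain ⟨i, hi⟩ := (List.mem_ofFn' a.args _).1 h
      exact ⟨_, ⟨a, ha, rfl⟩, i, hi⟩
  rw [hgd, hdb]
  have hev := evaluated (predCode_injective m n) predCode_lt hσ (D (dbl.map factList)) R hRσ (T₀ := dbl.map factList) fun x hx => by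
    obtain ⟨a, -, rfl⟩ := List.mem_map.1 hx
    exact ⟨embDB a, factList_eq a⟩
  rw [hx] at hev ⊢
  exact ⟨_, hev.isStable hR hRa hRW (predCode_injective m n) predCode_lt, fun a => Iff.rfl⟩

theorem dbPTime_of_expressible {k : ℕ} {Q : Query m ar k} (h : ExpressibleChoice Q) : DBPTime Q := by
  obtain ⟨n, arAux, P, σ, ans, hk, -, hσ, h⟩ := h
  subst hk
  obtain ⟨T, hT, hM⟩ := exists_stable P σ hσ
  rw [dbPTime_iff]
  let k := arAux ans
  refine ⟨fun x => ((T x).filter fun y => decide (y.headD 0 = m + ans) && ((y.drop (k + 1)).isEmpty && !(y.drop k).isEmpty)).map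
    List.tail, ?_, fun dbl => ?_⟩
  · refine PT.map (f := fun _ y => y.tail) (PT.filter (l := T) (f := fun _ y => decide (y.headD 0 = m + ans) &&
      ((y.drop (k + 1)).isEmpty && !(y.drop k).isEmpty)) hT ?_) (by fun_prop)
    have h1 : PT fun q : List (List ℕ) × List ℕ => q.2.drop (k + 1) := PT.drop _ (by fun_prop)
    have h2 : PT fun q : List (List ℕ) × List ℕ => q.2.drop k := PT.drop _ (by fun_prop)
    have h3 : PT fun q : List (List ℕ) × List ℕ => q.2.headD 0 := PT.headD (by fun_prop) (by fun_prop)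
    exact PT.and (PT.decideEq h3 (PT.const _)) (PT.and h1.isEmpty (PT.not h2.isEmpty))
  · obtain ⟨M, hst, hMT⟩ := hM dbl
    have hans := (h {a | a ∈ dbl} (List.finite_toSet dbl)).2 M hst
    beta_reduce
    generalize T (dbl.map factList) = T' at hMT ⊢
    set F := T'.filter fun y => decide (y.headD 0 = m + ans) && ((y.drop (k + 1)).isEmpty && !(y.drop k).isEmpty) with hF
    have hmem : ∀ y, y ∈ F ↔ y ∈ T' ∧ ∃ t : Fin k → ℕ, y = (m + ans) :: List.ofFn t := by
      intro y
      rw [hF, List.mem_filter]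
      refine and_congr_right fun _ => ?_
      cases y with
      | nil => simp
      | cons a y =>
        simp only [List.headD_cons, List.drop_succ_cons, Bool.and_eq_true, List.isEmpty_iff,
          List.drop_eq_nil_iff, Bool.not_eq_true', List.isEmpty_eq_false_iff, ne_eq, List.length_cons, List.cons.injEq]
        constructor
        · rintro ⟨h0, h1, h2⟩
          obtain rfl := of_decide_eq_true h0
          have hl : y.length = k := by omega
          exact ⟨fun i => y[(i : ℕ)], rfl, List.ofFn_getElem.symm.trans (List.ofFn_congr hl _)⟩
        · rintro ⟨t, rfl, rfl⟩
          exact ⟨decide_eq_true rfl, by simp⟩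
    clear_value F
    refine ⟨F.map fun y i => y.tail.getD i 0, ?_, fun t => ?_⟩
    · rw [List.map_map]
      refine List.map_congr_left fun y hy => ?_
      obtain ⟨-, t, rfl⟩ := (hmem y).1 hy
      simp only [List.tail_cons, Function.comp_apply]
      congr 1
      funext i
      rw [List.getD_eq_getElem _ _ (by simp [k])]
      simp
    · rw [← hans t, hMT, List.mem_map]
      have hc : codeAtom (S := ⟨Fin m ⊕ Fin n, Sum.elim ar arAux⟩) (predCode m n) ⟨Sum.inr ans, fun i => t (Fin.cast rfl i)⟩ =
        (m + ans) :: List.ofFn t := rfl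
      rw [hc]
      constructor
      · rintro ⟨y, hy, rfl⟩
        obtain ⟨hy, t, rfl⟩ := (hmem y).1 hy
        convert hy using 3
        funext i
        rw [List.tail_cons, List.getD_eq_getElem _ _ (by simp [k])]
        simp
      · intro ht
        refine ⟨_, (hmem _).2 ⟨ht, t, rfl⟩, ?_⟩
        funext i
        rw [List.tail_cons, List.getD_eq_getElem _ _ (by simp)]
        simp

end

end DC

namespace DC

/-! ## Linear orders on finite domains and lexicographic positions of tuples -/

/-- A maximal injective successor relation started at `0` enumerates the domain. -/
theorem exists_enum {D : Set ℕ} (hD : D.Finite) (h0 : 0 ∈ D) {s : ℕ → ℕ → Prop}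
    (hs : ∀ x y, s x y → Relation.ReflTransGen s 0 x ∧ x ∈ D ∧ y ∈ D ∧ y ≠ 0)
    (hfun : ∀ x y y', s x y → s x y' → y = y') (hinj : ∀ x x' y, s x y → s x' y → x = x')
    (hmax : ∀ x ∈ D, ∀ y ∈ D, Relation.ReflTransGen s 0 x → y ≠ 0 → (∃ y', s x y') ∨ ∃ x', s x' y) :
    ∃ (els : List ℕ) (rk : ℕ → ℕ), els.map rk = List.range els.length ∧ rk 0 = 0 ∧ (∀ x, x ∈ D ↔ x ∈ els) ∧
      ∀ x y, s x y ↔ x ∈ els ∧ y ∈ els ∧ rk y = rk x + 1 := by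
  classical
  let f : ℕ → ℕ := fun x => if h : ∃ y, s x y then h.choose else x
  have hf : ∀ x y, s x y → f x = y := fun x y h => by
    have h' : ∃ y, s x y := ⟨y, h⟩
    simp only [f, dif_pos h']
    exact hfun _ _ _ h'.choose_spec h
  let el : ℕ → ℕ := fun i => f^[i] 0
  have hel : ∀ i, (∃ y, s (el i) y) → s (el i) (el (i + 1)) := fun i ⟨y, hy⟩ => by
    have : el (i + 1) = f (el i) := Function.iterate_succ_apply' f i 0
    rw [this, hf _ _ hy]; exact hy
  have hne : ∀ n, (∀ i < n, ∃ y, s (el i) y) → ∀ i j, i < j → j ≤ n → el i ≠ el j := by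
    intro n hn i
    induction i with
    | zero =>
      rintro (_ | j) hij hj e
      · omega
      · exact (hs _ _ (hel j (hn j (by omega)))).2.2.2 e.symm
    | succ i ih =>
      rintro (_ | j) hij hj e
      · omega
      · have h1 := hel i (hn i (by omega))
        have h2 := hel j (hn j (by omega))
        rw [← e] at h2
        exact ih j (by omega) (by omega) (hinj _ _ _ h1 h2)
  have hfin : ∃ n, ¬ ∃ y, s (el n) y := by
    by_contra! hc
    have hinj : Function.Injective el := fun i j e => by
      rcases lt_trichotomy i j with h | h | h
      · exact absurd e (hne j (fun i _ => hc i) i j h le_rfl)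
      · exact h
      · exact absurd e.symm (hne i (fun i _ => hc i) j i h le_rfl)
    refine Set.infinite_range_of_injective hinj (hD.subset ?_)
    rintro _ ⟨i, rfl⟩
    exact (hs _ _ (hel i (hc i))).2.1
  let n := Nat.find hfin
  have hn : ¬ ∃ y, s (el n) y := Nat.find_spec hfin
  have hlt : ∀ i < n, ∃ y, s (el i) y := fun i hi => not_not.1 (Nat.find_min hfin hi)
  have hsucc : ∀ i < n, s (el i) (el (i + 1)) := fun i hi => hel i (hlt i hi)
  clear_value n
  have hreach : ∀ x, Relation.ReflTransGen s 0 x → ∃ i ≤ n, el i = x := by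
    intro x hx
    induction hx with
    | refl => exact ⟨0, Nat.zero_le _, rfl⟩
    | tail _ h ih =>
      obtain ⟨i, hi, rfl⟩ := ih
      have : i ≠ n := by rintro rfl; exact hn ⟨_, h⟩
      exact ⟨i + 1, by omega, hfun _ _ _ (hsucc i (by omega)) h⟩
  have hpath : ∀ i ≤ n, Relation.ReflTransGen s 0 (el i) := by
    intro i
    induction i with
    | zero => exact fun _ => .refl
    | succ i ih => exact fun hi => (ih (by omega)).tail (hsucc i (by omega))
  have hDel : ∀ i ≤ n, el i ∈ D := by
    rintro (_ | i) hi
    · exact h0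
    · exact (hs _ _ (hsucc i (by omega))).2.2.1
  have hcov : ∀ x, x ∈ D ↔ ∃ i ≤ n, el i = x := by
    refine fun x => ⟨fun hx => ?_, ?_⟩
    · by_cases hx0 : x = 0
      · exact ⟨0, Nat.zero_le _, hx0.symm⟩
      · rcases hmax _ (hDel n le_rfl) x hx (hpath n le_rfl) hx0 with h | ⟨x', h⟩
        · exact absurd h hn
        · exact hreach _ ((hs _ _ h).1.tail h)
    · rintro ⟨i, hi, rfl⟩; exact hDel i hi
  have hinj' : ∀ i ≤ n, ∀ j ≤ n, el i = el j → i = j := fun i hi j hj e => by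
    rcases lt_trichotomy i j with h | h | h
    · exact absurd e (hne n hlt i j h hj)
    · exact h
    · exact absurd e.symm (hne n hlt j i h hi)
  let els := (List.range (n + 1)).map el
  have hrk : ∀ i ≤ n, els.idxOf (el i) = i := fun i hi => by
    have hnd : els.Nodup := List.Nodup.map_on (fun i hi j hj e => hinj' i (by simp at hi; omega) j (by simp at hj; omega) e)
      List.nodup_range
    have := hnd.idxOf_getElem i (by simp [els]; omega)
    rwa [show els[i]'(by simp [els]; omega) = el i by simp [els]] at this
  have hmem : ∀ x, x ∈ els ↔ ∃ i ≤ n, el i = x := fun x => by simp [els]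
  refine ⟨els, els.idxOf, ?_, hrk 0 (Nat.zero_le _), fun x => by rw [hcov, hmem], fun x y => ?_⟩
  · rw [show els.length = n + 1 by simp [els], show els = (List.range (n + 1)).map el from rfl, List.map_map]
    conv_rhs => rw [← List.map_id (List.range (n + 1))]
    refine List.map_congr_left fun i hi => ?_
    exact hrk i (by simp at hi; omega)
  · rw [hmem, hmem]
    constructor
    · intro h
      obtain ⟨i, hi, rfl⟩ := hreach _ (hs _ _ h).1
      have hin : i ≠ n := by rintro rfl; exact hn ⟨_, h⟩
      obtain rfl := hfun _ _ _ h (hsucc i (by omega))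
      exact ⟨⟨i, hi, rfl⟩, ⟨i + 1, by omega, rfl⟩, by beta_reduce; rw [hrk _ (by omega), hrk _ hi]⟩
    · rintro ⟨⟨i, hi, rfl⟩, ⟨j, hj, rfl⟩, h⟩
      beta_reduce at h
      rw [hrk _ hj, hrk _ hi] at h
      subst h
      exact hsucc i (by omega)

/-- The lexicographic position of a tuple. -/
def pos (rk : ℕ → ℕ) (N : ℕ) : List ℕ → ℕ
  | [] => 0
  | x :: l => rk x * N ^ l.length + pos rk N l

section

variable {rk : ℕ → ℕ} {N : ℕ}

theorem pos_append (l l' : List ℕ) : pos rk N (l ++ l') = pos rk N l * N ^ l'.length + pos rk N l' := by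
  induction l with
  | nil => simp [pos]
  | cons x l ih => simp only [List.cons_append, pos, List.length_append, ih]; ring

theorem pos_replicate_zero {z : ℕ} (hz : rk z = 0) (j : ℕ) : pos rk N (List.replicate j z) = 0 := by
  induction j with
  | zero => rfl
  | succ j ih => rw [List.replicate_succ, pos, ih, hz]; simp

theorem pos_replicate_last {w : ℕ} (hw : rk w + 1 = N) (j : ℕ) : pos rk N (List.replicate j w) + 1 = N ^ j := by
  induction j with
  | zero => rfl
  | succ j ih =>
    rw [List.replicate_succ, pos, List.length_replicate, add_assoc, ih, pow_succ', ← hw]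
    ring

theorem flatMap_range_add (n B : ℕ) : ((List.range n).flatMap fun i => (List.range B).map fun j => i * B + j) = List.range (n * B) := by
  induction n with
  | zero => simp
  | succ n ih =>
    rw [List.range_succ, List.flatMap_append, ih, Nat.succ_mul, List.range_add]
    simp

theorem map_pos_envs {els : List ℕ} (h : els.map rk = List.range N) (R : ℕ) :
    (envs els R).map (pos rk N) = List.range (N ^ R) := by
  induction R with
  | zero => rfl
  | succ R ih =>
    rw [envs, List.map_flatMap, pow_succ', ← flatMap_range_add, ← h, List.flatMap_map]
    congr 1
    funext x
    rw [← ih, List.map_map, List.map_map]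
    refine List.map_congr_left fun l hl => ?_
    simp [pos, (mem_envs.1 hl).1]

variable {els : List ℕ} (h : els.map rk = List.range N) {R : ℕ}
include h

theorem length_envs : (envs els R).length = N ^ R := by simpa using congrArg List.length (map_pos_envs h R)

theorem pos_getElem {i : ℕ} (hi : i < (envs els R).length) : pos rk N ((envs els R)[i]) = i := by
  have h1 : ((envs els R).map (pos rk N))[i]'(by simpa) = i := by
    simp only [map_pos_envs h R, List.getElem_range]
  rwa [List.getElem_map] at h1

theorem getElem_pos {l : List ℕ} (hl : l ∈ envs els R) : (envs els R)[pos rk N l]? = some l := by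
  obtain ⟨i, hi, rfl⟩ := List.getElem_of_mem hl
  rw [pos_getElem h, List.getElem?_eq_getElem hi]

theorem pos_lt {l : List ℕ} (hl : l ∈ envs els R) : pos rk N l < N ^ R := by
  rw [← length_envs h (R := R)]
  exact (List.getElem?_eq_some_iff.1 (getElem_pos h hl)).1

theorem pos_inj {l l' : List ℕ} (hl : l ∈ envs els R) (hl' : l' ∈ envs els R) (e : pos rk N l = pos rk N l') : l = l' := by
  have h1 := getElem_pos h hl
  rw [e, getElem_pos h hl'] at h1
  exact (Option.some.inj h1).symm

theorem exists_pos {i : ℕ} (hi : i < N ^ R) : ∃ l ∈ envs els R, pos rk N l = i := by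
  rw [← length_envs h (R := R)] at hi
  exact ⟨_, List.getElem_mem hi, pos_getElem h hi⟩

theorem rk_lt {x : ℕ} (hx : x ∈ els) : rk x < N := by
  have : rk x ∈ els.map rk := List.mem_map_of_mem hx
  rw [h] at this
  exact List.mem_range.1 this

theorem exists_rk {i : ℕ} (hi : i < N) : ∃ x ∈ els, rk x = i := by
  have : i ∈ els.map rk := by rw [h]; exact List.mem_range.2 hi
  simpa using this

theorem rk_inj {x y : ℕ} (hx : x ∈ els) (hy : y ∈ els) (e : rk x = rk y) : x = y := by
  have := pos_inj (R := 1) h (mem_envs.2 ⟨rfl, by simpa using hx⟩) (mem_envs.2 ⟨rfl, by simpa using hy⟩) (l := [x]) (l' := [y])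
    (by simp [pos, e])
  simpa using this

end

/-- A tuple that is not the last one splits at its last digit that can be increased. -/
theorem eq_replicate_or_split (w : ℕ) (l : List ℕ) :
    l = List.replicate l.length w ∨ ∃ l' x j, x ≠ w ∧ l = l' ++ x :: List.replicate j w := by
  induction l with
  | nil => exact .inl rfl
  | cons x l ih =>
    rcases ih with h | ⟨l', y, j, hy, h⟩
    · by_cases hx : x = w
      · left; rw [hx, List.length_cons, List.replicate_succ, ← h]
      · exact .inr ⟨[], x, l.length, hx, by rw [← h]; rfl⟩
    · exact .inr ⟨x :: l', y, j, hy, by rw [h]; rfl⟩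

theorem exists_pow_bound (p : Polynomial ℕ) : ∃ d, ∀ n, 2 ≤ n → p.eval n < n ^ d := by
  induction p using Polynomial.induction_on' with
  | add p q hp hq =>
    obtain ⟨d, hd⟩ := hp
    obtain ⟨e, he⟩ := hq
    refine ⟨d + e + 1, fun n hn => ?_⟩
    have h1 := hd n hn
    have h2 := he n hn
    have h3 : n ^ d ≤ n ^ (d + e) := Nat.pow_le_pow_right (by omega) (by omega)
    have h4 : n ^ e ≤ n ^ (d + e) := Nat.pow_le_pow_right (by omega) (by omega)
    rw [Polynomial.eval_add, pow_succ]
    nlinarith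
  | monomial i c =>
    refine ⟨c + i, fun n hn => ?_⟩
    rw [Polynomial.eval_monomial, pow_add]
    have h1 : c < n ^ c := Nat.lt_pow_self (by omega)
    exact Nat.mul_lt_mul_of_pos_right h1 (by positivity)

end DC

namespace DC

/-! ## A choice program simulating a Turing machine on an arbitrary linear order -/

/-- The predicates of the simulating program for a machine with states `Fin (q + 1)` and symbols `Fin (k + 3)`. -/
inductive Pr (q k : ℕ)
  | zero | dom | reach | succ | hasSucc | last | next | bit | region | eq | ans
  | state (i : Fin (q + 1))
  | cell (c : Fin (k + 3))

noncomputable instance {q k : ℕ} : Fintype (Pr q k) :=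
  have : Function.Surjective (Sum.elim ![Pr.zero, .dom, .reach, .succ, .hasSucc, .last, .next, .bit, .region, .eq, .ans]
      (Sum.elim (Pr.state (q := q) (k := k)) Pr.cell)) := by
    rintro (_ | _ | _ | _ | _ | _ | _ | _ | _ | _ | _ | i | c)
    exacts [⟨.inl 0, rfl⟩, ⟨.inl 1, rfl⟩, ⟨.inl 2, rfl⟩, ⟨.inl 3, rfl⟩, ⟨.inl 4, rfl⟩, ⟨.inl 5, rfl⟩, ⟨.inl 6, rfl⟩,
      ⟨.inl 7, rfl⟩, ⟨.inl 8, rfl⟩, ⟨.inl 9, rfl⟩, ⟨.inl 10, rfl⟩, ⟨.inr (.inl i), rfl⟩, ⟨.inr (.inr c), rfl⟩]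
  have := Finite.of_surjective _ this
  Fintype.ofFinite _

/-- The parameters of the simulating program: the arity of the answer, the machine, the number of digits
of input positions besides the relation index, and the number of digits of the offset of the input. -/
structure Par where
  k : ℕ
  M : TM
  b : ℕ
  d : ℕ

/-- A rule without choice goals and with unspecified head predicate. -/
structure Rl (m : ℕ) (X : Par) where
  hd : List (Term ℕ)
  pos : List ((Fin m ⊕ Pr X.M.q X.M.k) × List (Term ℕ)) := []
  neg : List ((Fin m ⊕ Pr X.M.q X.M.k) × List (Term ℕ)) := []

section

variable {m : ℕ} (ar : Fin m → ℕ) (X : Par)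

def prAr : Pr X.M.q X.M.k → ℕ
  | .zero | .dom | .reach | .hasSucc | .last => 1
  | .succ => 2
  | .bit => X.b + 1
  | .region => X.d + 1
  | .next | .eq | .state _ | .cell _ => (X.d + 1) + (X.d + 1)
  | .ans => X.k

/-- The variables of a block. -/
def blk (i n : ℕ) : List (Term ℕ) := (List.range n).map fun j => .var (Nat.pair i j)

/-- The first variable of a block. -/
def vr (i : ℕ) : Term ℕ := .var (Nat.pair i 0)

/-- Repeated zeros. -/
def zs (n : ℕ) : List (Term ℕ) := List.replicate n (.const 0)

/-- Links of a successor chain starting at zero. -/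
def chain (i : ℕ) : Term ℕ := if i = 0 then .const 0 else .var (Nat.pair 2 i)

/-- The blocks `i` and `j` of full length. -/
def two (i j : ℕ) : List (Term ℕ) := blk i (X.d + 1) ++ blk j (X.d + 1)

/-- The rules defining each predicate, except for the successor relation. -/
def rulesFor : Pr X.M.q X.M.k → List (Rl m X)
  | .zero => [⟨[.const 0], [], []⟩]
  | .dom => (List.range (m + 2)).map fun j => ⟨[.const j], [], []⟩
  | .reach => [⟨[.const 0], [], []⟩, ⟨[vr 1], [(.inr .succ, [vr 0, vr 1])], []⟩]
  | .succ => []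
  | .hasSucc => [⟨[vr 0], [(.inr .succ, [vr 0, vr 1])], []⟩]
  | .last => [⟨[vr 0], [], [(.inr .hasSucc, [vr 0])]⟩]
  | .next => (List.range (X.d + 1)).map fun i =>
      ⟨(blk 0 i ++ vr 1 :: List.replicate (X.d - i) (vr 2)) ++ (blk 0 i ++ vr 3 :: zs (X.d - i)),
        [(.inr .succ, [vr 1, vr 3]), (.inr .last, [vr 2])], []⟩
  | .bit => ⟨zs X.b ++ [vr 0], [], []⟩ :: (List.finRange m).map fun (p : Fin m) =>
      ⟨chain ((p : ℕ) + 1) :: blk 1 X.b, (.inl p, blk 1 (ar p)) ::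
        (List.range ((p : ℕ) + 1)).map fun i => (.inr .succ, [chain i, chain (i + 1)]), []⟩
  | .region => [⟨vr 0 :: (zs (X.d - (X.b + 1)) ++ blk 1 (X.b + 1)), [(.inr .succ, [.const 0, vr 0])], []⟩]
  | .eq => [⟨two X 0 0, [], []⟩]
  | .ans => (List.finRange (X.M.q + 1) ×ˢ List.finRange (X.M.k + 3)).filterMap fun c =>
      if X.M.δ c.1 c.2 = none then
        some ⟨blk 2 X.k, [(.inr .succ, [.const 0, vr 3]), (.inr (.state c.1), two X 0 1), (.inr (.cell c.2), two X 0 1),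
          (.inr (.cell 2), blk 0 (X.d + 1) ++ vr 3 :: (zs (X.d - X.k) ++ blk 2 X.k))], []⟩
      else none
  | .state q => (if q = 0 then [⟨zs (X.d + 1) ++ vr 0 :: zs X.d, [(.inr .succ, [.const 0, vr 0])], []⟩] else []) ++
      (List.finRange (X.M.q + 1) ×ˢ List.finRange (X.M.k + 3)).filterMap fun c =>
        (X.M.δ c.1 c.2).bind fun r => if r.1 = q then
          some ⟨two X 1 3, [(.inr .next, two X 0 1), (.inr (.state c.1), two X 0 2), (.inr (.cell c.2), two X 0 2),
            (.inr .next, if r.2.2 then two X 2 3 else two X 3 2)], []⟩ else none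
  | .cell s =>
      (if s = 2 then [⟨zs (X.d + 1) ++ vr 0 :: (zs (X.d - (X.b + 1)) ++ blk 1 (X.b + 1)),
        [(.inr .succ, [.const 0, vr 0]), (.inr .bit, blk 1 (X.b + 1))], []⟩] else []) ++
      (if s = 1 then [⟨zs (X.d + 1) ++ vr 0 :: (zs (X.d - (X.b + 1)) ++ blk 1 (X.b + 1)),
        [(.inr .succ, [.const 0, vr 0])], [(.inr .bit, blk 1 (X.b + 1))]⟩] else []) ++
      (if s = 0 then [⟨zs (X.d + 1) ++ blk 0 (X.d + 1), [], [(.inr .region, blk 0 (X.d + 1))]⟩] else []) ++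
      ((List.finRange (X.M.q + 1) ×ˢ List.finRange (X.M.k + 3)).filterMap fun c =>
        (X.M.δ c.1 c.2).bind fun r => if r.2.1 = s then
          some ⟨two X 1 2, [(.inr .next, two X 0 1), (.inr (.state c.1), two X 0 2), (.inr (.cell c.2), two X 0 2)], []⟩
        else none) ++
      ((List.finRange (X.M.q + 1) ×ˢ List.finRange (X.M.k + 3)).filterMap fun c =>
        if X.M.δ c.1 c.2 = none then none else
          some ⟨two X 1 3, [(.inr .next, two X 0 1), (.inr (.state c.1), two X 0 2), (.inr (.cell c.2), two X 0 2),
            (.inr (.cell s), two X 0 3)], [(.inr .eq, two X 2 3)]⟩)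

/-- The stratum of each predicate. -/
def stratum : Fin m ⊕ Pr X.M.q X.M.k → ℕ
  | .inl _ => 0
  | .inr .zero | .inr .dom | .inr .eq => 0
  | .inr .reach | .inr .succ | .inr .hasSucc => 1
  | .inr .last | .inr .next | .inr .bit | .inr .region => 2
  | .inr .ans | .inr (.state _) | .inr (.cell _) => 3

theorem stratum_le (a : Fin m ⊕ Pr X.M.q X.M.k) : stratum X a ≤ 3 := by
  rcases a with p | (_ | _) <;> simp [stratum]

theorem stratum_rulesFor (j : Pr X.M.q X.M.k) : ∀ r ∈ rulesFor ar X j,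
    (∀ a ∈ r.pos, stratum X a.1 ≤ stratum X (.inr j : Fin m ⊕ _)) ∧ ∀ a ∈ r.neg, stratum X a.1 < stratum X (.inr j : Fin m ⊕ _) := by
  cases j
  case state q =>
    refine fun r hr => ⟨fun a _ => stratum_le X _, ?_⟩
    simp only [rulesFor, List.mem_append, List.mem_filterMap, Option.bind_eq_some_iff] at hr
    rcases hr with hr | ⟨c, -, u, -, hr⟩
    · split_ifs at hr <;> simp_all
    · split_ifs at hr <;> (obtain rfl := Option.some.inj hr; simp)
  case cell s =>
    refine fun r hr => ⟨fun a _ => stratum_le X _, ?_⟩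
    simp only [rulesFor, List.mem_append, List.mem_filterMap, Option.bind_eq_some_iff] at hr
    rcases hr with (((hr | hr) | hr) | ⟨c, -, u, -, hr⟩) | ⟨c, -, hr⟩
    all_goals split_ifs at hr
    all_goals simp at hr; try (subst hr; simp [stratum])
  case ans =>
    refine fun r hr => ⟨fun a _ => stratum_le X _, ?_⟩
    simp only [rulesFor, List.mem_filterMap] at hr
    obtain ⟨c, -, hr⟩ := hr
    split_ifs at hr; simp at hr; simp [← hr]
  all_goals simp [rulesFor, stratum]
  all_goals grind [stratum]

end

end DC

namespace DC

/-! ## Programs with a single choice rule -/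

section

variable {S : Schema} {C : Type}

/-- The body of a rule holds in `M`. -/
def Holds (M : Set (FAtom S C)) (r : CRule S C) (ν : ℕ → C) : Prop :=
  posBody r ν ⊆ M ∧ ∀ a ∈ negBody r ν, a ∉ M

variable {r₀ : CRule S C} {P : CProgram S C} {D : Set C} {edb : Set (GAtom S C)} {M : Set (FAtom S C)}

theorem base_of_holds (hM : IsStableModel (foeD (r₀ :: P) D edb) M) {r : CRule S C} (hr : r ∈ P) (h0 : r.cgoals = [])
    {ν : ℕ → C} (hν : ∀ v, ν v ∈ D) (h : Holds M r ν) : FAtom.base (r.head.ground ν) ∈ M := by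
  obtain ⟨i, rfl⟩ := List.get_of_mem hr
  exact (isStable_iff.1 hM).1 _ (.inl (.inl (.inl (.inr ⟨i.succ, ν, hν, h0, rfl⟩)))) h.1 h.2

theorem base_of_edb (hM : IsStableModel (foeD (r₀ :: P) D edb) M) {a : GAtom S C} (ha : a ∈ edb) : FAtom.base a ∈ M :=
  (isStable_iff.1 hM).1 _ (.inl (.inl (.inl (.inl ⟨a, ha, rfl⟩)))) (Set.empty_subset _) fun _ h => h.elim

theorem base_of_chosen (hM : IsStableModel (foeD (r₀ :: P) D edb) M) (h0 : r₀.cgoals ≠ []) {ν : ℕ → C}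
    (hν : ∀ v, ν v ∈ D) (h : Holds M r₀ ν) (hc : FAtom.chosen 0 (r₀.W.map ν) ∈ M) : FAtom.base (r₀.head.ground ν) ∈ M :=
  (isStable_iff.1 hM).1 _ (.inl (.inl (.inr ⟨⟨0, Nat.succ_pos _⟩, ν, hν, h0, rfl⟩))) (Set.insert_subset hc h.1) h.2

theorem chosen_of_holds (hM : IsStableModel (foeD (r₀ :: P) D edb) M) (h0 : r₀.cgoals ≠ []) {ν : ℕ → C}
    (hν : ∀ v, ν v ∈ D) (h : Holds M r₀ ν) (hd : FAtom.diff 0 (r₀.W.map ν) ∉ M) : FAtom.chosen 0 (r₀.W.map ν) ∈ M :=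
  (isStable_iff.1 hM).1 _ (.inl (.inr ⟨⟨0, Nat.succ_pos _⟩, ν, hν, h0, rfl⟩)) h.1 fun a ha => by
    rcases ha with rfl | ha
    exacts [hd, h.2 a ha]

theorem diff_of_chosen (hM : IsStableModel (foeD (r₀ :: P) D edb) M) {g : List ℕ × List ℕ} (hg : g ∈ r₀.cgoals)
    {ν ν' : ℕ → C} (hν : ∀ v, ν v ∈ D) (hν' : ∀ v, ν' v ∈ D) (h1 : ∀ v ∈ g.1, ν v = ν' v) (h2 : ∃ v ∈ g.2, ν v ≠ ν' v)
    (hc : FAtom.chosen 0 (r₀.W.map ν') ∈ M) : FAtom.diff 0 (r₀.W.map ν) ∈ M :=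
  (isStable_iff.1 hM).1 _ (.inr ⟨⟨0, Nat.succ_pos _⟩, g, hg, ν, ν', hν, hν', h1, h2, rfl⟩)
    (Set.singleton_subset_iff.2 hc) fun _ h => h.elim

theorem base_supported (hM : IsStableModel (foeD (r₀ :: P) D edb) M) (hP : ∀ r ∈ P, r.cgoals = []) (h0 : r₀.cgoals ≠ [])
    {a : GAtom S C} (ha : FAtom.base a ∈ M) : a ∈ edb ∨
    (∃ r ∈ P, ∃ ν : ℕ → C, (∀ v, ν v ∈ D) ∧ a = r.head.ground ν ∧ Holds M r ν) ∨
    ∃ ν : ℕ → C, (∀ v, ν v ∈ D) ∧ a = r₀.head.ground ν ∧ Holds M r₀ ν ∧ FAtom.chosen 0 (r₀.W.map ν) ∈ M := by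
  obtain ⟨_, (((⟨a, ha, rfl⟩ | ⟨⟨_ | i, hi⟩, ν, hν, hi', rfl⟩) | ⟨⟨_ | i, hi⟩, ν, hν, hi', rfl⟩) | ⟨i, ν, hν, hi, rfl⟩) |
    ⟨i, g, hg, ν, ν', -, -, -, -, rfl⟩, h1, h2, h3⟩ := stable_supported hM ha
  · cases h1; exact .inl ha
  · exact absurd hi' h0
  · cases h1
    exact .inr (.inl ⟨_, List.get_mem P ⟨i, Nat.lt_of_succ_lt_succ hi⟩, ν, hν, rfl, h2, h3⟩)
  · cases h1
    exact .inr (.inr ⟨ν, hν, rfl, ⟨fun x hx => h2 (.inr hx), h3⟩, h2 (.inl rfl)⟩)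
  · exact absurd (hP _ (List.get_mem P ⟨i, Nat.lt_of_succ_lt_succ hi⟩)) hi'
  · cases h1
  · cases h1

theorem chosen_supported (hM : IsStableModel (foeD (r₀ :: P) D edb) M) {w : List C} (hw : FAtom.chosen 0 w ∈ M) :
    ∃ ν : ℕ → C, (∀ v, ν v ∈ D) ∧ w = r₀.W.map ν ∧ Holds M r₀ ν ∧ FAtom.diff 0 w ∉ M := by
  obtain ⟨_, (((⟨a, ha, rfl⟩ | ⟨i, ν, hν, hi', rfl⟩) | ⟨i, ν, hν, hi', rfl⟩) | ⟨⟨_ | i, hi⟩, ν, hν, hi', rfl⟩) |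
    ⟨i, g, hg, ν, ν', -, -, -, -, rfl⟩, h1, h2, h3⟩ := stable_supported hM hw
  · cases h1
  · cases h1
  · cases h1
  · cases h1
    exact ⟨ν, hν, rfl, ⟨h2, fun a ha => h3 a (.inr ha)⟩, h3 _ (.inl rfl)⟩
  · cases h1
  · cases h1

theorem diff_supported (hM : IsStableModel (foeD (r₀ :: P) D edb) M) {w : List C} (hw : FAtom.diff 0 w ∈ M) :
    ∃ g ∈ r₀.cgoals, ∃ ν ν' : ℕ → C, (∀ v, ν v ∈ D) ∧ (∀ v, ν' v ∈ D) ∧ (∀ v ∈ g.1, ν v = ν' v) ∧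
      (∃ v ∈ g.2, ν v ≠ ν' v) ∧ w = r₀.W.map ν ∧ FAtom.chosen 0 (r₀.W.map ν') ∈ M := by
  obtain ⟨_, (((⟨a, ha, rfl⟩ | ⟨i, ν, hν, hi', rfl⟩) | ⟨i, ν, hν, hi', rfl⟩) | ⟨i, ν, hν, hi', rfl⟩) |
    ⟨⟨_ | i, hi⟩, g, hg, ν, ν', hν, hν', h, h', rfl⟩, h1, h2, h3⟩ := stable_supported hM hw
  · cases h1
  · cases h1
  · cases h1
  · cases h1
  · cases h1
    exact ⟨g, hg, ν, ν', hν, hν', h, h', rfl, h2 rfl⟩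
  · cases h1

end

end DC

namespace DC

open Relation

section

variable {m : ℕ} (ar : Fin m → ℕ) (X : Par)

/-! ### The program -/

/-- The arities of the auxiliary predicates, which are numbered along an enumeration. -/
noncomputable def auxAr (i : Fin (Fintype.card (Pr X.M.q X.M.k))) : ℕ := prAr X ((Fintype.equivFin _).symm i)

/-- The schema of the simulating program. -/
noncomputable abbrev fullSchema : Schema := ⟨Fin m ⊕ Fin (Fintype.card (Pr X.M.q X.M.k)), Sum.elim ar (auxAr X)⟩

/-- The number of a predicate. -/
noncomputable def pn (m : ℕ) : Fin m ⊕ Pr X.M.q X.M.k → Fin m ⊕ Fin (Fintype.card (Pr X.M.q X.M.k)) :=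
  Sum.map id (Fintype.equivFin _)

theorem pn_injective : Function.Injective (pn X m) := Sum.map_injective.2 ⟨fun _ _ h => h, (Fintype.equivFin _).injective⟩

noncomputable def toAtom (a : (Fin m ⊕ Pr X.M.q X.M.k) × List (Term ℕ)) : Atom (fullSchema ar X) ℕ :=
  ⟨pn X m a.1, fun i => a.2.getD i (.const 0)⟩

noncomputable def toRule (j : Pr X.M.q X.M.k) (r : Rl m X) : CRule (fullSchema ar X) ℕ :=
  ⟨toAtom ar X (.inr j, r.hd), r.pos.map (toAtom ar X), r.neg.map (toAtom ar X), [], by simp, by simp⟩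

/-- The rule choosing successors. -/
noncomputable def succRule : CRule (fullSchema ar X) ℕ where
  head := toAtom ar X (.inr .succ, [vr 0, vr 1])
  pos := [toAtom ar X (.inr .reach, [vr 0])]
  neg := [toAtom ar X (.inr .zero, [vr 1])]
  cgoals := [([Nat.pair 0 0], [Nat.pair 1 0]), ([Nat.pair 1 0], [Nat.pair 0 0])]
  cgoals_disjoint := by simp
  cgoals_right_ne := by simp

noncomputable def otherRules : CProgram (fullSchema ar X) ℕ :=
  (Finset.univ : Finset (Pr X.M.q X.M.k)).toList.flatMap fun j => (rulesFor ar X j).map (toRule ar X j)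

/-- The simulating program. -/
noncomputable def prog : CProgram (fullSchema ar X) ℕ := succRule ar X :: otherRules ar X

variable {ar X}

theorem mem_otherRules {r : CRule (fullSchema ar X) ℕ} :
    r ∈ otherRules ar X ↔ ∃ j, ∃ r' ∈ rulesFor ar X j, toRule ar X j r' = r := by
  simp [otherRules]

theorem head_prog : ∀ r ∈ prog ar X, ∃ j, r.head.p = Sum.inr j := by
  intro r hr
  rcases List.mem_cons.1 hr with rfl | hr
  · exact ⟨_, rfl⟩
  · obtain ⟨j, r', -, rfl⟩ := mem_otherRules.1 hr
    exact ⟨_, rfl⟩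

theorem stratifiedBy_prog : ∃ σ, StratifiedBy (prog ar X) σ := by
  let σ : Fin m ⊕ Fin (Fintype.card (Pr X.M.q X.M.k)) → ℕ := fun a => stratum X (a.map id (Fintype.equivFin _).symm)
  have hσ : ∀ a : (Fin m ⊕ Pr X.M.q X.M.k) × List (Term ℕ), σ (toAtom ar X a).p = stratum X a.1 := by
    rintro ⟨a | a, l⟩ <;> simp [σ, toAtom, pn]
  refine ⟨σ, fun r hr => ?_⟩
  rcases List.mem_cons.1 hr with rfl | hr
  · refine ⟨fun a ha => ?_, fun a ha => ?_⟩
    · obtain rfl := List.mem_singleton.1 ha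
      exact ((hσ _).trans_le (by simp [stratum])).trans_eq (hσ _).symm
    · obtain rfl := List.mem_singleton.1 ha
      exact ((hσ _).trans_lt (by simp [stratum])).trans_eq (hσ _).symm
  · obtain ⟨j, r', hr', rfl⟩ := mem_otherRules.1 hr
    have := stratum_rulesFor ar X j r' hr'
    refine ⟨fun a ha => ?_, fun a ha => ?_⟩
    · obtain ⟨a, ha', rfl⟩ := List.mem_map.1 ha
      exact ((hσ _).trans_le (this.1 a ha')).trans_eq (hσ (.inr j, r'.hd)).symm
    · obtain ⟨a, ha', rfl⟩ := List.mem_map.1 ha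
      exact ((hσ _).trans_lt (this.2 a ha')).trans_eq (hσ (.inr j, r'.hd)).symm

/-! ### Solutions -/

variable (ar X) in
/-- The interpretations of the predicates by stable models. -/
structure IsSol (D : Set ℕ) (db : Set (GAtom (inSchema m ar) ℕ)) (V : Fin m ⊕ Pr X.M.q X.M.k → List ℕ → Prop) : Prop where
  closed : ∀ j, ∀ r ∈ rulesFor ar X j, ∀ ν : ℕ → ℕ, (∀ v, ν v ∈ D) → (∀ a ∈ r.pos, V a.1 (a.2.map (Term.eval ν))) →
    (∀ a ∈ r.neg, ¬ V a.1 (a.2.map (Term.eval ν))) → V (.inr j) (r.hd.map (Term.eval ν))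
  supp : ∀ j ≠ Pr.succ, ∀ l : List ℕ, l.length = prAr X j → V (.inr j) l → ∃ r ∈ rulesFor ar X j, ∃ ν : ℕ → ℕ,
    (∀ v, ν v ∈ D) ∧ l = r.hd.map (Term.eval ν) ∧ (∀ a ∈ r.pos, V a.1 (a.2.map (Term.eval ν))) ∧
    ∀ a ∈ r.neg, ¬ V a.1 (a.2.map (Term.eval ν))
  input : ∀ p l, V (.inl p) l ↔ ⟨p, fun i => l.getD i 0⟩ ∈ db
  dom : D.Finite ∧ (∀ i < m + 2, i ∈ D) ∧ ∀ a ∈ db, ∀ i, a.args i ∈ D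
  succ : ∀ x y, V (.inr .succ) [x, y] → V (.inr .reach) [x] ∧ x ∈ D ∧ y ∈ D ∧ ¬ V (.inr .zero) [y]
  succ_right : ∀ x y y', V (.inr .succ) [x, y] → V (.inr .succ) [x, y'] → y = y'
  succ_left : ∀ x x' y, V (.inr .succ) [x, y] → V (.inr .succ) [x', y] → x = x'
  succ_max : ∀ x ∈ D, ∀ y ∈ D, V (.inr .reach) [x] → ¬ V (.inr .zero) [y] →
    (∃ y', V (.inr .succ) [x, y']) ∨ ∃ x', V (.inr .succ) [x', y]
  reach : ∀ x, V (.inr .reach) [x] → ReflTransGen (fun x y => V (.inr .succ) [x, y]) 0 x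

/-- The ground atom with a given list of arguments. -/
noncomputable def toGAtom (ar : Fin m → ℕ) (X : Par) (p : Fin m ⊕ Pr X.M.q X.M.k) (l : List ℕ) : GAtom (fullSchema ar X) ℕ :=
  ⟨pn X m p, fun i => l.getD i 0⟩

theorem ground_toAtom (a : (Fin m ⊕ Pr X.M.q X.M.k) × List (Term ℕ)) (ν : ℕ → ℕ) :
    (toAtom ar X a).ground ν = toGAtom ar X a.1 (a.2.map (Term.eval ν)) := by
  refine congrArg (GAtom.mk (S := fullSchema ar X) (pn X m a.1)) (funext fun i => ?_)
  exact (List.getD_map (f := Term.eval ν) (l := a.2) (n := i) (d := .const 0)).symm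

theorem ar_pn (p : Pr X.M.q X.M.k) : (fullSchema ar X).ar (pn X m (.inr p)) = prAr X p := by
  simp [pn, auxAr]

theorem toGAtom_inj {p p' : Fin m ⊕ Pr X.M.q X.M.k} {l l' : List ℕ} (h : toGAtom ar X p l = toGAtom ar X p' l') :
    p = p' ∧ ∀ i < (fullSchema ar X).ar (pn X m p), l.getD i 0 = l'.getD i 0 := by
  obtain ⟨h1, h2⟩ := GAtom.mk.inj h
  obtain rfl := pn_injective X h1
  have h2 := eq_of_heq h2
  exact ⟨rfl, fun i hi => congrFun h2 ⟨i, hi⟩⟩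

theorem toGAtom_inr_inj {p p' : Pr X.M.q X.M.k} {l l' : List ℕ} (h : toGAtom ar X (.inr p) l = toGAtom ar X (.inr p') l')
    (hl : l.length = prAr X p) (hl' : l'.length = prAr X p') : p = p' ∧ l = l' := by
  obtain ⟨h1, h2⟩ := toGAtom_inj h
  obtain rfl := Sum.inr_injective h1
  refine ⟨rfl, List.ext_getElem (hl.trans hl'.symm) fun i hi hi' => ?_⟩
  have := h2 i (by rw [ar_pn]; omega)
  rwa [List.getD_eq_getElem _ _ hi, List.getD_eq_getElem _ _ hi'] at this

theorem length_hd (hb : X.b + 1 ≤ X.d) (j : Pr X.M.q X.M.k) : ∀ r ∈ rulesFor ar X j, r.hd.length = prAr X j := by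
  have hblk : ∀ i n, (blk i n).length = n := fun i n => by simp [blk]
  have hzs : ∀ n, (zs n).length = n := fun n => by simp [zs]
  have htwo : ∀ i j, (two X i j).length = X.d + 1 + (X.d + 1) := fun i j => by simp [two, hblk]
  cases j
  case state q =>
    intro r hr
    simp only [rulesFor, List.mem_append, List.mem_filterMap, Option.bind_eq_some_iff] at hr
    rcases hr with hr | ⟨c, -, u, -, hr⟩
    · split_ifs at hr <;> simp at hr
      subst hr; simp [prAr, hzs]
    · split_ifs at hr <;> (obtain rfl := Option.some.inj hr; exact htwo _ _)
  case cell s =>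
    intro r hr
    simp only [rulesFor, List.mem_append, List.mem_filterMap, Option.bind_eq_some_iff] at hr
    rcases hr with (((hr | hr) | hr) | ⟨c, -, u, -, hr⟩) | ⟨c, -, hr⟩
    all_goals split_ifs at hr
    all_goals simp at hr; try (subst hr; simp [prAr, hzs, hblk, htwo]; try omega)
  case ans =>
    intro r hr
    simp only [rulesFor, List.mem_filterMap] at hr
    obtain ⟨c, -, hr⟩ := hr
    split_ifs at hr; simp at hr; simp [← hr, hblk, prAr]
  all_goals simp [rulesFor, prAr, hzs, hblk, htwo]
  all_goals try omega

theorem isSol_of_stable (hb : X.b + 1 ≤ X.d) {db : Set (GAtom (inSchema m ar) ℕ)} (hdb : db.Finite)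
    {M : Set (FAtom (fullSchema ar X) ℕ)}
    (hM : IsStableModel (foeD (prog ar X) (gdom (prog ar X) {b | ∃ a ∈ db, b = embDB (arAux := auxAr X) a})
      {b | ∃ a ∈ db, b = embDB (arAux := auxAr X) a}) M) :
    IsSol ar X (gdom (prog ar X) {b | ∃ a ∈ db, b = embDB (arAux := auxAr X) a}) db
      fun p l => FAtom.base (toGAtom ar X p l) ∈ M := by
  have hembed : ∀ a ∈ db, embDB (arAux := auxAr X) a = toGAtom ar X (.inl a.p) (List.ofFn a.args) := fun a _ => by
    refine congrArg (GAtom.mk (S := fullSchema ar X) (Sum.inl a.p)) (funext fun i => ?_)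
    exact (by simp : (List.ofFn a.args).getD i 0 = a.args i).symm
  have hdomc : ∀ i < m + 2, i ∈ gdom (prog ar X) {b | ∃ a ∈ db, b = embDB (arAux := auxAr X) a} := by
    intro i hi
    refine .inr ⟨toRule ar X .dom ⟨[.const i], [], []⟩, List.mem_cons_of_mem _ (mem_otherRules.2 ⟨.dom, _, ?_, rfl⟩),
      .inl ⟨⟨0, ?_⟩, ?_⟩⟩
    · simpa [rulesFor] using hi
    · change 0 < (fullSchema ar X).ar (pn X m (.inr .dom))
      rw [ar_pn]; exact Nat.one_pos
    · rfl
  have hfin : (gdom (prog ar X) {b | ∃ a ∈ db, b = embDB (arAux := auxAr X) a}).Finite := by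
    refine .union ?_ (consts_finite _)
    have : activeDom {b | ∃ a ∈ db, b = embDB (arAux := auxAr X) a} ⊆ ⋃ a ∈ db, Set.range a.args := by
      rintro c ⟨_, ⟨a, ha, rfl⟩, i, rfl⟩
      exact Set.mem_biUnion ha ⟨i, rfl⟩
    exact (hdb.biUnion fun a _ => Set.finite_range _).subset this
  have hact : ∀ a ∈ db, ∀ i, a.args i ∈ gdom (prog ar X) {b | ∃ a ∈ db, b = embDB (arAux := auxAr X) a} :=
    fun a ha i => .inl ⟨_, ⟨a, ha, rfl⟩, i, rfl⟩
  have hedb : ∀ j l, toGAtom ar X (.inr j) l ∉ {b | ∃ a ∈ db, b = embDB (arAux := auxAr X) a} := by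
    rintro j l ⟨a, ha, h⟩
    rw [hembed a ha] at h
    cases (toGAtom_inj h).1
  generalize gdom (prog ar X) {b | ∃ a ∈ db, b = embDB (arAux := auxAr X) a} = D at *
  have hP : ∀ r ∈ otherRules ar X, r.cgoals = [] := fun r hr => by
    obtain ⟨j, r', -, rfl⟩ := mem_otherRules.1 hr
    rfl
  have h0 : (succRule ar X).cgoals ≠ [] := by simp [succRule]
  have hholds : ∀ j r (ν : ℕ → ℕ), Holds M (toRule ar X j r) ν ↔
      (∀ a ∈ r.pos, FAtom.base (toGAtom ar X a.1 (a.2.map (Term.eval ν))) ∈ M) ∧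
      ∀ a ∈ r.neg, FAtom.base (toGAtom ar X a.1 (a.2.map (Term.eval ν))) ∉ M := by
    intro j r ν
    refine and_congr ⟨fun h a ha => ?_, ?_⟩ ⟨fun h a ha => ?_, ?_⟩
    · exact h ⟨_, List.mem_map_of_mem ha, congrArg FAtom.base (ground_toAtom a ν).symm⟩
    · rintro h _ ⟨_, ha, rfl⟩
      obtain ⟨a, ha', rfl⟩ := List.mem_map.1 ha
      rw [ground_toAtom]; exact h a ha'
    · exact h _ ⟨_, List.mem_map_of_mem ha, congrArg FAtom.base (ground_toAtom a ν).symm⟩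
    · rintro h _ ⟨_, ha, rfl⟩
      obtain ⟨a, ha', rfl⟩ := List.mem_map.1 ha
      rw [ground_toAtom]; exact h a ha'
  have hholds₀ : ∀ ν : ℕ → ℕ, Holds M (succRule ar X) ν ↔
      FAtom.base (toGAtom ar X (.inr .reach) [ν (Nat.pair 0 0)]) ∈ M ∧
      FAtom.base (toGAtom ar X (.inr .zero) [ν (Nat.pair 1 0)]) ∉ M := by
    intro ν
    have e1 : (toAtom ar X (.inr .reach, [vr 0])).ground ν = toGAtom ar X (.inr .reach) [ν (Nat.pair 0 0)] := ground_toAtom _ _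
    have e2 : (toAtom ar X (.inr .zero, [vr 1])).ground ν = toGAtom ar X (.inr .zero) [ν (Nat.pair 1 0)] := ground_toAtom _ _
    rw [← e1, ← e2]
    refine and_congr ⟨fun h => h ⟨_, List.mem_singleton_self _, rfl⟩, ?_⟩ ⟨fun h => h _ ⟨_, List.mem_singleton_self _, rfl⟩, ?_⟩
    · rintro h _ ⟨_, ha, rfl⟩
      obtain rfl := List.mem_singleton.1 ha
      exact h
    · rintro h _ ⟨_, ha, rfl⟩
      obtain rfl := List.mem_singleton.1 ha
      exact h
  have hhead₀ : ∀ ν : ℕ → ℕ, (succRule ar X).head.ground ν = toGAtom ar X (.inr .succ) [ν (Nat.pair 0 0), ν (Nat.pair 1 0)] :=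
    fun ν => ground_toAtom _ _
  have hhead : ∀ j r (ν : ℕ → ℕ), (toRule ar X j r).head.ground ν = toGAtom ar X (.inr j) (r.hd.map (Term.eval ν)) :=
    fun j r ν => ground_toAtom _ _
  have hW0 : Nat.pair 0 0 ∈ (succRule ar X).W := by simp [CRule.W, succRule]
  have hW1 : Nat.pair 1 0 ∈ (succRule ar X).W := by simp [CRule.W, succRule]
  have hW : ∀ ν ν' : ℕ → ℕ, (succRule ar X).W.map ν = (succRule ar X).W.map ν' →
      ν (Nat.pair 0 0) = ν' (Nat.pair 0 0) ∧ ν (Nat.pair 1 0) = ν' (Nat.pair 1 0) := fun ν ν' h => by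
    rw [List.map_inj_left] at h
    exact ⟨h _ hW0, h _ hW1⟩
  have hchosen : ∀ ν : ℕ → ℕ, FAtom.chosen 0 ((succRule ar X).W.map ν) ∈ M →
      Holds M (succRule ar X) ν ∧ FAtom.diff 0 ((succRule ar X).W.map ν) ∉ M := fun ν h => by
    obtain ⟨ν', hν', e, h1, h2⟩ := chosen_supported hM h
    refine ⟨?_, h2⟩
    rw [hholds₀] at h1 ⊢
    rwa [(hW _ _ e).1, (hW _ _ e).2]
  have hsucc : ∀ x y, FAtom.base (toGAtom ar X (.inr .succ) [x, y]) ∈ M → ∃ ν : ℕ → ℕ, (∀ v, ν v ∈ D) ∧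
      x = ν (Nat.pair 0 0) ∧ y = ν (Nat.pair 1 0) ∧ Holds M (succRule ar X) ν ∧
      FAtom.chosen 0 ((succRule ar X).W.map ν) ∈ M := by
    intro x y h
    rcases base_supported hM hP h0 h with h | ⟨r, hr, ν, hν, e, h⟩ | ⟨ν, hν, e, h, hc⟩
    · exact absurd h (hedb _ _)
    · obtain ⟨j, r', hr', rfl⟩ := mem_otherRules.1 hr
      rw [hhead] at e
      cases (toGAtom_inj e).1
      cases hr'
    · rw [hhead₀] at e
      obtain ⟨-, e⟩ := toGAtom_inr_inj e rfl rfl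
      simp only [List.cons.injEq, and_true] at e
      exact ⟨ν, hν, e.1, e.2, h, hc⟩
  have hmem : ∀ {g : List ℕ × List ℕ}, g ∈ (succRule ar X).cgoals ↔
      g = ([Nat.pair 0 0], [Nat.pair 1 0]) ∨ g = ([Nat.pair 1 0], [Nat.pair 0 0]) := by simp [succRule]
  refine ⟨?_, ?_, ?_, ⟨hfin, hdomc, hact⟩, ?_, ?_, ?_, ?_, ?_⟩
  · intro j r hr ν hν h1 h2
    rw [← hhead]
    exact base_of_holds hM (mem_otherRules.2 ⟨j, r, hr, rfl⟩) rfl hν ((hholds _ _ _).2 ⟨h1, h2⟩)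
  · intro j hj l hl h
    rcases base_supported hM hP h0 h with h | ⟨r, hr, ν, hν, e, h⟩ | ⟨ν, hν, e, h, hc⟩
    · exact absurd h (hedb _ _)
    · obtain ⟨j, r', hr', rfl⟩ := mem_otherRules.1 hr
      rw [hhead] at e
      obtain ⟨e1, -⟩ := toGAtom_inj e
      obtain rfl := Sum.inr_injective e1
      obtain ⟨-, e⟩ := toGAtom_inr_inj e hl (by rw [List.length_map]; exact length_hd hb _ _ hr')
      exact ⟨r', hr', ν, hν, e, (hholds _ _ _).1 h⟩
    · rw [hhead₀] at e
      exact absurd (Sum.inr_injective (toGAtom_inj e).1) hj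
  · intro p l
    constructor
    · intro h
      rcases base_supported hM hP h0 h with ⟨a, ha, e⟩ | ⟨r, hr, ν, hν, e, h⟩ | ⟨ν, hν, e, h, hc⟩
      · rw [hembed a ha] at e
        obtain ⟨e1, e2⟩ := toGAtom_inj e
        obtain rfl := Sum.inl_injective e1
        have : (⟨a.p, fun i => l.getD i 0⟩ : GAtom (inSchema m ar) ℕ) = a := by
          refine congrArg (GAtom.mk (S := inSchema m ar) a.p) (funext fun i => ?_)
          rw [e2 i i.2]
          simp
        rwa [this]
      · obtain ⟨j, r', hr', rfl⟩ := mem_otherRules.1 hr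
        rw [hhead] at e
        cases (toGAtom_inj e).1
      · rw [hhead₀] at e
        cases (toGAtom_inj e).1
    · exact fun h => base_of_edb hM ⟨_, h, rfl⟩
  · intro x y h
    obtain ⟨ν, hν, rfl, rfl, h, -⟩ := hsucc x y h
    exact ⟨((hholds₀ ν).1 h).1, hν _, hν _, ((hholds₀ ν).1 h).2⟩
  · intro x y y' h h'
    obtain ⟨ν, hν, rfl, rfl, -, hc⟩ := hsucc x y h
    obtain ⟨ν', hν', e, rfl, -, hc'⟩ := hsucc _ y' h'
    by_contra hne
    exact (hchosen ν hc).2 (diff_of_chosen hM (hmem.2 (.inl rfl)) hν hν' (by simpa using e) (by simpa using hne) hc')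
  · intro x x' y h h'
    obtain ⟨ν, hν, rfl, rfl, -, hc⟩ := hsucc x y h
    obtain ⟨ν', hν', rfl, e, -, hc'⟩ := hsucc x' _ h'
    by_contra hne
    exact (hchosen ν hc).2 (diff_of_chosen hM (hmem.2 (.inr rfl)) hν hν' (by simpa using e) (by simpa using hne) hc')
  · intro x hx y hy h1 h2
    let ν : ℕ → ℕ := fun v => if v = Nat.pair 0 0 then x else y
    have hν : ∀ v, ν v ∈ D := fun v => by simp only [ν]; split_ifs <;> assumption
    have e0 : ν (Nat.pair 0 0) = x := if_pos rfl
    have e1 : ν (Nat.pair 1 0) = y := if_neg (by simp)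
    have hh : Holds M (succRule ar X) ν := by rw [hholds₀, e0, e1]; exact ⟨h1, h2⟩
    by_cases hd : FAtom.diff 0 ((succRule ar X).W.map ν) ∈ M
    · obtain ⟨g, hg, ν₁, ν₂, -, hν₂, a1, -, e, hc⟩ := diff_supported hM hd
      have := base_of_chosen hM h0 hν₂ (hchosen ν₂ hc).1 hc
      rw [hhead₀] at this
      have e' := hW _ _ e
      rcases hmem.1 hg with rfl | rfl
      · left
        rw [← a1 _ (List.mem_singleton_self _), ← e'.1, e0] at this
        exact ⟨_, this⟩
      · right
        rw [← a1 _ (List.mem_singleton_self _), ← e'.2, e1] at this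
        exact ⟨_, this⟩
    · have := base_of_chosen hM h0 hν hh (chosen_of_holds hM h0 hν hh hd)
      rw [hhead₀, e0, e1] at this
      exact .inl ⟨_, this⟩
  · intro x hx
    refine (stable_induction hM {a | (∀ x, a = FAtom.base (toGAtom ar X (.inr .reach) [x]) →
      ReflTransGen (fun x y => FAtom.base (toGAtom ar X (.inr .succ) [x, y]) ∈ M) 0 x) ∧
      ∀ x y, a = FAtom.base (toGAtom ar X (.inr .succ) [x, y]) →
      ReflTransGen (fun x y => FAtom.base (toGAtom ar X (.inr .succ) [x, y]) ∈ M) 0 x} ?_ hx).1 x rfl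
    rintro _ ((((⟨a, ha, rfl⟩ | ⟨⟨_ | i, hi⟩, ν, hν, hi', rfl⟩) | ⟨⟨_ | i, hi⟩, ν, hν, hi', rfl⟩) | ⟨i, ν, hν, hi, rfl⟩) |
      ⟨i, g, hg, ν, ν', -, -, -, -, rfl⟩) h1 h2 h3
    · refine ⟨fun x e => ?_, fun x y e => ?_⟩ <;>
      · obtain rfl := FAtom.base.inj e
        exact absurd ha (hedb _ _)
    · exact absurd hi' h0
    · obtain ⟨j, r', hr', hr⟩ := mem_otherRules.1 (List.get_mem (otherRules ar X) ⟨i, Nat.lt_of_succ_lt_succ hi⟩)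
      change posBody ((otherRules ar X).get ⟨i, Nat.lt_of_succ_lt_succ hi⟩) ν ⊆ M at h1
      change ∀ a ∈ negBody ((otherRules ar X).get ⟨i, Nat.lt_of_succ_lt_succ hi⟩) ν, a ∉ M at h2
      change posBody ((otherRules ar X).get ⟨i, Nat.lt_of_succ_lt_succ hi⟩) ν ⊆ _ at h3
      refine ⟨fun x e => ?_, fun x y e => ?_⟩
      · change FAtom.base (((otherRules ar X).get ⟨i, Nat.lt_of_succ_lt_succ hi⟩).head.ground ν) = _ at e
        rw [← hr] at e h1 h2 h3
        rw [hhead] at e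
        have e := FAtom.base.inj e
        obtain rfl := Sum.inr_injective (toGAtom_inj e).1
        obtain ⟨-, e⟩ := toGAtom_inr_inj e (by rw [List.length_map]; exact length_hd hb _ _ hr') rfl
        rcases List.mem_cons.1 hr' with rfl | hr'
        · simp only [List.map_cons, List.map_nil, Term.eval, List.cons.injEq, and_true] at e
          subst e
          exact .refl
        · obtain rfl := List.mem_singleton.1 hr'
          simp only [List.map_cons, List.map_nil, Term.eval, vr, List.cons.injEq, and_true] at e
          subst e
          have hs := h3 ⟨_, List.mem_map_of_mem (List.mem_singleton_self _), rfl⟩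
          rw [ground_toAtom] at hs
          exact (hs.2 _ _ rfl).tail (((hholds _ _ _).1 ⟨h1, h2⟩).1 _ (List.mem_singleton_self _))
      · change FAtom.base (((otherRules ar X).get ⟨i, Nat.lt_of_succ_lt_succ hi⟩).head.ground ν) = _ at e
        rw [← hr, hhead] at e
        obtain rfl := Sum.inr_injective (toGAtom_inj (FAtom.base.inj e)).1
        cases hr'
    · refine ⟨fun x e => ?_, fun x y e => ?_⟩
      · change FAtom.base ((succRule ar X).head.ground ν) = _ at e
        rw [hhead₀] at e
        cases (toGAtom_inj (FAtom.base.inj e)).1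
      · change FAtom.base ((succRule ar X).head.ground ν) = _ at e
        rw [hhead₀] at e
        obtain ⟨-, e⟩ := toGAtom_inr_inj (FAtom.base.inj e) rfl rfl
        simp only [List.cons.injEq, and_true] at e
        rw [← e.1]
        have := h3 (.inr ⟨_, List.mem_singleton_self _, rfl⟩)
        rw [ground_toAtom] at this
        exact this.1 _ rfl
    · exact absurd (hP _ (List.get_mem (otherRules ar X) ⟨i, Nat.lt_of_succ_lt_succ hi⟩)) hi'
    · exact ⟨nofun, nofun⟩
    · exact ⟨nofun, nofun⟩

end

end DC

namespace DC

open Relation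

variable {m : ℕ} {ar : Fin m → ℕ} {X : Par} {D : Set ℕ} {db : Set (GAtom (inSchema m ar) ℕ)}
  {V : Fin m ⊕ Pr X.M.q X.M.k → List ℕ → Prop}

/-! ### The order of the domain -/

/-- The values of the variables of a block. -/
def ev (ν : ℕ → ℕ) (i n : ℕ) : List ℕ := (List.range n).map fun j => ν (Nat.pair i j)

theorem map_blk (ν : ℕ → ℕ) (i n : ℕ) : (blk i n).map (Term.eval ν) = ev ν i n := by
  simp [blk, ev, Term.eval, Function.comp_def]

theorem map_zs (ν : ℕ → ℕ) (n : ℕ) : (zs n).map (Term.eval ν) = List.replicate n 0 := by simp [zs, Term.eval]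

theorem eval_vr (ν : ℕ → ℕ) (i : ℕ) : (vr i).eval ν = ν (Nat.pair i 0) := rfl

theorem map_two (ν : ℕ → ℕ) (i j : ℕ) : (two X i j).map (Term.eval ν) = ev ν i (X.d + 1) ++ ev ν j (X.d + 1) := by
  simp [two, map_blk]

theorem length_ev (ν : ℕ → ℕ) (i n : ℕ) : (ev ν i n).length = n := by simp [ev]

/-- The valuation giving the variables of each block the entries of a list. -/
def ofBlocks (B : ℕ → List ℕ) (v : ℕ) : ℕ := (B v.unpair.1).getD v.unpair.2 0

theorem ev_ofBlocks {B : ℕ → List ℕ} {i n : ℕ} (h : (B i).length = n) : ev (ofBlocks B) i n = B i := by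
  subst h
  refine List.ext_getElem (length_ev _ _ _) fun j hj hj' => ?_
  simp [ev, ofBlocks, hj']

theorem ofBlocks_pair (B : ℕ → List ℕ) (i j : ℕ) : ofBlocks B (Nat.pair i j) = (B i).getD j 0 := by simp [ofBlocks]

theorem IsSol.zero_mem (h : IsSol ar X D db V) : 0 ∈ D := h.dom.2.1 0 (by omega)

theorem IsSol.zero_iff (h : IsSol ar X D db V) (y : ℕ) : V (.inr .zero) [y] ↔ y = 0 := by
  constructor
  · intro hy
    obtain ⟨r, hr, ν, -, e, -⟩ := h.supp .zero (by simp) [y] rfl hy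
    obtain rfl := List.mem_singleton.1 hr
    simpa [Term.eval] using e
  · rintro rfl
    exact h.closed .zero _ (List.mem_singleton_self _) (fun _ => 0) (fun _ => h.zero_mem) (by simp) (by simp)

/-- A valuation by blocks with entries in the domain has values in the domain. -/
theorem IsSol.ofBlocks_mem (h : IsSol ar X D db V) {B : ℕ → List ℕ} (hB : ∀ i, ∀ x ∈ B i, x ∈ D) (v : ℕ) : ofBlocks B v ∈ D := by
  rw [ofBlocks]
  by_cases hv : v.unpair.2 < (B v.unpair.1).length
  · rw [List.getD_eq_getElem _ _ hv]
    exact hB _ _ (List.getElem_mem hv)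
  · rw [List.getD_eq_default _ _ (not_lt.1 hv)]
    exact h.zero_mem

theorem IsSol.reach_iff (h : IsSol ar X D db V) (x : ℕ) :
    V (.inr .reach) [x] ↔ ReflTransGen (fun x y => V (.inr .succ) [x, y]) 0 x := by
  refine ⟨h.reach x, fun hx => ?_⟩
  cases hx with
  | refl =>
    exact h.closed .reach _ (List.mem_cons_self) (fun _ => 0) (fun _ => h.zero_mem) (by simp) (by simp)
  | @tail y _ hy hxy =>
    have hs := h.succ _ _ hxy
    have := h.closed .reach _ (List.mem_cons_of_mem _ (List.mem_singleton_self _))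
      (ofBlocks fun i => if i = 0 then [y] else [x]) (h.ofBlocks_mem fun i z hz => by
        split_ifs at hz <;> obtain rfl := List.mem_singleton.1 hz
        exacts [hs.2.1, hs.2.2.1]) (by simpa [eval_vr, ofBlocks_pair] using hxy) (by simp)
    simpa [eval_vr, ofBlocks_pair] using this

/-- A choice of successors orders the domain. -/
theorem IsSol.exists_order (h : IsSol ar X D db V) : ∃ (els : List ℕ) (rk : ℕ → ℕ),
    els.map rk = List.range els.length ∧ rk 0 = 0 ∧ m + 2 ≤ els.length ∧ (∀ x, x ∈ D ↔ x ∈ els) ∧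
    ∀ x y, V (.inr .succ) [x, y] ↔ x ∈ els ∧ y ∈ els ∧ rk y = rk x + 1 := by
  obtain ⟨els, rk, h1, h2, h3, h4⟩ := exists_enum h.dom.1 h.zero_mem (s := fun x y => V (.inr .succ) [x, y])
    (fun x y hxy => ⟨(h.reach_iff x).1 (h.succ x y hxy).1, (h.succ x y hxy).2.1, (h.succ x y hxy).2.2.1,
      fun e => (h.succ x y hxy).2.2.2 ((h.zero_iff y).2 e)⟩)
    h.succ_right h.succ_left (fun x hx y hy hr hy0 => h.succ_max x hx y hy ((h.reach_iff x).2 hr) (mt (h.zero_iff y).1 hy0))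
  refine ⟨els, rk, h1, h2, ?_, h3, h4⟩
  have : List.range (m + 2) ⊆ els := fun x hx => (h3 x).1 (h.dom.2.1 x (List.mem_range.1 hx))
  simpa using (List.nodup_range.subperm this).length_le

/-- The domain is ordered by the successor relation. -/
structure Ordered (D : Set ℕ) (V : Fin m ⊕ Pr X.M.q X.M.k → List ℕ → Prop) (els : List ℕ) (rk : ℕ → ℕ) (N : ℕ) : Prop where
  map : els.map rk = List.range N
  zero : rk 0 = 0
  card : m + 2 ≤ N
  mem : ∀ x, x ∈ D ↔ x ∈ els
  succ : ∀ x y, V (.inr .succ) [x, y] ↔ x ∈ els ∧ y ∈ els ∧ rk y = rk x + 1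

variable {els : List ℕ} {rk : ℕ → ℕ} {N : ℕ}

theorem ev_mem (hO : Ordered D V els rk N) {ν : ℕ → ℕ} (hν : ∀ v, ν v ∈ D) (i n : ℕ) : ev ν i n ∈ envs els n := by
  refine mem_envs.2 ⟨length_ev _ _ _, fun x hx => ?_⟩
  obtain ⟨j, -, rfl⟩ := List.mem_map.1 hx
  exact (hO.mem _).1 (hν _)

theorem zero_mem_els (h : IsSol ar X D db V) (hO : Ordered D V els rk N) : 0 ∈ els := (hO.mem 0).1 h.zero_mem

theorem replicate_mem {x n : ℕ} (hx : x ∈ els) : List.replicate n x ∈ envs els n :=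
  mem_envs.2 ⟨List.length_replicate, fun y hy => by rwa [List.eq_of_mem_replicate hy]⟩

theorem append_mem {l l' : List ℕ} {a b : ℕ} (h : l ∈ envs els a) (h' : l' ∈ envs els b) : l ++ l' ∈ envs els (a + b) := by
  rw [mem_envs] at *
  refine ⟨by simp [h.1, h'.1], fun x hx => ?_⟩
  rcases List.mem_append.1 hx with hx | hx
  exacts [h.2 x hx, h'.2 x hx]

theorem cons_mem {x : ℕ} {l : List ℕ} {a : ℕ} (hx : x ∈ els) (h : l ∈ envs els a) : x :: l ∈ envs els (a + 1) := by
  rw [mem_envs] at *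
  exact ⟨by simp [h.1], List.forall_mem_cons.2 ⟨hx, h.2⟩⟩

theorem last_iff (h : IsSol ar X D db V) (hO : Ordered D V els rk N) {x : ℕ} (hx : x ∈ els) :
    V (.inr .last) [x] ↔ rk x + 1 = N := by
  have hS : V (.inr .hasSucc) [x] ↔ ∃ y, V (.inr .succ) [x, y] := by
    constructor
    · intro hy
      obtain ⟨r, hr, ν, -, e, h1, -⟩ := h.supp .hasSucc (by simp) [x] rfl hy
      obtain rfl := List.mem_singleton.1 hr
      simp only [List.map_cons, List.map_nil, List.cons.injEq, and_true] at e
      subst e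
      exact ⟨_, h1 _ (List.mem_singleton_self _)⟩
    · rintro ⟨y, hxy⟩
      have hs := h.succ _ _ hxy
      have := h.closed .hasSucc _ (List.mem_singleton_self _)
        (ofBlocks fun i => if i = 0 then [x] else [y]) (h.ofBlocks_mem fun i z hz => by
          split_ifs at hz <;> obtain rfl := List.mem_singleton.1 hz
          exacts [hs.2.1, hs.2.2.1]) (by simpa [eval_vr, ofBlocks_pair] using hxy) (by simp)
      simpa [eval_vr, ofBlocks_pair] using this
  have hL : V (.inr .last) [x] ↔ ¬ V (.inr .hasSucc) [x] := by
    constructor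
    · intro hy
      obtain ⟨r, hr, ν, -, e, -, h1⟩ := h.supp .last (by simp) [x] rfl hy
      obtain rfl := List.mem_singleton.1 hr
      simp only [List.map_cons, List.map_nil, List.cons.injEq, and_true] at e
      subst e
      exact h1 _ (List.mem_singleton_self _)
    · intro hn
      exact h.closed .last _ (List.mem_singleton_self _) (fun _ => x) (fun _ => (hO.mem x).2 hx) (by simp)
        (by simpa [Term.eval, vr] using hn)
  rw [hL, hS]
  constructor
  · intro hn
    by_contra hne
    obtain ⟨y, hy, e⟩ := exists_rk hO.map (i := rk x + 1) (by have := rk_lt hO.map hx; omega)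
    exact hn ⟨y, (hO.succ _ _).2 ⟨hx, hy, e⟩⟩
  · rintro hn ⟨y, hy⟩
    obtain ⟨-, hy, e⟩ := (hO.succ _ _).1 hy
    have := rk_lt hO.map hy
    omega

theorem next_iff (h : IsSol ar X D db V) (hO : Ordered D V els rk N) {l l' : List ℕ} (hl : l ∈ envs els (X.d + 1))
    (hl' : l' ∈ envs els (X.d + 1)) : V (.inr .next) (l ++ l') ↔ pos rk N l' = pos rk N l + 1 := by
  constructor
  · intro hy
    obtain ⟨r, hr, ν, hν, e, h1, -⟩ := h.supp .next (by simp) (l ++ l') (by simp [(mem_envs.1 hl).1, (mem_envs.1 hl').1, prAr]) hy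
    obtain ⟨i, hi, rfl⟩ := List.mem_map.1 hr
    have hi := List.mem_range.1 hi
    simp only [List.map_append, List.map_cons, map_blk, map_zs, eval_vr, List.map_replicate] at e
    obtain ⟨rfl, rfl⟩ := List.append_inj e (by simp [(mem_envs.1 hl).1, length_ev]; omega)
    have hs := (hO.succ _ _).1 (h1 _ List.mem_cons_self)
    have hw := (last_iff h hO ((hO.mem _).1 (hν _))).1 (h1 _ (List.mem_cons_of_mem _ (List.mem_singleton_self _)))
    rw [pos_append, pos_append]
    simp only [pos, pos_replicate_zero hO.zero, List.length_cons, List.length_replicate, eval_vr] at hs ⊢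
    have := pos_replicate_last hw (X.d - i)
    rw [hs.2.2]
    ring_nf at this ⊢
    omega
  · intro hp
    obtain ⟨w, hw, ew⟩ := exists_rk hO.map (i := N - 1) (by have := hO.card; omega)
    have hlen := (mem_envs.1 hl).1
    rcases eq_replicate_or_split w l with e | ⟨l₁, x, j, hx, rfl⟩
    · exfalso
      rw [hlen] at e
      have h1 := pos_replicate_last (rk := rk) (N := N) (w := w) (by have := hO.card; omega) (X.d + 1)
      have h2 := pos_lt hO.map hl'
      rw [← e] at h1
      omega
    · have hmem := (mem_envs.1 hl).2
      have hxe : x ∈ els := hmem x (by simp)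
      have hxN : rk x < N - 1 := by
        have := rk_lt hO.map hxe
        have : rk x ≠ N - 1 := fun e => hx (rk_inj hO.map hxe hw (e.trans ew.symm))
        omega
      obtain ⟨y, hy, ey⟩ := exists_rk hO.map (i := rk x + 1) (by omega)
      simp only [List.length_append, List.length_cons, List.length_replicate] at hlen
      have h0 := zero_mem_els h hO
      have hl₁ : l₁ ∈ envs els l₁.length := mem_envs.2 ⟨rfl, fun z hz => hmem z (by simp [hz])⟩
      have hl'' : l₁ ++ y :: List.replicate j 0 ∈ envs els (X.d + 1) := by
        rw [← hlen]
        exact append_mem hl₁ (cons_mem hy (replicate_mem h0))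
      obtain rfl : l' = l₁ ++ y :: List.replicate j 0 := by
        refine pos_inj hO.map hl' hl'' (hp.trans ?_)
        rw [pos_append, pos_append]
        simp only [pos, pos_replicate_zero hO.zero, List.length_cons, List.length_replicate]
        have := pos_replicate_last (rk := rk) (N := N) (w := w) (by omega) j
        rw [ey]
        ring_nf at this ⊢
        omega
      have := h.closed .next _ (List.mem_map_of_mem (a := l₁.length) (List.mem_range.2 (by omega)))
        (ofBlocks fun i => if i = 0 then l₁ else if i = 1 then [x] else if i = 2 then [w] else [y])
        (h.ofBlocks_mem fun i z hz => by
          rw [hO.mem]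
          split_ifs at hz
          · exact (mem_envs.1 hl₁).2 z hz
          all_goals obtain rfl := List.mem_singleton.1 hz; assumption) ?_ (by simp)
      · have e : X.d - l₁.length = j := by omega
        simpa [map_blk, map_zs, eval_vr, ofBlocks_pair, ev_ofBlocks, e] using this
      · simp only [List.mem_cons, List.not_mem_nil, or_false, forall_eq_or_imp, forall_eq]
        refine ⟨?_, ?_⟩
        · simpa [eval_vr, ofBlocks_pair] using (hO.succ x y).2 ⟨hxe, hy, ey⟩
        · simpa [eval_vr, ofBlocks_pair] using (last_iff h hO hw).2 (by omega)

theorem eq_iff (h : IsSol ar X D db V) (hO : Ordered D V els rk N) {l l' : List ℕ} (hl : l ∈ envs els (X.d + 1))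
    (hl' : l' ∈ envs els (X.d + 1)) : V (.inr .eq) (l ++ l') ↔ l = l' := by
  constructor
  · intro hy
    obtain ⟨r, hr, ν, hν, e, -⟩ := h.supp .eq (by simp) (l ++ l') (by simp [(mem_envs.1 hl).1, (mem_envs.1 hl').1, prAr]) hy
    obtain rfl := List.mem_singleton.1 hr
    simp only [map_two] at e
    obtain ⟨rfl, rfl⟩ := List.append_inj e (by simp [(mem_envs.1 hl).1, length_ev])
    rfl
  · rintro rfl
    have := h.closed .eq _ (List.mem_singleton_self _) (ofBlocks fun _ => l)
        (h.ofBlocks_mem fun i z hz => (hO.mem _).2 ((mem_envs.1 hl).2 z hz)) (by simp) (by simp)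
    simpa [map_two, ev_ofBlocks, (mem_envs.1 hl).1] using this

end DC

namespace DC

variable {m : ℕ} {ar : Fin m → ℕ} {X : Par} {D : Set ℕ} {db : Set (GAtom (inSchema m ar) ℕ)}
  {V : Fin m ⊕ Pr X.M.q X.M.k → List ℕ → Prop} {els : List ℕ} {rk : ℕ → ℕ} {N : ℕ}

/-! ### The input tape -/

theorem bit_iff (h : IsSol ar X D db V) (hO : Ordered D V els rk N) (har : ∀ p, ar p ≤ X.b) {x : ℕ} {l : List ℕ}
    (hx : x ∈ els) (hl : l ∈ envs els X.b) : V (.inr .bit) (x :: l) ↔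
      (∃ y, x :: l = List.replicate X.b 0 ++ [y]) ∨ ∃ p : Fin m, rk x = p + 1 ∧ ⟨p, fun i => l.getD i 0⟩ ∈ db := by
  have htake : ∀ p : Fin m, (⟨p, fun i => (l.take (ar p)).getD i 0⟩ : GAtom (inSchema m ar) ℕ) = ⟨p, fun i => l.getD i 0⟩ := by
    intro p
    refine congrArg (GAtom.mk (S := inSchema m ar) p) (funext fun i => ?_)
    have hi : (i : ℕ) < ar p := i.2
    simp [List.getD_eq_getElem?_getD, hi]
  have hev : ∀ (ν : ℕ → ℕ) (p : Fin m), ev ν 1 X.b = l → ev ν 1 (ar p) = l.take (ar p) := by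
    rintro ν p rfl
    rw [ev, ev, ← List.map_take, List.take_range, min_eq_left (har p)]
  constructor
  · intro hy
    obtain ⟨r, hr, ν, hν, e, h1, -⟩ := h.supp .bit (by simp) (x :: l) (by simp [(mem_envs.1 hl).1, prAr]) hy
    rcases List.mem_cons.1 hr with rfl | hr
    · left
      exact ⟨_, by rw [e, List.map_append, map_zs]; rfl⟩
    · right
      obtain ⟨p, -, rfl⟩ := List.mem_map.1 hr
      simp only [List.map_cons, map_blk, List.cons.injEq] at e
      refine ⟨p, ?_, ?_⟩
      · have hc : ∀ i ≤ (p : ℕ) + 1, rk (Term.eval ν (chain i)) = i := by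
          intro i
          induction i with
          | zero => exact fun _ => hO.zero
          | succ i ih =>
            intro hi
            have := h1 (.inr .succ, [chain i, chain (i + 1)])
              (List.mem_cons_of_mem _ (List.mem_map_of_mem (f := fun i => (Sum.inr Pr.succ, [chain i, chain (i + 1)])) (List.mem_range.2 hi)))
            rw [((hO.succ _ _).1 this).2.2, ih (by omega)]
        rw [e.1, hc _ le_rfl]
      · have := h1 _ List.mem_cons_self
        rw [h.input, map_blk, hev ν p e.2.symm, htake] at this
        exact this
  · rintro (⟨y, e⟩ | ⟨p, hp, hdb⟩)
    · have hy : y ∈ D := by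
        have : y ∈ x :: l := by rw [e]; simp
        rw [hO.mem]
        exact (mem_envs.1 (cons_mem hx hl)).2 y this
      have := h.closed .bit _ List.mem_cons_self (fun _ => y) (fun _ => hy) (by simp) (by simp)
      rw [List.map_append, map_zs] at this
      rw [e]
      exact this
    · have hN : (p : ℕ) + 1 < N := by have := hO.card; omega
      have hex : ∀ i, ∃ y ∈ els, i < N → rk y = i := fun i => by
        by_cases hi : i < N
        · obtain ⟨y, hy, e⟩ := exists_rk hO.map hi
          exact ⟨y, hy, fun _ => e⟩
        · exact ⟨x, hx, fun hi' => absurd hi' hi⟩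
      choose el hel hrk using hex
      let B : ℕ → List ℕ := fun i => if i = 1 then l else (List.range N).map el
      have hB2 : ∀ i ≤ (p : ℕ) + 1, Term.eval (ofBlocks B) (chain i) = el i := by
        rintro (_ | i) hi
        · exact rk_inj hO.map (zero_mem_els h hO) (hel 0) (hO.zero.trans (hrk 0 (by omega)).symm)
        · have : i + 1 < N := by omega
          simp [chain, Term.eval, ofBlocks_pair, B, this]
      have hB1 : ev (ofBlocks B) 1 X.b = l := ev_ofBlocks (B := B) (i := 1) (mem_envs.1 hl).1
      have := h.closed .bit _ (List.mem_cons_of_mem _ (List.mem_map_of_mem (List.mem_finRange p))) (ofBlocks B)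
        (h.ofBlocks_mem fun i z hz => by
          rw [hO.mem]
          simp only [B] at hz
          split_ifs at hz
          · exact (mem_envs.1 hl).2 z hz
          · obtain ⟨j, -, rfl⟩ := List.mem_map.1 hz
            exact hel j) (fun a ha => ?_) (by simp)
      · rw [List.map_cons, map_blk, hB1, hB2 _ le_rfl] at this
        rwa [rk_inj hO.map hx (hel _) (hp.trans (hrk _ hN).symm)]
      · rcases List.mem_cons.1 ha with rfl | ha
        · rw [h.input, map_blk, hev _ p hB1, htake]
          exact hdb
        · obtain ⟨i, hi, rfl⟩ := List.mem_map.1 ha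
          have hi := List.mem_range.1 hi
          simp only [List.map_cons, List.map_nil]
          rw [hB2 i hi.le, hB2 (i + 1) hi, hO.succ]
          exact ⟨hel _, hel _, by rw [hrk _ (by omega), hrk _ (by omega)]⟩

theorem eval_const (ν : ℕ → ℕ) (c : ℕ) : (Term.const c).eval ν = c := rfl

theorem two_le_card (hO : Ordered D V els rk N) : 2 ≤ N := by have := hO.card; omega

theorem succ_zero_iff (h : IsSol ar X D db V) (hO : Ordered D V els rk N) {u : ℕ} :
    V (.inr .succ) [0, u] ↔ u ∈ els ∧ rk u = 1 := by
  rw [hO.succ, hO.zero]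
  exact and_iff_right (zero_mem_els h hO)

theorem pos_offset (hO : Ordered D V els rk N) {u n : ℕ} (hu : rk u = 1) {l : List ℕ} (hl : l.length = n) (hn : n ≤ X.d) :
    pos rk N (u :: (List.replicate (X.d - n) 0 ++ l)) = N ^ X.d + pos rk N l := by
  subst hl
  simp only [pos, pos_append, pos_replicate_zero hO.zero, hu, List.length_append, List.length_replicate]
  rw [Nat.sub_add_cancel hn]
  ring

theorem offset_mem (h : IsSol ar X D db V) (hO : Ordered D V els rk N) {u n : ℕ} (hu : u ∈ els) {l : List ℕ} (hl : l ∈ envs els n) (hn : n ≤ X.d) :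
    u :: (List.replicate (X.d - n) 0 ++ l) ∈ envs els (X.d + 1) := by
  have := cons_mem hu (append_mem (replicate_mem (n := X.d - n) (zero_mem_els h hO)) hl)
  rwa [Nat.sub_add_cancel hn] at this

theorem exists_offset (h : IsSol ar X D db V) (hO : Ordered D V els rk N) {n i : ℕ} (hn : n ≤ X.d) {p : List ℕ} (hp : p ∈ envs els (X.d + 1))
    (hi : i < N ^ n) (e : pos rk N p = N ^ X.d + i) :
    ∃ u ∈ els, rk u = 1 ∧ ∃ l ∈ envs els n, pos rk N l = i ∧ p = u :: (List.replicate (X.d - n) 0 ++ l) := by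
  obtain ⟨u, hu, hu1⟩ := exists_rk hO.map (i := 1) (two_le_card hO)
  obtain ⟨l, hl, hli⟩ := exists_pos hO.map hi
  refine ⟨u, hu, hu1, l, hl, hli, pos_inj hO.map hp (offset_mem h hO hu hl hn) ?_⟩
  rw [pos_offset hO hu1 (mem_envs.1 hl).1 hn, e, hli]

theorem region_iff (h : IsSol ar X D db V) (hO : Ordered D V els rk N) (hb : X.b + 1 ≤ X.d) {p : List ℕ}
    (hp : p ∈ envs els (X.d + 1)) :
    V (.inr .region) p ↔ ∃ i < N ^ (X.b + 1), pos rk N p = N ^ X.d + i := by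
  constructor
  · intro hy
    obtain ⟨r, hr, ν, hν, e, h1, -⟩ := h.supp .region (by simp) p (by simp [(mem_envs.1 hp).1, prAr]) hy
    obtain rfl := List.mem_singleton.1 hr
    simp only [List.map_cons, List.map_append, map_blk, map_zs, eval_vr] at e
    have hu := (succ_zero_iff h hO).1 (h1 _ (List.mem_singleton_self _))
    exact ⟨_, pos_lt hO.map (ev_mem hO hν _ _), by rw [e]; exact pos_offset hO hu.2 (length_ev _ _ _) hb⟩
  · rintro ⟨i, hi, e⟩
    obtain ⟨u, hu, hu1, l, hl, hli, rfl⟩ := exists_offset h hO hb hp hi e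
    have := h.closed .region _ (List.mem_singleton_self _) (ofBlocks fun i => if i = 0 then [u] else l)
      (h.ofBlocks_mem fun i z hz => by
        rw [hO.mem]
        split_ifs at hz
        · obtain rfl := List.mem_singleton.1 hz
          exact hu
        · exact (mem_envs.1 hl).2 z hz) (by simpa [eval_vr, ofBlocks_pair, eval_const] using (succ_zero_iff h hO).2 ⟨hu, hu1⟩) (by simp)
    simpa [eval_vr, ofBlocks_pair, map_blk, map_zs, ev_ofBlocks, (mem_envs.1 hl).1] using this

open Classical in
/-- The input of the simulated machine. -/
noncomputable def input (X : Par) (V : Fin m ⊕ Pr X.M.q X.M.k → List ℕ → Prop) (els : List ℕ) : List Bool :=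
  (envs els (X.b + 1)).map fun l => decide (V (.inr .bit) l)

theorem length_input (hO : Ordered D V els rk N) : (input X V els).length = N ^ (X.b + 1) := by
  rw [input, List.length_map, length_envs hO.map]

theorem init_tape (hO : Ordered D V els rk N) {l : List ℕ} (hl : l ∈ envs els (X.b + 1)) (M : TM) (s : Fin (M.k + 3)) :
    (M.init (input X V els)).tape (pos rk N l) = s ↔ s = 2 ∧ V (.inr .bit) l ∨ s = 1 ∧ ¬ V (.inr .bit) l := by
  classical
  have hlt := pos_lt hO.map hl
  rw [← length_input (V := V) hO] at hlt
  have e : (input X V els)[pos rk N l] = decide (V (.inr .bit) l) := by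
    have := getElem_pos hO.map hl
    rw [List.getElem?_eq_some_iff] at this
    obtain ⟨_, this⟩ := this
    simp [input, this]
  simp only [TM.init, Int.natCast_nonneg, Int.toNat_natCast, hlt, and_self, dite_true, List.get_eq_getElem, e, TM.boolSym]
  by_cases hV : V (.inr .bit) l <;> simp [hV, eq_comm]

theorem init_tape_blank (hO : Ordered D V els rk N) {i : ℤ} (hi : ¬ ∃ j < N ^ (X.b + 1), i = (j : ℕ)) (M : TM) :
    (M.init (input X V els)).tape i = 0 := by
  simp only [TM.init, length_input hO]
  rw [dif_neg]
  rintro ⟨h1, h2⟩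
  exact hi ⟨_, h2, (Int.toNat_of_nonneg h1).symm⟩

end DC

namespace DC

variable {m : ℕ} {ar : Fin m → ℕ} {X : Par} {D : Set ℕ} {db : Set (GAtom (inSchema m ar) ℕ)}
  {V : Fin m ⊕ Pr X.M.q X.M.k → List ℕ → Prop} {els : List ℕ} {rk : ℕ → ℕ} {N : ℕ}

/-! ### Unfolding the rules of the simulation -/

theorem two_ofBlocks {B : ℕ → List ℕ} (hB : ∀ i, B i ∈ envs els (X.d + 1)) (i j : ℕ) :
    (two X i j).map (Term.eval (ofBlocks B)) = B i ++ B j := by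
  rw [map_two, ev_ofBlocks (mem_envs.1 (hB i)).1, ev_ofBlocks (mem_envs.1 (hB j)).1]

theorem eq_zeros (h : IsSol ar X D db V) (hO : Ordered D V els rk N) {n : ℕ} {t : List ℕ} (ht : t ∈ envs els n) (e : pos rk N t = 0) :
    t = List.replicate n 0 :=
  pos_inj hO.map ht (replicate_mem (zero_mem_els h hO)) (by rw [e, pos_replicate_zero hO.zero])

theorem state_iff (h : IsSol ar X D db V) (hO : Ordered D V els rk N) (q : Fin (X.M.q + 1)) {t p : List ℕ}
    (ht : t ∈ envs els (X.d + 1)) (hp : p ∈ envs els (X.d + 1)) : V (.inr (.state q)) (t ++ p) ↔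
      (q = 0 ∧ pos rk N t = 0 ∧ pos rk N p = N ^ X.d) ∨
      ∃ q' s' r, X.M.δ q' s' = some r ∧ r.1 = q ∧ ∃ t' ∈ envs els (X.d + 1), ∃ p' ∈ envs els (X.d + 1),
        pos rk N t = pos rk N t' + 1 ∧ V (.inr (.state q')) (t' ++ p') ∧ V (.inr (.cell s')) (t' ++ p') ∧
        if r.2.2 then pos rk N p = pos rk N p' + 1 else pos rk N p' = pos rk N p + 1 := by
  have hlt : t.length = X.d + 1 := (mem_envs.1 ht).1
  constructor
  · intro hy
    obtain ⟨r, hr, ν, hν, e, h1, -⟩ := h.supp (.state q) (by simp) (t ++ p) (by simp [hlt, (mem_envs.1 hp).1, prAr]) hy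
    simp only [rulesFor, List.mem_append, List.mem_filterMap, Option.bind_eq_some_iff] at hr
    rcases hr with hr | ⟨⟨q', s'⟩, -, u, hδ, hr⟩
    · left
      split_ifs at hr with hq
      · obtain rfl := List.mem_singleton.1 hr
        simp only [List.map_append, List.map_cons, map_zs] at e
        obtain ⟨rfl, rfl⟩ := List.append_inj e (by simp [hlt])
        have hu := (succ_zero_iff h hO).1 (h1 _ (List.mem_singleton_self _))
        refine ⟨hq, pos_replicate_zero hO.zero _, ?_⟩
        simp [pos, pos_replicate_zero hO.zero, hu.2]
      · cases hr
    · right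
      by_cases hu : u.1 = q
      · rw [if_pos hu] at hr
        obtain rfl := Option.some.inj hr
        simp only [map_two] at e
        obtain ⟨rfl, rfl⟩ := List.append_inj e (by simp [hlt, length_ev])
        simp only [List.mem_cons, List.not_mem_nil, or_false, forall_eq_or_imp, forall_eq, map_two] at h1
        obtain ⟨h2, h3, h4, h5⟩ := h1
        rw [next_iff h hO (ev_mem hO hν _ _) ht] at h2
        refine ⟨q', s', u, hδ, hu, _, ev_mem hO hν 0 _, _, ev_mem hO hν 2 _, h2, h3, h4, ?_⟩
        split_ifs with hd
        · rwa [if_pos hd, map_two, next_iff h hO (ev_mem hO hν _ _) (ev_mem hO hν _ _)] at h5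
        · rwa [if_neg hd, map_two, next_iff h hO (ev_mem hO hν _ _) (ev_mem hO hν _ _)] at h5
      · rw [if_neg hu] at hr
        cases hr
  · rintro (⟨rfl, ht0, hp0⟩ | ⟨q', s', r, hδ, rfl, t', ht', p', hp', htt, hst, hce, hd⟩)
    · obtain ⟨u, hu, hu1, l, hl, hli, rfl⟩ := exists_offset h hO (Nat.zero_le X.d) hp (n := 0) (i := 0) (by simp) (by simpa using hp0)
      obtain rfl := List.length_eq_zero_iff.1 (mem_envs.1 hl).1
      have := h.closed (.state 0) _ (List.mem_append_left _ (by rw [if_pos rfl]; exact List.mem_singleton_self _)) (ofBlocks fun _ => [u])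
        (h.ofBlocks_mem fun i z hz => by
          obtain rfl := List.mem_singleton.1 hz
          exact (hO.mem _).2 hu) (by simpa [eval_vr, ofBlocks_pair, eval_const] using (succ_zero_iff h hO).2 ⟨hu, hu1⟩) (by simp)
      rw [eq_zeros h hO ht ht0]
      simpa [eval_vr, ofBlocks_pair, map_zs] using this
    · let B : ℕ → List ℕ := fun i => if i = 0 then t' else if i = 1 then t else if i = 2 then p' else p
      have hB : ∀ i, B i ∈ envs els (X.d + 1) := fun i => by simp only [B]; split_ifs <;> assumption
      have := h.closed (.state r.1) _ (List.mem_append_right _ (List.mem_filterMap.2 ⟨(q', s'), by simp, by rw [hδ, Option.bind_some, if_pos rfl]⟩))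
        (ofBlocks B) (h.ofBlocks_mem fun i z hz => (hO.mem _).2 ((mem_envs.1 (hB i)).2 z hz)) ?_ (by simp)
      · rwa [two_ofBlocks hB] at this
      · simp only [List.mem_cons, List.not_mem_nil, or_false, forall_eq_or_imp, forall_eq, two_ofBlocks hB]
        refine ⟨(next_iff h hO ht' ht).2 htt, hst, hce, ?_⟩
        split_ifs at hd ⊢ <;> rw [two_ofBlocks hB]
        · exact (next_iff h hO hp' hp).2 hd
        · exact (next_iff h hO hp hp').2 hd

theorem mem_cell_init (h : IsSol ar X D db V) (hO : Ordered D V els rk N) (hb : X.b + 1 ≤ X.d) (s : Fin (X.M.k + 3)) {p : List ℕ}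
    (hp : p ∈ envs els (X.d + 1)) : (X.M.init (input X V els)).tape ((pos rk N p : ℤ) - ((N ^ X.d : ℕ) : ℤ)) = s ↔
      (∃ u ∈ els, rk u = 1 ∧ ∃ l ∈ envs els (X.b + 1), p = u :: (List.replicate (X.d - (X.b + 1)) 0 ++ l) ∧
        (s = 2 ∧ V (.inr .bit) l ∨ s = 1 ∧ ¬ V (.inr .bit) l)) ∨ s = 0 ∧ ¬ V (.inr .region) p := by
  rw [region_iff h hO hb hp]
  by_cases hr : ∃ i < N ^ (X.b + 1), pos rk N p = N ^ X.d + i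
  · obtain ⟨i, hi, e⟩ := id hr
    simp only [hr, not_true_eq_false, and_false, or_false]
    obtain ⟨u, hu, hu1, l, hl, rfl, rfl⟩ := exists_offset h hO hb hp hi e
    have e' : ((N ^ X.d + pos rk N l : ℕ) : ℤ) - ((N ^ X.d : ℕ) : ℤ) = (pos rk N l : ℕ) := by push_cast; ring
    rw [e, e', init_tape hO hl]
    constructor
    · exact fun hs => ⟨u, hu, hu1, l, hl, rfl, hs⟩
    · rintro ⟨u', -, -, l', -, e2, hs⟩
      obtain rfl : l = l' := List.append_cancel_left (List.cons.inj e2).2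
      exact hs
  · simp only [hr, not_false_eq_true, and_true]
    rw [init_tape_blank hO]
    · constructor
      · exact fun e => .inr e.symm
      · rintro (⟨u, -, hu1, l, hl, rfl, -⟩ | rfl)
        · exact absurd ⟨_, pos_lt hO.map hl, pos_offset hO hu1 (mem_envs.1 hl).1 hb⟩ hr
        · rfl
    · rintro ⟨j, hj, e⟩
      exact hr ⟨j, hj, by omega⟩

theorem cell_iff (h : IsSol ar X D db V) (hO : Ordered D V els rk N) (hb : X.b + 1 ≤ X.d) (s : Fin (X.M.k + 3)) {t p : List ℕ}
    (ht : t ∈ envs els (X.d + 1)) (hp : p ∈ envs els (X.d + 1)) : V (.inr (.cell s)) (t ++ p) ↔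
      (pos rk N t = 0 ∧ (X.M.init (input X V els)).tape ((pos rk N p : ℤ) - ((N ^ X.d : ℕ) : ℤ)) = s) ∨
      ∃ q' s' r, X.M.δ q' s' = some r ∧ ∃ t' ∈ envs els (X.d + 1), ∃ p' ∈ envs els (X.d + 1),
        pos rk N t = pos rk N t' + 1 ∧ V (.inr (.state q')) (t' ++ p') ∧ V (.inr (.cell s')) (t' ++ p') ∧
        (r.2.1 = s ∧ p' = p ∨ V (.inr (.cell s)) (t' ++ p) ∧ p' ≠ p) := by
  have hlt : t.length = X.d + 1 := (mem_envs.1 ht).1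
  rw [mem_cell_init h hO hb s hp]
  constructor
  · intro hy
    obtain ⟨r, hr, ν, hν, e, h1, h2⟩ := h.supp (.cell s) (by simp) (t ++ p) (by simp [hlt, (mem_envs.1 hp).1, prAr]) hy
    simp only [rulesFor, List.mem_append, List.mem_filterMap, Option.bind_eq_some_iff] at hr
    rcases hr with (((hr | hr) | hr) | ⟨⟨q', s'⟩, -, u, hδ, hr⟩) | ⟨⟨q', s'⟩, -, hr⟩
    · left
      split_ifs at hr with hs
      · obtain rfl := List.mem_singleton.1 hr
        simp only [List.map_append, List.map_cons, map_zs, map_blk] at e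
        obtain ⟨rfl, rfl⟩ := List.append_inj e (by simp [hlt])
        simp only [List.mem_cons, List.not_mem_nil, or_false, forall_eq_or_imp, forall_eq, map_blk] at h1
        have hu := (succ_zero_iff h hO).1 h1.1
        exact ⟨pos_replicate_zero hO.zero _, .inl ⟨_, hu.1, hu.2, _, ev_mem hO hν _ _, rfl, .inl ⟨hs, h1.2⟩⟩⟩
      · cases hr
    · left
      split_ifs at hr with hs
      · obtain rfl := List.mem_singleton.1 hr
        simp only [List.map_append, List.map_cons, map_zs, map_blk] at e
        obtain ⟨rfl, rfl⟩ := List.append_inj e (by simp [hlt])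
        simp only [List.mem_cons, List.not_mem_nil, or_false, forall_eq, map_blk] at h1 h2
        have hu := (succ_zero_iff h hO).1 h1
        exact ⟨pos_replicate_zero hO.zero _, .inl ⟨_, hu.1, hu.2, _, ev_mem hO hν _ _, rfl, .inr ⟨hs, h2⟩⟩⟩
      · cases hr
    · left
      split_ifs at hr with hs
      · obtain rfl := List.mem_singleton.1 hr
        simp only [List.map_append, map_zs, map_blk] at e
        obtain ⟨rfl, rfl⟩ := List.append_inj e (by simp [hlt])
        simp only [List.mem_cons, List.not_mem_nil, or_false, forall_eq, map_blk] at h2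
        exact ⟨pos_replicate_zero hO.zero _, .inr ⟨hs, h2⟩⟩
      · cases hr
    · right
      by_cases hu : u.2.1 = s
      · rw [if_pos hu] at hr
        obtain rfl := Option.some.inj hr
        simp only [map_two] at e
        obtain ⟨rfl, rfl⟩ := List.append_inj e (by simp [hlt, length_ev])
        simp only [List.mem_cons, List.not_mem_nil, or_false, forall_eq_or_imp, forall_eq, map_two] at h1
        obtain ⟨h2, h3, h4⟩ := h1
        rw [next_iff h hO (ev_mem hO hν _ _) ht] at h2
        exact ⟨q', s', u, hδ, _, ev_mem hO hν 0 _, _, ev_mem hO hν 2 _, h2, h3, h4, .inl ⟨hu, rfl⟩⟩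
      · rw [if_neg hu] at hr
        cases hr
    · right
      cases hδ : X.M.δ q' s' with
      | none => simp [hδ] at hr
      | some u =>
        rw [if_neg (by simp [hδ])] at hr
        obtain rfl := Option.some.inj hr
        simp only [map_two] at e
        obtain ⟨rfl, rfl⟩ := List.append_inj e (by simp [hlt, length_ev])
        simp only [List.mem_cons, List.not_mem_nil, or_false, forall_eq_or_imp, forall_eq, map_two] at h1 h2
        obtain ⟨h3, h4, h5, h6⟩ := h1
        rw [next_iff h hO (ev_mem hO hν _ _) ht] at h3
        rw [eq_iff h hO (ev_mem hO hν _ _) hp] at h2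
        exact ⟨q', s', u, hδ, _, ev_mem hO hν 0 _, _, ev_mem hO hν 2 _, h3, h4, h5, .inr ⟨h6, h2⟩⟩
  · rintro (⟨ht0, ⟨u, hu, hu1, l, hl, rfl, hs⟩ | ⟨rfl, hr⟩⟩ | ⟨q', s', r, hδ, t', ht', p', hp', htt, hst, hce, hs⟩)
    · rw [eq_zeros h hO ht ht0]
      have hB : ∀ v, ofBlocks (fun i => if i = 0 then [u] else l) v ∈ D := h.ofBlocks_mem fun i z hz => by
        rw [hO.mem]
        split_ifs at hz
        · obtain rfl := List.mem_singleton.1 hz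
          exact hu
        · exact (mem_envs.1 hl).2 z hz
      have hsu := (succ_zero_iff h hO).2 ⟨hu, hu1⟩
      have hll := (mem_envs.1 hl).1
      rcases hs with ⟨rfl, hbit⟩ | ⟨rfl, hbit⟩
      · have := h.closed (.cell 2) _ (List.mem_append_left _ (List.mem_append_left _ (List.mem_append_left _ (List.mem_append_left _
          (by rw [if_pos rfl]; exact List.mem_singleton_self _))))) _ hB
          (by simpa [eval_vr, ofBlocks_pair, eval_const, map_blk, ev_ofBlocks, hll] using ⟨hsu, hbit⟩) (by simp)
        simpa [eval_vr, ofBlocks_pair, eval_const, map_blk, map_zs, ev_ofBlocks, hll] using this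
      · have := h.closed (.cell 1) _ (List.mem_append_left _ (List.mem_append_left _ (List.mem_append_left _ (List.mem_append_right _
          (by rw [if_pos rfl]; exact List.mem_singleton_self _))))) _ hB
          (by simpa [eval_vr, ofBlocks_pair, eval_const] using hsu) (by simpa [map_blk, ev_ofBlocks, hll] using hbit)
        simpa [eval_vr, ofBlocks_pair, eval_const, map_blk, map_zs, ev_ofBlocks, hll] using this
    · rw [eq_zeros h hO ht ht0]
      have hlp := (mem_envs.1 hp).1
      have := h.closed (.cell 0) _ (List.mem_append_left _ (List.mem_append_left _ (List.mem_append_right _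
          (by rw [if_pos rfl]; exact List.mem_singleton_self _)))) (ofBlocks fun _ => p)
          (h.ofBlocks_mem fun i z hz => (hO.mem _).2 ((mem_envs.1 hp).2 z hz))
          (by simp) (by simpa [map_blk, ev_ofBlocks, hlp] using hr)
      simpa [map_blk, map_zs, ev_ofBlocks, hlp] using this
    · let B : ℕ → List ℕ := fun i => if i = 0 then t' else if i = 1 then t else if i = 2 then p' else p
      have hB : ∀ i, B i ∈ envs els (X.d + 1) := fun i => by simp only [B]; split_ifs <;> assumption
      have hBD := h.ofBlocks_mem fun i z hz => (hO.mem _).2 ((mem_envs.1 (hB i)).2 z hz)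
      rcases hs with ⟨rfl, rfl⟩ | ⟨hs, hne⟩
      · have := h.closed (.cell r.2.1) _ (List.mem_append_left _ (List.mem_append_right _
          (List.mem_filterMap.2 ⟨(q', s'), by simp, by rw [hδ, Option.bind_some, if_pos rfl]⟩))) _ hBD ?_ (by simp)
        · rwa [two_ofBlocks hB] at this
        · simp only [List.mem_cons, List.not_mem_nil, or_false, forall_eq_or_imp, forall_eq, two_ofBlocks hB]
          exact ⟨(next_iff h hO ht' ht).2 htt, hst, hce⟩
      · have := h.closed (.cell s) _ (List.mem_append_right _
          (List.mem_filterMap.2 ⟨(q', s'), by simp, by rw [if_neg (by simp [hδ])]⟩)) _ hBD ?_ ?_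
        · rwa [two_ofBlocks hB] at this
        · simp only [List.mem_cons, List.not_mem_nil, or_false, forall_eq_or_imp, forall_eq, two_ofBlocks hB]
          exact ⟨(next_iff h hO ht' ht).2 htt, hst, hce, hs⟩
        · simp only [List.mem_cons, List.not_mem_nil, or_false, forall_eq, two_ofBlocks hB]
          exact mt (eq_iff h hO hp' hp).1 hne

theorem ans_iff (h : IsSol ar X D db V) (hO : Ordered D V els rk N) (hk : X.k ≤ X.d) {l : List ℕ} (hl : l.length = X.k) :
    V (.inr .ans) l ↔ l ∈ envs els X.k ∧ ∃ q s, X.M.δ q s = none ∧ ∃ t ∈ envs els (X.d + 1), ∃ p ∈ envs els (X.d + 1),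
      ∃ p' ∈ envs els (X.d + 1), V (.inr (.state q)) (t ++ p) ∧ V (.inr (.cell s)) (t ++ p) ∧
      pos rk N p' = N ^ X.d + pos rk N l ∧ V (.inr (.cell 2)) (t ++ p') := by
  constructor
  · intro hy
    obtain ⟨r, hr, ν, hν, e, h1, -⟩ := h.supp .ans (by simp) l hl hy
    simp only [rulesFor, List.mem_filterMap] at hr
    obtain ⟨⟨q, s⟩, -, hr⟩ := hr
    split_ifs at hr with hδ
    obtain rfl := Option.some.inj hr
    simp only [map_blk] at e
    subst e
    simp only [List.mem_cons, List.not_mem_nil, or_false, forall_eq_or_imp, forall_eq, map_two, List.map_append, List.map_cons,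
      map_blk, map_zs] at h1
    obtain ⟨h2, h3, h4, h5⟩ := h1
    have hu := (succ_zero_iff h hO).1 h2
    exact ⟨ev_mem hO hν _ _, q, s, hδ, _, ev_mem hO hν 0 _, _, ev_mem hO hν 1 _, _, offset_mem h hO hu.1 (ev_mem hO hν 2 _) hk, h3, h4,
      pos_offset hO hu.2 (length_ev _ _ _) hk, h5⟩
  · rintro ⟨hle, q, s, hδ, t, ht, p, hp, p', hp', hst, hce, hpp, hc2⟩
    obtain ⟨u, hu, hu1, l', hl', hli, rfl⟩ := exists_offset h hO hk hp' (pos_lt hO.map hle) hpp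
    obtain rfl := pos_inj hO.map hl' hle hli
    let B : ℕ → List ℕ := fun i => if i = 0 then t else if i = 1 then p else if i = 2 then l' else [u]
    have hB : ∀ i, ∀ z ∈ B i, z ∈ D := fun i z hz => by
      rw [hO.mem]
      simp only [B] at hz
      split_ifs at hz
      · exact (mem_envs.1 ht).2 z hz
      · exact (mem_envs.1 hp).2 z hz
      · exact (mem_envs.1 hl').2 z hz
      · obtain rfl := List.mem_singleton.1 hz
        exact hu
    have e0 : ev (ofBlocks B) 0 (X.d + 1) = t := ev_ofBlocks (B := B) (i := 0) (mem_envs.1 ht).1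
    have e1 : ev (ofBlocks B) 1 (X.d + 1) = p := ev_ofBlocks (B := B) (i := 1) (mem_envs.1 hp).1
    have e2 : ev (ofBlocks B) 2 X.k = l' := ev_ofBlocks (B := B) (i := 2) (mem_envs.1 hl').1
    have e3 : (vr 3).eval (ofBlocks B) = u := by simp [eval_vr, ofBlocks_pair, B]
    have := h.closed .ans _ (List.mem_filterMap.2 ⟨(q, s), by simp, by rw [if_pos hδ]⟩) _ (h.ofBlocks_mem hB) ?_ (by simp)
    · rwa [map_blk, e2] at this
    · simp only [List.mem_cons, List.not_mem_nil, or_false, forall_eq_or_imp, forall_eq, map_two, List.map_append, List.map_cons,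
        map_blk, map_zs, e0, e1, e2, e3]
      exact ⟨(succ_zero_iff h hO).2 ⟨hu, hu1⟩, hst, hce, hc2⟩

end DC

namespace DC

/-! ### Correctness of the simulation -/

theorem iter_succ (M : TM) (n : ℕ) (c : TMCfg M) : M.iter (n + 1) c = (M.iter n c).bind M.step := by
  induction n generalizing c with
  | zero => simp [TM.iter]
  | succ n ih =>
    rw [TM.iter]
    conv_rhs => rw [TM.iter]
    cases M.step c with
    | none => rfl
    | some c' => exact ih c'

theorem step_eq_some {M : TM} {c : TMCfg M} {r : Fin (M.q + 1) × Fin (M.k + 3) × Bool}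
    (h : M.δ c.state (c.tape c.head) = some r) :
    M.step c = some ⟨r.1, Function.update c.tape c.head r.2.1, if r.2.2 then c.head + 1 else c.head - 1⟩ := by
  obtain ⟨q, s, d⟩ := r
  simp only [TM.step, h]

theorem step_eq_none {M : TM} {c : TMCfg M} : M.step c = none ↔ M.δ c.state (c.tape c.head) = none := by
  rcases h : M.δ c.state (c.tape c.head) with _ | r
  · simp only [TM.step, h]
  · simp [step_eq_some h]

theorem exists_iter_of_le {M : TM} {c : TMCfg M} {n n' : ℕ} (hn : n ≤ n') {c' : TMCfg M} (h : M.iter n' c = some c') :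
    ∃ c'', M.iter n c = some c'' := by
  induction n', hn using Nat.le_induction generalizing c' with
  | base => exact ⟨_, h⟩
  | succ n' _ ih =>
    rw [iter_succ, Option.bind_eq_some_iff] at h
    obtain ⟨c₁, h1, -⟩ := h
    exact ih h1

theorem le_of_halts {M : TM} {c : TMCfg M} {n n' : ℕ} {c₁ c₂ : TMCfg M} (h₁ : M.iter n c = some c₁) (hs : M.step c₁ = none)
    (h₂ : M.iter n' c = some c₂) : n' ≤ n := by
  by_contra! hlt
  obtain ⟨c₃, h3⟩ := exists_iter_of_le (Nat.succ_le_of_lt hlt) h₂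
  rw [Nat.succ_eq_add_one, iter_succ, h₁, Option.bind_some, hs] at h3
  cases h3

variable {m : ℕ} {ar : Fin m → ℕ} {X : Par} {D : Set ℕ} {db : Set (GAtom (inSchema m ar) ℕ)}
  {V : Fin m ⊕ Pr X.M.q X.M.k → List ℕ → Prop} {els : List ℕ} {rk : ℕ → ℕ} {N : ℕ}

theorem sound (h : IsSol ar X D db V) (hO : Ordered D V els rk N) (hb : X.b + 1 ≤ X.d) (τ : ℕ) {t : List ℕ} (ht : t ∈ envs els (X.d + 1))
    (hτ : pos rk N t = τ) {p : List ℕ} (hp : p ∈ envs els (X.d + 1)) :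
    (∀ q, V (.inr (.state q)) (t ++ p) → ∃ c, X.M.iter τ (X.M.init (input X V els)) = some c ∧ c.state = q ∧
      (pos rk N p : ℤ) = c.head + ((N ^ X.d : ℕ) : ℤ)) ∧
    ∀ s, V (.inr (.cell s)) (t ++ p) → ∃ c, X.M.iter τ (X.M.init (input X V els)) = some c ∧
      c.tape ((pos rk N p : ℤ) - ((N ^ X.d : ℕ) : ℤ)) = s := by
  induction τ generalizing t p with
  | zero =>
    refine ⟨fun q hq => ?_, fun s hs => ?_⟩
    · rcases (state_iff h hO q ht hp).1 hq with ⟨rfl, -, h2⟩ | ⟨_, _, _, _, _, _, _, _, _, h1, _⟩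
      · exact ⟨_, rfl, rfl, by simp [TM.init, h2]⟩
      · omega
    · rcases (cell_iff h hO hb s ht hp).1 hs with ⟨-, h2⟩ | ⟨_, _, _, _, _, _, _, _, h1, _⟩
      · exact ⟨_, rfl, h2⟩
      · omega
  | succ τ ih =>
    have key {q' s' r} (hδ : X.M.δ q' s' = some r) {t' p'} (ht' : t' ∈ envs els (X.d + 1)) (hp' : p' ∈ envs els (X.d + 1))
        (htt : pos rk N t = pos rk N t' + 1) (hst : V (.inr (.state q')) (t' ++ p')) (hce : V (.inr (.cell s')) (t' ++ p')) :
        ∃ c, X.M.iter τ (X.M.init (input X V els)) = some c ∧ (pos rk N p' : ℤ) = c.head + ((N ^ X.d : ℕ) : ℤ) ∧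
          X.M.iter (τ + 1) (X.M.init (input X V els)) =
            some ⟨r.1, Function.update c.tape c.head r.2.1, if r.2.2 then c.head + 1 else c.head - 1⟩ := by
      obtain ⟨c, h1, rfl, h3⟩ := (ih ht' (by omega) hp').1 _ hst
      obtain ⟨c', h1', rfl⟩ := (ih ht' (by omega) hp').2 _ hce
      obtain rfl := Option.some.inj (h1.symm.trans h1')
      refine ⟨c, h1, h3, ?_⟩
      rw [iter_succ, h1, Option.bind_some, step_eq_some]
      rw [← hδ, h3, add_sub_cancel_right]
    refine ⟨fun q hq => ?_, fun s hs => ?_⟩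
    · rcases (state_iff h hO q ht hp).1 hq with ⟨_, h1, _⟩ | ⟨q', s', r, hδ, rfl, t', ht', p', hp', htt, hst, hce, hd⟩
      · omega
      · obtain ⟨c, -, h3, h4⟩ := key hδ ht' hp' htt hst hce
        refine ⟨_, h4, rfl, ?_⟩
        dsimp only
        split_ifs at hd ⊢ <;> omega
    · rcases (cell_iff h hO hb s ht hp).1 hs with ⟨h1, _⟩ | ⟨q', s', r, hδ, t', ht', p', hp', htt, hst, hce, hd⟩
      · omega
      · obtain ⟨c, h1, h3, h4⟩ := key hδ ht' hp' htt hst hce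
        refine ⟨_, h4, ?_⟩
        dsimp only
        rcases hd with ⟨rfl, rfl⟩ | ⟨hs', hne⟩
        · rw [h3, add_sub_cancel_right, Function.update_self]
        · obtain ⟨c', h1', rfl⟩ := (ih ht' (by omega) hp).2 _ hs'
          obtain rfl := Option.some.inj (h1.symm.trans h1')
          rw [Function.update_of_ne]
          intro e
          exact hne (pos_inj hO.map hp' hp (by omega))

theorem complete (h : IsSol ar X D db V) (hO : Ordered D V els rk N) (hb : X.b + 1 ≤ X.d) (τ : ℕ) (hτN : τ < N ^ X.d)
    {c : TMCfg X.M} (hc : X.M.iter τ (X.M.init (input X V els)) = some c) :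
    |c.head| ≤ τ ∧ ∀ t ∈ envs els (X.d + 1), pos rk N t = τ → ∀ p ∈ envs els (X.d + 1),
      ((pos rk N p : ℤ) = c.head + ((N ^ X.d : ℕ) : ℤ) → V (.inr (.state c.state)) (t ++ p)) ∧
      V (.inr (.cell (c.tape ((pos rk N p : ℤ) - ((N ^ X.d : ℕ) : ℤ))))) (t ++ p) := by
  have hN : N ^ X.d * 2 ≤ N ^ (X.d + 1) := by
    rw [pow_succ]
    exact Nat.mul_le_mul_left _ (two_le_card hO)
  induction τ generalizing c with
  | zero =>
    obtain rfl := Option.some.inj hc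
    refine ⟨by simp [TM.init], fun t ht h0 p hp => ⟨fun e => ?_, ?_⟩⟩
    · exact (state_iff h hO _ ht hp).2 (.inl ⟨rfl, h0, by simp only [TM.init] at e; omega⟩)
    · exact (cell_iff h hO hb _ ht hp).2 (.inl ⟨h0, rfl⟩)
  | succ τ ih =>
    rw [iter_succ, Option.bind_eq_some_iff] at hc
    obtain ⟨c₀, h0, hs⟩ := hc
    obtain ⟨hh, ih⟩ := ih (by omega) h0
    rcases hδ : X.M.δ c₀.state (c₀.tape c₀.head) with _ | r
    · rw [step_eq_none.2 hδ] at hs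
      cases hs
    · rw [step_eq_some hδ] at hs
      obtain rfl := Option.some.inj hs
      rw [abs_le] at hh
      obtain ⟨t', ht', e'⟩ := exists_pos hO.map (i := τ) (R := X.d + 1) (by omega)
      obtain ⟨p', hp', e''⟩ := exists_pos hO.map (i := (c₀.head + ((N ^ X.d : ℕ) : ℤ)).toNat) (R := X.d + 1) (by omega)
      replace e'' : (pos rk N p' : ℤ) = c₀.head + ((N ^ X.d : ℕ) : ℤ) := by omega
      have hst := (ih t' ht' e' p' hp').1 e''
      have hce := (ih t' ht' e' p' hp').2
      rw [e'', add_sub_cancel_right] at hce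
      refine ⟨by rw [abs_le]; dsimp only; split_ifs <;> push_cast <;> omega, fun t ht hτ p hp => ⟨fun e => ?_, ?_⟩⟩
      · refine (state_iff h hO _ ht hp).2 (.inr ⟨_, _, r, hδ, rfl, t', ht', p', hp', by omega, hst, hce, ?_⟩)
        dsimp only at e
        split_ifs at e ⊢ <;> omega
      · refine (cell_iff h hO hb _ ht hp).2 (.inr ⟨_, _, r, hδ, t', ht', p', hp', by omega, hst, hce, ?_⟩)
        dsimp only
        by_cases hpp : p' = p
        · subst hpp
          exact .inl ⟨by rw [e'', add_sub_cancel_right, Function.update_self], rfl⟩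
        · refine .inr ⟨?_, hpp⟩
          rw [Function.update_of_ne]
          · exact (ih t' ht' e' p hp).2
          · intro e
            exact hpp (pos_inj hO.map hp' hp (by omega))

theorem ans_iff_output (h : IsSol ar X D db V) (hO : Ordered D V els rk N) (hb : X.b + 1 ≤ X.d) (hk : X.k ≤ X.d) {T : ℕ}
    {c : TMCfg X.M} (hT : X.M.HaltsIn (X.M.init (input X V els)) T c) (hTN : T < N ^ X.d) {y : List Bool}
    (hy : X.M.OutputIs c y) (hyl : y.length = N ^ X.k) {l : List ℕ} (hl : l.length = X.k) :
    V (.inr .ans) l ↔ l ∈ envs els X.k ∧ y[pos rk N l]? = some true := by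
  have hN : N ^ X.d * 2 ≤ N ^ (X.d + 1) := by
    rw [pow_succ]
    exact Nat.mul_le_mul_left _ (two_le_card hO)
  have hkd : N ^ X.k ≤ N ^ X.d := Nat.pow_le_pow_right (by have := two_le_card hO; omega) hk
  have hsym (hle : l ∈ envs els X.k) : c.tape (pos rk N l : ℤ) = 2 ↔ y[pos rk N l]? = some true := by
    have hlt : pos rk N l < y.length := hyl ▸ pos_lt hO.map hle
    have := hy.1 ⟨_, hlt⟩
    rw [this, List.getElem?_eq_getElem hlt, Option.some_inj, List.get_eq_getElem]
    dsimp only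
    cases y[pos rk N l] with
    | true => simp [TM.boolSym]
    | false => simpa [TM.boolSym] using (fin_two_ne (k := X.M.k)).2.symm
  obtain ⟨hh, hc⟩ := complete h hO hb T hTN hT.1
  rw [ans_iff h hO hk hl]
  refine and_congr_right fun hle => ?_
  rw [← hsym hle]
  constructor
  · rintro ⟨q, s, hδ, t, ht, p, hp, p', hp', hst, hce, e, h2⟩
    obtain ⟨c₁, h3, rfl, h5⟩ := (sound h hO hb _ ht rfl hp).1 _ hst
    obtain ⟨c₂, h4, rfl⟩ := (sound h hO hb _ ht rfl hp).2 _ hce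
    obtain rfl := Option.some.inj (h3.symm.trans h4)
    rw [h5, add_sub_cancel_right, ← step_eq_none] at hδ
    have hTt := le_antisymm (le_of_halts h3 hδ hT.1) (le_of_halts hT.1 hT.2 h3)
    obtain ⟨c₃, h6, h7⟩ := (sound h hO hb _ ht rfl hp').2 _ h2
    rw [← hTt, hT.1] at h6
    obtain rfl := Option.some.inj h6
    rw [← h7]
    congr 1
    omega
  · intro h2
    have hlt := pos_lt hO.map hle
    rw [abs_le] at hh
    obtain ⟨t, ht, e⟩ := exists_pos hO.map (i := T) (R := X.d + 1) (by omega)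
    obtain ⟨p, hp, e1⟩ := exists_pos hO.map (i := (c.head + ((N ^ X.d : ℕ) : ℤ)).toNat) (R := X.d + 1) (by omega)
    obtain ⟨p', hp', e2⟩ := exists_pos hO.map (i := N ^ X.d + pos rk N l) (R := X.d + 1) (by omega)
    replace e1 : (pos rk N p : ℤ) = c.head + ((N ^ X.d : ℕ) : ℤ) := by omega
    have h3 := hc t ht e p hp
    have h4 := (hc t ht e p' hp').2
    rw [e1, add_sub_cancel_right] at h3
    refine ⟨_, _, step_eq_none.1 hT.2, t, ht, p, hp, p', hp', h3.1 rfl, h3.2, e2, ?_⟩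
    rw [e2, Nat.cast_add, add_sub_cancel_left, h2] at h4
    exact h4

end DC

namespace DC

open Enc

/-! ### Decoding the input of the simulated machine -/

/-- The elements of `ls` at the positions where `x` holds. -/
def select (ls : List (List ℕ)) (x : List Bool) : List (List ℕ) :=
  (ls.foldl (fun (s : List Bool × List (List ℕ)) l => (s.1.tail, bif s.1.headD false then l :: s.2 else s.2)) (x, [])).2

theorem mem_select {ls : List (List ℕ)} {x : List Bool} {l : List ℕ} :
    l ∈ select ls x ↔ ∃ i : ℕ, ls[i]? = some l ∧ x[i]? = some true := by
  suffices H : ∀ out : List (List ℕ), l ∈ (ls.foldl (fun (s : List Bool × List (List ℕ)) l =>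
      (s.1.tail, bif s.1.headD false then l :: s.2 else s.2)) (x, out)).2 ↔
        l ∈ out ∨ ∃ i : ℕ, ls[i]? = some l ∧ x[i]? = some true by
    simpa [select] using H []
  induction ls generalizing x with
  | nil => simp
  | cons a ls ih =>
    intro out
    rw [List.foldl_cons, ih]
    have h0 : (∃ i : ℕ, (a :: ls)[i]? = some l ∧ x[i]? = some true) ↔
        (a = l ∧ x[0]? = some true) ∨ ∃ i : ℕ, ls[i]? = some l ∧ x.tail[i]? = some true := by
      constructor
      · rintro ⟨_ | i, h⟩
        · exact .inl (by simpa using h)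
        · exact .inr ⟨i, by simpa using h⟩
      · rintro (h | ⟨i, h⟩)
        · exact ⟨0, by simpa using h⟩
        · exact ⟨i + 1, by simpa using h⟩
    rw [h0]
    rcases x with _ | ⟨_ | _, x⟩ <;> simp [or_left_comm, or_assoc, eq_comm]

theorem PT.select {α : Type} [Enc α] {ls : α → List (List ℕ)} {x : α → List Bool} (hl : PT ls) (hx : PT x) :
    PT fun a => DC.select (ls a) (x a) := by
  refine PT.snd (PT.foldl (l := ls) (s := fun a => (x a, []))
    (g := fun _ (s : List Bool × List (List ℕ)) l => (s.1.tail, bif s.1.headD false then l :: s.2 else s.2))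
    (PT.pair (by fun_prop) (PT.cond (PT.headD (by fun_prop) (.const _)) (by fun_prop) (by fun_prop))) hl (by fun_prop)
    ⟨Polynomial.X, fun a s l _ => ?_⟩)
  have := sz_tail_le s.1
  simp only [sz_pair, Polynomial.eval_X]
  cases s.1.headD false <;> simp <;> omega

/-- The names `2 ^ i - 1` of the domain elements, one for each leading bit that holds. -/
def names (x : List Bool) : List ℕ :=
  ((x.takeWhile id).tail.foldl (fun s _ => Nat.bit true (s.headD 0) :: s) [0]).reverse

theorem foldl_names (l : List Bool) : l.foldl (fun s _ => Nat.bit true (s.headD 0) :: s) [0] =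
    ((List.range (l.length + 1)).map fun i => 2 ^ i - 1).reverse := by
  induction l using List.reverseRecOn with
  | nil => rfl
  | append_singleton l b ih =>
    rw [List.foldl_append, ih, List.length_append, List.length_singleton, List.range_succ (n := l.length + 1)]
    simp only [List.foldl_cons, List.foldl_nil, List.map_append, List.map_cons, List.map_nil, List.reverse_append,
      List.reverse_singleton, List.singleton_append, List.cons.injEq, and_true]
    rw [List.range_succ, List.map_append, List.map_singleton, List.reverse_append, List.reverse_singleton, List.singleton_append,
      List.headD_cons]
    have := Nat.one_le_two_pow (n := l.length)
    rw [Nat.bit_true_apply, pow_succ]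
    omega

theorem names_eq {x : List Bool} {n : ℕ} (hn : 0 < n) (h : (x.takeWhile id).length = n) :
    names x = (List.range n).map fun i => 2 ^ i - 1 := by
  rw [names, foldl_names, List.reverse_reverse, List.length_tail, h, Nat.sub_add_cancel hn]

theorem length_takeWhile {x : List Bool} {n : ℕ} (h1 : ∀ i < n, x[i]? = some true) (h2 : x[n]? = some false) :
    (x.takeWhile id).length = n := by
  induction n generalizing x with
  | zero =>
    rcases x with _ | ⟨_ | _, x⟩ <;> simp_all
  | succ n ih =>
    have h0 := h1 0 (by omega)
    rcases x with _ | ⟨_ | _, x⟩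
    · simp at h0
    · simp at h0
    · rw [List.takeWhile_cons_of_pos rfl, List.length_cons, ih (fun i hi => by simpa using h1 (i + 1) (by omega)) (by simpa using h2)]

theorem PT.names {α : Type} [Enc α] {x : α → List Bool} (hx : PT x) : PT fun a => DC.names (x a) := by
  have h1 : PT fun x : List Bool => x.takeWhile _root_.id := by
    refine (PT.foldr (l := fun x : List Bool => x) (s := fun _ => []) (g := fun _ b (s : List Bool) => bif b then b :: s else [])
      (PT.cond (by fun_prop) (by fun_prop) (by fun_prop)) PT.id (by fun_prop) ⟨Polynomial.X, fun a s b _ => ?_⟩).congr fun x => ?_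
    · have := sz_pos s
      simp only [sz_pair, Polynomial.eval_X]
      cases b <;> simp <;> omega
    · induction x with
      | nil => rfl
      | cons b x ih => cases b <;> simp [ih]
  have hb : ∀ l : List Bool, sz (l.foldl (fun s _ => Nat.bit true (s.headD 0) :: s) [0]) ≤ (l.length + 1) * (4 * l.length + 4) ∧
      sz ((l.foldl (fun s _ => Nat.bit true (s.headD 0) :: s) [0]).headD 0) ≤ 4 * l.length + 1 := by
    intro l
    induction l using List.reverseRecOn with
    | nil => decide
    | append_singleton l b ih =>
      have h3 := sz_bit_le true ((l.foldl (fun s _ => Nat.bit true (s.headD 0) :: s) [0]).headD 0)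
      simp only [List.foldl_append, List.foldl_cons, List.foldl_nil, sz_cons, List.headD_cons, List.length_append, List.length_singleton]
      constructor
      · nlinarith [ih.1, ih.2]
      · omega
  have h2 : PT fun l : List Bool => l.foldl (fun s _ => Nat.bit true (s.headD 0) :: s) [0] := by
    refine PT.foldl_aux (g := fun (s : List ℕ) (_ : Bool) => Nat.bit true (s.headD 0) :: s)
      (PT.cons (PT.bit (.const _) (PT.headD (by fun_prop) (.const _))) (by fun_prop)) (fun l : List Bool => l) (fun _ => [0])
      PT.id (by fun_prop) ((Polynomial.X + 1) * (4 * Polynomial.X + 4)) fun l l₁ l₂ e => ?_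
    have h3 : l₁.length ≤ sz l := by
      have := length_lt_sz l
      subst e
      simp at this
      omega
    refine (hb l₁).1.trans ?_
    simp only [Polynomial.eval_mul, Polynomial.eval_add, Polynomial.eval_X, Polynomial.eval_one, Polynomial.eval_ofNat]
    gcongr
  exact PT.reverse (h2.comp (PT.tail (h1.comp hx)))

/-- The database described by the input, with the domain elements replaced by their names. -/
def decodeDB {m : ℕ} (ar : Fin m → ℕ) (b : ℕ) (x : List Bool) : List (GAtom (inSchema m ar) ℕ) :=
  (List.finRange m).flatMap fun (p : Fin m) => ((select (envs (names x) (b + 1)) x).filter fun l => decide (l.headD 0 = 2 ^ (p.val + 1) - 1)).map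
    fun l => ⟨p, fun i => l.getD (i + 1) 0⟩

theorem PT.flatMap_const {α ι β : Type} [Enc α] [Enc β] (F : List ι) {f : ι → α → List β} (hf : ∀ i, PT (f i)) :
    PT fun a => F.flatMap fun i => f i a := by
  induction F with
  | nil => exact PT.const []
  | cons i F ih => simpa only [List.flatMap_cons] using PT.append (hf i) ih

theorem PT.decodeDB {m : ℕ} (ar : Fin m → ℕ) (b : ℕ) : PT fun x => (DC.decodeDB ar b x).map factList := by
  have h1 : PT fun x => DC.select (DC.envs (DC.names x) (b + 1)) x := PT.select (PT.envs (PT.names PT.id) _) PT.id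
  have h2 : ∀ (S : List Bool → List (List ℕ)) (_ : PT S) (c v : ℕ) (n : ℕ), PT fun x => ((S x).filter
      fun l => decide (l.headD 0 = c)).map fun l => v :: List.ofFn fun i : Fin n => l.getD (i + 1) 0 := fun S hS c v n =>
    PT.map (f := fun _ l => v :: List.ofFn fun i : Fin n => l.getD (i + 1) 0)
      (PT.filter (l := S) (f := fun _ l => decide (l.headD 0 = c)) hS
        (PT.decideEq (f := fun q : List Bool × List ℕ => q.2.headD 0) (PT.headD (by fun_prop) (.const _)) (.const _)))
      (PT.cons (.const _) (PT.ofFn fun i => PT.getD _ _ (by fun_prop)))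
  refine (PT.flatMap_const (List.finRange m) fun p => h2 _ h1 (2 ^ (p.val + 1) - 1) p.val (ar p)).congr fun x => ?_
  refine Eq.trans ?_ (List.map_flatMap (l := List.finRange m)).symm
  refine congrArg (fun f => List.flatMap f _) (funext fun p => ?_)
  rw [List.map_map]
  rfl

/-- The truth table of the answer of `g`, over the names. -/
def answer {m : ℕ} (ar : Fin m → ℕ) (b k : ℕ) (g : List (List ℕ) → List (List ℕ)) (x : List Bool) : List Bool :=
  (envs (names x) k).map fun l => decide (l ∈ g ((decodeDB ar b x).map factList))

theorem PT.answer {m : ℕ} (ar : Fin m → ℕ) (b k : ℕ) {g : List (List ℕ) → List (List ℕ)} (hg : PT g) : PT (DC.answer ar b k g) := by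
  have h1 := hg.comp (PT.decodeDB ar b)
  exact PT.map (f := fun x l => decide (l ∈ g ((DC.decodeDB ar b x).map factList))) (PT.envs (PT.names PT.id) k)
    (PT.elem (f := fun q : List Bool × List ℕ => q.2) (l := fun q => g ((DC.decodeDB ar b q.1).map factList)) (by fun_prop)
      (h1.comp (f := fun q : List Bool × List ℕ => q.1) (by fun_prop)))

theorem envs_map (f : ℕ → ℕ) (D : List ℕ) (R : ℕ) : envs (D.map f) R = (envs D R).map (List.map f) := by
  induction R with
  | zero => rfl
  | succ R ih => simp only [envs, ih, List.map_flatMap, List.flatMap_map, List.map_map, Function.comp_def, List.map_cons]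

end DC

namespace DC

open Enc

/-! ### Genericity and renaming of the domain -/

theorem exists_perm {f : ℕ → ℕ} {s : Finset ℕ} (hf : Set.InjOn f s) : ∃ π : ℕ ≃ ℕ, ∀ x ∈ s, π x = f x := by
  induction s using Finset.induction_on with
  | empty => exact ⟨Equiv.refl ℕ, by simp⟩
  | insert a s ha ih =>
    obtain ⟨π, hπ⟩ := ih (hf.mono (by simp))
    refine ⟨π.trans (Equiv.swap (π a) (f a)), fun x hx => ?_⟩
    rcases Finset.mem_insert.1 hx with rfl | hx
    · simp
    · have h1 : π x ≠ π a := fun e => ha (π.injective e ▸ hx)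
      have h2 : π x ≠ f a := fun e => ha (hf (by simp [hx]) (by simp) ((hπ x hx).symm.trans e) ▸ hx)
      rw [Equiv.trans_apply, Equiv.swap_apply_of_ne_of_ne h1 h2, hπ x hx]

theorem mem_query_iff {m : ℕ} {ar : Fin m → ℕ} {k : ℕ} {Q : Query m ar k} (hQ : Generic Q) (π : ℕ ≃ ℕ)
    (db : Set (GAtom (inSchema m ar) ℕ)) (t : Fin k → ℕ) : (fun i => π (t i)) ∈ Q (renameDB π db) ↔ t ∈ Q db := by
  rw [hQ π db]
  constructor
  · rintro ⟨s, hs, e⟩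
    convert hs using 1
    exact funext fun i => π.injective (congrFun e i)
  · exact fun h => ⟨t, h, rfl⟩

theorem mem_dom_of_mem_query {m : ℕ} {ar : Fin m → ℕ} {k : ℕ} {Q : Query m ar k} (hQ : Generic Q)
    {db : Set (GAtom (inSchema m ar) ℕ)} (hfin : (Q db).Finite) {D : Set ℕ} (hD : D.Finite) (hdb : ∀ a ∈ db, ∀ i, a.args i ∈ D)
    {t : Fin k → ℕ} (ht : t ∈ Q db) (i : Fin k) : t i ∈ D := by
  by_contra hi
  refine hD.infinite_compl ((hfin.image fun s => s i).subset fun z hz => ?_)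
  have hfix : ∀ x ∈ D, Equiv.swap (t i) z x = x := fun x hx =>
    Equiv.swap_apply_of_ne_of_ne (fun e => hi (e ▸ hx)) (fun e => hz (e ▸ hx))
  have hr : renameDB (Equiv.swap (t i) z) db = db := by
    have key : ∀ b ∈ db, (⟨b.p, fun j => Equiv.swap (t i) z (b.args j)⟩ : GAtom (inSchema m ar) ℕ) = b := fun b hb =>
      congrArg (GAtom.mk (S := inSchema m ar) b.p) (funext fun j => hfix _ (hdb b hb j))
    ext a
    constructor
    · rintro ⟨b, hb, rfl⟩
      rwa [key b hb]
    · exact fun ha => ⟨a, ha, (key a ha).symm⟩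
  have := (mem_query_iff hQ (Equiv.swap (t i) z) db t).2 ht
  rw [hr] at this
  exact ⟨_, this, by simp⟩

variable {m : ℕ} {ar : Fin m → ℕ} {X : Par} {D : Set ℕ} {db : Set (GAtom (inSchema m ar) ℕ)}
  {V : Fin m ⊕ Pr X.M.q X.M.k → List ℕ → Prop} {els : List ℕ} {rk : ℕ → ℕ} {N : ℕ}

theorem input_getElem? (hO : Ordered D V els rk N) {l : List ℕ} (hl : l ∈ envs els (X.b + 1)) (c : Bool) :
    (input X V els)[pos rk N l]? = some c ↔ (V (.inr .bit) l ↔ c = true) := by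
  rw [input, List.getElem?_map, getElem_pos hO.map hl, Option.map_some, Option.some_inj]
  cases c <;> simp

theorem names_input (h : IsSol ar X D db V) (hO : Ordered D V els rk N) (har : ∀ p, ar p ≤ X.b) (hb : 2 ≤ X.b) :
    names (input X V els) = els.map fun x => 2 ^ rk x - 1 := by
  have hN := two_le_card hO
  have h0 := zero_mem_els h hO
  rw [names_eq (n := N) (by omega), ← hO.map, List.map_map]
  · rfl
  refine length_takeWhile (fun i hi => ?_) ?_
  · obtain ⟨x, hx, rfl⟩ := exists_rk hO.map hi
    have hl := append_mem (replicate_mem (n := X.b) h0) (cons_mem hx (a := 0) (l := []) (by simp [envs]))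
    have := input_getElem? hO hl true (V := V)
    rw [pos_append, pos_replicate_zero hO.zero] at this
    simp only [pos, zero_mul, List.length_nil, pow_zero, mul_one, add_zero, zero_add] at this
    rw [this, iff_true]
    obtain ⟨b, hb'⟩ := Nat.exists_eq_add_of_le' hb
    have e : List.replicate X.b 0 ++ [x] = 0 :: (List.replicate (X.b - 1) 0 ++ [x]) := by
      rw [hb', Nat.add_sub_assoc (by omega), List.replicate_succ]; rfl
    rw [e, bit_iff h hO har h0, ← e]
    · exact .inl ⟨x, rfl⟩
    · have := append_mem (replicate_mem (n := X.b - 1) h0) (cons_mem hx (a := 0) (l := []) (by simp [envs]))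
      rwa [Nat.sub_add_cancel (by omega)] at this
  · obtain ⟨u, hu, hu1⟩ := exists_rk hO.map (i := 1) (by omega)
    have hl := append_mem (replicate_mem (n := X.b - 2) h0) (cons_mem hu (cons_mem h0 (a := 0) (l := []) (by simp [envs])))
    rw [Nat.sub_add_cancel hb] at hl
    have h1 := input_getElem? hO (cons_mem h0 hl) false (V := V)
    have e : pos rk N (0 :: (List.replicate (X.b - 2) 0 ++ [u, 0])) = N := by
      simp [pos, pos_append, pos_replicate_zero hO.zero, hO.zero, hu1]
    rw [e] at h1
    rw [h1, bit_iff h hO har h0 hl, iff_false_right Bool.false_ne_true]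
    rintro (⟨y, hy⟩ | ⟨p, hp, -⟩)
    · have hlt := rk_lt hO.map (x := y) (by
        have := (mem_envs.1 (cons_mem h0 hl)).2 y
        rw [hy] at this
        exact this (by simp))
      rw [hy, pos_append, pos_replicate_zero hO.zero] at e
      simp [pos] at e
      omega
    · rw [hO.zero] at hp
      omega

theorem pow_sub_one_inj {a b : ℕ} (h : 2 ^ a - 1 = 2 ^ b - 1) : a = b := by
  have h1 := Nat.one_le_two_pow (n := a)
  have h2 := Nat.one_le_two_pow (n := b)
  exact Nat.pow_right_injective le_rfl (by simp only; omega)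

theorem decodeDB_input (h : IsSol ar X D db V) (hO : Ordered D V els rk N) (har : ∀ p, ar p ≤ X.b) (hb : 2 ≤ X.b)
    {π : ℕ ≃ ℕ} (hπ : ∀ x ∈ els, π x = 2 ^ rk x - 1) : {a | a ∈ decodeDB ar X.b (input X V els)} = renameDB π db := by
  have h0 := zero_mem_els h hO
  have hsel : ∀ l, l ∈ select (envs (names (input X V els)) (X.b + 1)) (input X V els) ↔
      ∃ l₀ ∈ envs els (X.b + 1), V (.inr .bit) l₀ ∧ l = l₀.map fun x => 2 ^ rk x - 1 := by
    intro l
    rw [mem_select, names_input h hO har hb, envs_map]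
    constructor
    · rintro ⟨i, h1, h2⟩
      rw [List.getElem?_map, Option.map_eq_some_iff] at h1
      obtain ⟨l₀, h3, rfl⟩ := h1
      rw [input, List.getElem?_map, h3, Option.map_some, Option.some_inj] at h2
      exact ⟨l₀, List.mem_of_getElem? h3, by simpa using h2, rfl⟩
    · rintro ⟨l₀, h1, h2, rfl⟩
      refine ⟨pos rk N l₀, ?_, ?_⟩
      · rw [List.getElem?_map, getElem_pos hO.map h1]; rfl
      · exact (input_getElem? hO h1 true).2 (iff_of_true h2 rfl)
  have hargs : ∀ l ∈ envs els X.b, ∀ p : Fin m, (⟨p, fun i => (l.map fun x => 2 ^ rk x - 1).getD i 0⟩ : GAtom (inSchema m ar) ℕ) =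
      ⟨p, fun i => π (l.getD i 0)⟩ := by
    intro l hl p
    refine congrArg (GAtom.mk (S := inSchema m ar) p) (funext fun i => ?_)
    have hi : i.val < l.length := by
      rw [(mem_envs.1 hl).1]
      exact i.2.trans_le (har p)
    rw [List.getD_eq_getElem _ _ (by simpa using hi), List.getD_eq_getElem _ _ hi, List.getElem_map,
      hπ _ ((mem_envs.1 hl).2 _ (List.getElem_mem hi))]
  ext a
  simp only [decodeDB, Set.mem_ofPred_eq, List.mem_flatMap, List.mem_finRange, true_and, List.mem_map, List.mem_filter,
    decide_eq_true_iff, hsel]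
  constructor
  · rintro ⟨p, l, ⟨⟨l₀, h1, h2, rfl⟩, h3⟩, rfl⟩
    rcases l₀ with _ | ⟨x, l⟩
    · simp [mem_envs] at h1
    have hx : x ∈ els := (mem_envs.1 h1).2 _ (by simp)
    have hl : l ∈ envs els X.b := mem_envs.2 ⟨by simpa using (mem_envs.1 h1).1, fun y hy => (mem_envs.1 h1).2 y (by simp [hy])⟩
    rw [List.map_cons, List.headD_cons] at h3
    replace h3 := pow_sub_one_inj h3
    rcases (bit_iff h hO har hx hl).1 h2 with ⟨y, hy⟩ | ⟨p', hp', hdb⟩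
    · obtain ⟨b, hb'⟩ := Nat.exists_eq_add_of_le' hb
      rw [hb', List.replicate_succ, List.cons_append, List.cons.injEq] at hy
      rw [hy.1, hO.zero] at h3
      omega
    · obtain rfl : p' = p := Fin.ext (by omega)
      refine ⟨_, hdb, ?_⟩
      simpa only [List.map_cons, List.getD_cons_succ] using hargs l hl p'
  · rintro ⟨⟨p, args⟩, ha, rfl⟩
    have hargs_mem : ∀ i, args i ∈ els := fun i => (hO.mem _).1 (h.dom.2.2 _ ha i)
    have hl : List.ofFn args ++ List.replicate (X.b - ar p) 0 ∈ envs els X.b := by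
      have := append_mem (mem_envs.2 ⟨List.length_ofFn (f := args), fun x hx => by
        obtain ⟨i, rfl⟩ := (List.mem_ofFn' _ _).1 hx
        exact hargs_mem i⟩) (replicate_mem (n := X.b - ar p) h0)
      rwa [show (inSchema m ar).ar p + (X.b - ar p) = X.b from Nat.add_sub_cancel' (har p)] at this
    have hget : ∀ i, (List.ofFn args ++ List.replicate (X.b - ar p) 0).getD i.val 0 = args i := fun i => by
      rw [List.getD_append _ _ _ _ (by simp), List.getD_eq_getElem _ _ (by simp), List.getElem_ofFn]
    have he : (⟨p, fun i => (List.ofFn args ++ List.replicate (X.b - ar p) 0).getD i 0⟩ : GAtom (inSchema m ar) ℕ) = ⟨p, args⟩ :=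
      congrArg (GAtom.mk (S := inSchema m ar) p) (funext hget)
    obtain ⟨x, hx, hxp⟩ := exists_rk hO.map (i := (p : Fin m).val + 1) (by
      have h1 := hO.card
      have h2 := (p : Fin m).isLt
      omega)
    refine ⟨p, _, ⟨⟨_, cons_mem hx hl, (bit_iff h hO har hx hl).2 (.inr ⟨p, hxp, he ▸ ha⟩), rfl⟩, ?_⟩, ?_⟩
    · rw [List.map_cons, List.headD_cons, hxp]
    · simp only [List.map_cons, List.getD_cons_succ]
      rw [hargs _ hl p]
      exact congrArg (GAtom.mk (S := inSchema m ar) p) (funext fun i => congrArg π (hget i))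

end DC

namespace DC

open Enc

section

variable {m : ℕ} {ar : Fin m → ℕ} {X : Par} {D : Set ℕ} {db : Set (GAtom (inSchema m ar) ℕ)}
  {V : Fin m ⊕ Pr X.M.q X.M.k → List ℕ → Prop}

theorem ans_iff_query (h : IsSol ar X D db V) (har : ∀ p, ar p ≤ X.b) (hb2 : 2 ≤ X.b) (hb : X.b + 1 ≤ X.d) (hk : X.k ≤ X.d)
    {Q : Query m ar X.k} (hQ : Generic Q) {g : List (List ℕ) → List (List ℕ)}
    (hg : ∀ dbl : List (GAtom (inSchema m ar) ℕ),
      ∃ out : List (Fin X.k → ℕ), g (dbl.map factList) = out.map List.ofFn ∧ ∀ t, t ∈ out ↔ t ∈ Q {a | a ∈ dbl})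
    {T : ℕ → ℕ} (hM : X.M.ComputesInTime (answer ar X.b X.k g) T) (hT : ∀ n, 2 ≤ n → T (n ^ (X.b + 1)) < n ^ X.d)
    (t : Fin X.k → ℕ) : V (.inr .ans) (List.ofFn t) ↔ t ∈ Q db := by
  obtain ⟨els, rk, h1, h2, h3, h4, h5⟩ := h.exists_order
  have hO : Ordered D V els rk els.length := ⟨h1, h2, h3, h4, h5⟩
  obtain ⟨π, hπ⟩ := exists_perm (f := fun x => 2 ^ rk x - 1) (s := els.toFinset) fun x hx y hy e =>
    rk_inj h1 (by simpa using hx) (by simpa using hy) (pow_sub_one_inj e)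
  replace hπ : ∀ x ∈ els, π x = 2 ^ rk x - 1 := fun x hx => hπ x (by simpa using hx)
  obtain ⟨out, ho, hout⟩ := hg (decodeDB ar X.b (input X V els))
  rw [decodeDB_input h hO har hb2 hπ] at hout
  obtain ⟨n, hn, c, hc, hy⟩ := hM (input X V els)
  have hlen : (answer ar X.b X.k g (input X V els)).length = els.length ^ X.k := by
    rw [answer, List.length_map, names_input h hO har hb2, envs_map, List.length_map, length_envs h1]
  rw [length_input hO] at hn
  rw [ans_iff_output h hO hb hk hc (hn.trans_lt (hT _ (two_le_card hO))) hy hlen (List.length_ofFn (f := t))]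
  have hmem (hl : List.ofFn t ∈ envs els X.k) : (answer ar X.b X.k g (input X V els))[pos rk els.length (List.ofFn t)]? = some true ↔
      t ∈ Q db := by
    rw [answer, names_input h hO har hb2, envs_map, List.map_map, List.getElem?_map, getElem_pos h1 hl, Option.map_some,
      Option.some_inj, Function.comp_apply, decide_eq_true_iff, ho, ← mem_query_iff hQ π, ← hout]
    have e : (List.ofFn t).map (fun x => 2 ^ rk x - 1) = List.ofFn fun i => π (t i) := by
      rw [List.map_ofFn]
      exact congrArg List.ofFn (funext fun i => (hπ _ ((mem_envs.1 hl).2 _ (by simp))).symm)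
    rw [e, List.mem_map_of_injective List.ofFn_injective]
  refine ⟨fun ⟨hl, ht⟩ => (hmem hl).1 ht, fun ht => ?_⟩
  suffices hl : List.ofFn t ∈ envs els X.k from ⟨hl, (hmem hl).2 ht⟩
  have hfin : (Q db).Finite := by
    refine ((List.finite_toSet out).preimage (f := fun s i => π (s i)) fun s _ s' _ e =>
      funext fun i => π.injective (congrFun e i)).subset fun s hs => ?_
    exact (hout _).2 ((mem_query_iff hQ π db s).2 hs)
  refine mem_envs.2 ⟨List.length_ofFn, fun x hx => ?_⟩
  obtain ⟨i, rfl⟩ := (List.mem_ofFn' _ _).1 hx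
  exact (h4 _).1 (mem_dom_of_mem_query hQ hfin h.dom.1 h.dom.2.2 ht i)

end

theorem expressible_of_dbPTime {m : ℕ} {ar : Fin m → ℕ} {k : ℕ} {Q : Query m ar k} (hQ : Generic Q) (h : DBPTime Q) :
    ExpressibleChoice Q := by
  obtain ⟨g, hg, hgQ⟩ := (dbPTime_iff Q).1 h
  obtain ⟨b, hb2, har⟩ : ∃ b, 2 ≤ b ∧ ∀ p, ar p ≤ b :=
    ⟨2 + ∑ p, ar p, by omega, fun p => (Finset.single_le_sum (f := ar) (fun _ _ => Nat.zero_le _) (Finset.mem_univ p)).trans (by omega)⟩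
  obtain ⟨M, p, hM⟩ := (PT.answer ar b k hg).polyTime
  obtain ⟨d₀, hd₀⟩ := exists_pow_bound (p.comp (Polynomial.X ^ (b + 1)))
  let X : Par := ⟨k, M, b, max d₀ (max (b + 1) k)⟩
  have hbd : X.b + 1 ≤ X.d := (le_max_left _ _).trans (le_max_right _ _)
  have hkd : X.k ≤ X.d := (le_max_right _ _).trans (le_max_right _ _)
  have hT : ∀ n, 2 ≤ n → p.eval (n ^ (X.b + 1)) < n ^ X.d := fun n hn => by
    have := hd₀ n hn
    rw [Polynomial.eval_comp, Polynomial.eval_pow, Polynomial.eval_X] at this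
    exact this.trans_le (Nat.pow_le_pow_right (by omega) (le_max_left _ _))
  obtain ⟨σ, hσ⟩ := stratifiedBy_prog (ar := ar) (X := X)
  have hk : auxAr X (Fintype.equivFin _ Pr.ans) = k := by simp [auxAr, prAr, X]
  refine ⟨_, auxAr X, prog ar X, σ, Fintype.equivFin _ Pr.ans, hk, head_prog, hσ, fun db hdb => ⟨?_, fun S hS t => ?_⟩⟩
  · obtain ⟨T, -, hex⟩ := exists_stable (prog ar X) σ hσ
    obtain ⟨S, hS, -⟩ := hex hdb.toFinset.toList
    have e : {a | a ∈ hdb.toFinset.toList} = db := by ext; simp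
    rw [e] at hS
    exact ⟨S, hS⟩
  · rw [← ans_iff_query (isSol_of_stable hbd hdb hS) har hb2 hbd hkd hQ hgQ hM hT t]
    have e : (⟨Sum.inr (Fintype.equivFin _ Pr.ans), fun i => t (Fin.cast hk i)⟩ : GAtom (fullSchema ar X) ℕ) =
        toGAtom ar X (.inr .ans) (List.ofFn t) := by
      refine congrArg (GAtom.mk (S := fullSchema ar X) (Sum.inr (Fintype.equivFin _ Pr.ans))) (funext fun i => ?_)
      have hi : i.val < k := i.2.trans_eq hk
      rw [List.getD_eq_getElem _ _ (by simpa using hi), List.getElem_ofFn]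
      rfl
    rw [e]

end DC

/-- (1) Stratified Datalog with choice expresses exactly the
(generic) DB-PTIME queries.  (2) In contrast, stratified Datalog without
choice (on unordered databases, where by genericity no predefined total order
of the universe is available) cannot express all DB-PTIME queries: some
generic DB-PTIME query is not expressible without choice. -/
theorem stratified_datalog_with_choice_captures_db_ptime :
    (∀ (m : ℕ) (ar : Fin m → ℕ) (k : ℕ) (Q : Query m ar k), Generic Q →
      (DBPTime Q ↔ ExpressibleChoice Q)) ∧
    (∃ (m : ℕ) (ar : Fin m → ℕ) (k : ℕ) (Q : Query m ar k),
      Generic Q ∧ DBPTime Q ∧ ¬ ExpressibleNoChoice Q) :=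
  ⟨fun _ _ _ _ hQ => ⟨DC.expressible_of_dbPTime hQ, DC.dbPTime_of_expressible⟩,
    1, fun _ => 1, 0, DC.parityQuery, DC.generic_parityQuery, DC.dbPTime_parityQuery, DC.not_expressible_parityQuery⟩
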